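/- Let P ⊂ ℝ³ be a 3-dimensional simple integral convex polytope with edges E_1, …, E_m and facets F_1, …, F_n. Then there exist rational numbers c_3 and c_2 such that for every nonnegative integer l, the number of lattice points |(lP) ∩ ℤ³| equals c_3 l³ + c_2 l² + c_1 l + 1, where c_1 = Σ_{j=1}^m (s(E_j) + 1/4)·Vol(E_j) + (1/12)·Σ_{k=1}^n C(F_k). -/

import Mathlib

open scoped Pointwise

noncomputable section

/-- The real vector corresponding to an integer vector. -/
def toR (v : Fin 3 → ℤ) : Fin 3 → ℝ := fun i => (v i : ℝ)

/-- The standard inner product on `ℝ³`. -/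
def inner3 (u v : Fin 3 → ℝ) : ℝ := ∑ i, u i * v i

/-- The determinant of the 3×3 matrix whose columns are the vectors `u, v, w ∈ ℝ³`. -/
def det3 (u v w : Fin 3 → ℝ) : ℝ := Matrix.det (Matrix.transpose (Matrix.of ![u, v, w]))

/-- A vector in `ℤ³` is primitive if the gcd of its coordinates is `1`. -/
def IsPrimitive (v : Fin 3 → ℤ) : Prop := Int.gcd (v 0) (Int.gcd (v 1) (v 2)) = 1

/-- The gcd of the coordinates of an integer vector. -/
def gcd3 (v : Fin 3 → ℤ) : ℕ := Int.gcd (v 0) (Int.gcd (v 1) (v 2))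

/-- `toR` as an additive group homomorphism. -/
def toRhom : (Fin 3 → ℤ) →+ (Fin 3 → ℝ) where
  toFun := toR
  map_zero' := by funext i; simp [toR]
  map_add' x y := by funext i; simp [toR]

/-- The lattice `(ℝv + ℝw) ∩ ℤ³`, as an additive subgroup of `ℤ³`. -/
def planeLattice (v w : Fin 3 → ℤ) : AddSubgroup (Fin 3 → ℤ) :=
  AddSubgroup.comap toRhom (Submodule.span ℝ {toR v, toR w}).toAddSubgroup

/-- `m(E)` for an edge `E = F ∩ F'` with primitive inward normals `v, w`:
the index `|((ℝv + ℝw) ∩ ℤ³)/(ℤv + ℤw)|`. -/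
def mIndex (v w : Fin 3 → ℤ) : ℕ :=
  ((AddSubgroup.closure ({v, w} : Set (Fin 3 → ℤ))).addSubgroupOf (planeLattice v w)).index

/-- A (nonempty exposed) face of `P ⊂ ℝ³`. -/
def IsFaceOf (P F : Set (Fin 3 → ℝ)) : Prop :=
  F.Nonempty ∧ ∃ w : Fin 3 → ℝ, F = {x ∈ P | ∀ y ∈ P, inner3 w y ≤ inner3 w x}

/-- The dimension of a face, i.e. the rank of the direction of its affine span. -/
def faceDim (F : Set (Fin 3 → ℝ)) : ℕ := Module.finrank ℝ (vectorSpan ℝ F)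

/-- `x` is a vertex of `P`, i.e. `{x}` is a face of `P`. -/
def IsVertexOf (P : Set (Fin 3 → ℝ)) (x : Fin 3 → ℝ) : Prop := IsFaceOf P {x}

/-- `E` is an edge of `P`, i.e. a face of dimension `1`. -/
def IsEdgeOf (P E : Set (Fin 3 → ℝ)) : Prop := IsFaceOf P E ∧ faceDim E = 1

/-- `F` is a facet of `P`, i.e. a face of dimension `2`. -/
def IsFacetOf (P F : Set (Fin 3 → ℝ)) : Prop := IsFaceOf P F ∧ faceDim F = 2

/-- A 3-dimensional polytope is simple if every vertex lies on exactly `3` facets. -/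
def IsSimple (P : Set (Fin 3 → ℝ)) : Prop :=
  ∀ x : Fin 3 → ℝ, IsVertexOf P x → {F : Set (Fin 3 → ℝ) | IsFacetOf P F ∧ x ∈ F}.ncard = 3

/-- `v` is the inward-pointing primitive integral normal vector of the facet `F` of `P`. -/
def IsInwardNormal (P F : Set (Fin 3 → ℝ)) (v : Fin 3 → ℤ) : Prop :=
  IsPrimitive v ∧ ∀ u ∈ F, ∀ u' ∈ P, 0 ≤ inner3 (toR v) (u' - u)

/-- `ε_i = det(v, v_{k_{i+1}}, v_{k_i})`. -/
def epsF (vF : Fin 3 → ℤ) (vk : ℕ → Fin 3 → ℤ) (i : ℕ) : ℝ :=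
  det3 (toR vF) (toR (vk (i + 1))) (toR (vk i))

/-- `a_i = ⟨P_{i-1}Q_{i-1}, v_{k_{i+1}}⟩ / (ε_i ⟨P_{i-1}Q_{i-1}, v⟩)`. -/
def aF (vF : Fin 3 → ℤ) (vk : ℕ → Fin 3 → ℤ) (Pt : ℕ → Fin 3 → ℤ) (Q : ℕ → Fin 3 → ℝ)
    (i : ℕ) : ℝ :=
  inner3 (Q (i - 1) - toR (Pt (i - 1))) (toR (vk (i + 1))) /
    (epsF vF vk i * inner3 (Q (i - 1) - toR (Pt (i - 1))) (toR vF))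

/-- `b_i = ⟨P_iP_{i+1}, v_{k_{i-1}}⟩ / (ε_{i-1} ⟨P_iP_{i+1}, v_{k_i}⟩)`. -/
def bF (vF : Fin 3 → ℤ) (vk : ℕ → Fin 3 → ℤ) (Pt : ℕ → Fin 3 → ℤ) (i : ℕ) : ℝ :=
  inner3 (toR (Pt (i + 1)) - toR (Pt i)) (toR (vk (i - 1))) /
    (epsF vF vk (i - 1) * inner3 (toR (Pt (i + 1)) - toR (Pt i)) (toR (vk i)))

/-- `triDet b ε s t` is the determinant of the tridiagonal matrix with diagonal entries
`b s, …, b t` and sub- and super-diagonal entries `(ε s)⁻¹, …, (ε (t-1))⁻¹`, with the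
convention `triDet b ε s t = 1` when `s > t`. -/
def triDet (b ε : ℕ → ℝ) (s t : ℕ) : ℝ :=
  if t < s then 1
  else Matrix.det (Matrix.of fun k l : Fin (t + 1 - s) =>
    if (k : ℕ) = (l : ℕ) then b (s + (k : ℕ))
    else if (k : ℕ) + 1 = (l : ℕ) ∨ (l : ℕ) + 1 = (k : ℕ) then
      (ε (s + min (k : ℕ) (l : ℕ)))⁻¹
    else 0)

/-- `C(F) = -∑_{2 ≤ i < j ≤ r} a_i D(i+1, j-1) ε_i ε_{i+1} ⋯ ε_{j-1}
Vol(P_{j-1}P_j)/m(P_{j-1}P_j)`, computed from the labeling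
(vertices `Pt`, adjacent facet normals `vk`, points `Q`) around a facet with
inward primitive normal `vF` and `r` vertices. -/
def CFacet (vF : Fin 3 → ℤ) (Pt : ℕ → Fin 3 → ℤ) (vk : ℕ → Fin 3 → ℤ) (Q : ℕ → Fin 3 → ℝ)
    (r : ℕ) : ℝ :=
  -∑ i ∈ Finset.Icc 2 r, ∑ j ∈ Finset.Icc (i + 1) r,
      aF vF vk Pt Q i * triDet (bF vF vk Pt) (epsF vF vk) (i + 1) (j - 1) *
        (∏ k ∈ Finset.Icc i (j - 1), epsF vF vk k) *
        ((gcd3 (Pt j - Pt (j - 1)) : ℝ) / (mIndex vF (vk j) : ℝ))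

/-- A labeling of the vertices `P_1, …, P_r` (in cyclic order), the adjacent facets
`F_{k_1}, …, F_{k_r}` (`F_{k_i}` meets `F` along the edge `P_{i-1}P_i`), their inward
primitive normals `v_{k_1}, …, v_{k_r}`, and the points `Q_1, …, Q_r` (`Q_i` is the endpoint
other than `P_i` of the unique edge of `P` emanating from `P_i` not contained in `F`)
around a facet `F` of `P` with inward primitive normal `vF`; all data is indexed by `ℕ`,
periodically with period `r`. -/
structure FacetLabeling (P F : Set (Fin 3 → ℝ)) (vF : Fin 3 → ℤ) (r : ℕ)
    (Pt : ℕ → Fin 3 → ℤ) (Fk : ℕ → Set (Fin 3 → ℝ)) (vk : ℕ → Fin 3 → ℤ)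
    (Q : ℕ → Fin 3 → ℝ) : Prop where
  three_le : 3 ≤ r
  Pt_periodic : ∀ i, Pt (i + r) = Pt i
  Fk_periodic : ∀ i, Fk (i + r) = Fk i
  vk_periodic : ∀ i, vk (i + r) = vk i
  Q_periodic : ∀ i, Q (i + r) = Q i
  Pt_injOn : ∀ i ∈ Finset.Icc 1 r, ∀ j ∈ Finset.Icc 1 r, Pt i = Pt j → i = j
  Pt_vertex : ∀ i ∈ Finset.Icc 1 r, IsVertexOf P (toR (Pt i))
  F_eq_hull : F = convexHull ℝ ((fun i => toR (Pt i)) '' Set.Icc 1 r)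
  Fk_facet : ∀ i ∈ Finset.Icc 1 r, IsFacetOf P (Fk i)
  Fk_meets_F : ∀ i ∈ Finset.Icc 1 r, F ∩ Fk i = segment ℝ (toR (Pt (i - 1))) (toR (Pt i))
  vk_normal : ∀ i ∈ Finset.Icc 1 r, IsInwardNormal P (Fk i) (vk i)
  Q_edge : ∀ i ∈ Finset.Icc 1 r,
    IsEdgeOf P (segment ℝ (toR (Pt i)) (Q i)) ∧ Q i ∉ F ∧ Q i ≠ toR (Pt i)

/-- `(e₁, e₂)` is a `ℤ`-basis of the subgroup `L` of `ℤ³`. -/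
def IsZBasisOf (L : AddSubgroup (Fin 3 → ℤ)) (e₁ e₂ : Fin 3 → ℤ) : Prop :=
  e₁ ∈ L ∧ e₂ ∈ L ∧ LinearIndependent ℤ ![e₁, e₂] ∧
    ∀ w ∈ L, ∃ m n : ℤ, w = m • e₁ + n • e₂

/-- The sawtooth function `((x))`: equal to `x - ⌊x⌋ - 1/2` if `x ∉ ℤ`, and `0` if `x ∈ ℤ`. -/
def saw (x : ℚ) : ℚ := if x.den = 1 then 0 else x - ⌊x⌋ - 1 / 2

/-- The Dedekind sum `s(p, q) = ∑_{i=1}^q ((i/q)) ((p i / q))`. -/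
def dedekindSum (p q : ℤ) : ℚ :=
  ∑ i ∈ Finset.Icc (1 : ℤ) q, saw ((i : ℚ) / (q : ℚ)) * saw ((p : ℚ) * (i : ℚ) / (q : ℚ))

/-- The number of lattice points of the dilated polytope `lP`, i.e. `|(lP) ∩ ℤ³|`. -/
def latticeCount (P : Set (Fin 3 → ℝ)) (l : ℕ) : ℕ :=
  Set.ncard {p : Fin 3 → ℤ | toR p ∈ (l : ℝ) • P}

section

/-! ### Elementary vector algebra -/

def dt {R : Type*} [CommRing R] (a b : Fin 3 → R) : R := a 0 * b 0 + a 1 * b 1 + a 2 * b 2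

def cr {R : Type*} [CommRing R] (a b : Fin 3 → R) : Fin 3 → R :=
  ![a 1 * b 2 - a 2 * b 1, a 2 * b 0 - a 0 * b 2, a 0 * b 1 - a 1 * b 0]

section vec
variable {R : Type*} [CommRing R]

@[simp] theorem cr_0 (a b : Fin 3 → R) : cr a b 0 = a 1 * b 2 - a 2 * b 1 := rfl
@[simp] theorem cr_1 (a b : Fin 3 → R) : cr a b 1 = a 2 * b 0 - a 0 * b 2 := rfl
@[simp] theorem cr_2 (a b : Fin 3 → R) : cr a b 2 = a 0 * b 1 - a 1 * b 0 := rfl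

theorem vec_ext {a b : Fin 3 → R} (h0 : a 0 = b 0) (h1 : a 1 = b 1) (h2 : a 2 = b 2) : a = b := by
  funext i; fin_cases i <;> assumption

theorem dt_comm (a b : Fin 3 → R) : dt a b = dt b a := by simp only [dt]; ring
theorem dt_add (a b c : Fin 3 → R) : dt a (b + c) = dt a b + dt a c := by
  simp only [dt, Pi.add_apply]; ring
theorem dt_sub (a b c : Fin 3 → R) : dt a (b - c) = dt a b - dt a c := by
  simp only [dt, Pi.sub_apply]; ring
theorem dt_smul (t : R) (a b : Fin 3 → R) : dt a (t • b) = t * dt a b := by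
  simp only [dt, Pi.smul_apply, smul_eq_mul]; ring
theorem dt_neg (a b : Fin 3 → R) : dt a (-b) = - dt a b := by
  simp only [dt, Pi.neg_apply]; ring
theorem dt_zero (a : Fin 3 → R) : dt a 0 = 0 := by simp [dt]
theorem add_dt (a b c : Fin 3 → R) : dt (b + c) a = dt b a + dt c a := by
  simp only [dt, Pi.add_apply]; ring
theorem sub_dt (a b c : Fin 3 → R) : dt (b - c) a = dt b a - dt c a := by
  simp only [dt, Pi.sub_apply]; ring
theorem smul_dt (t : R) (a b : Fin 3 → R) : dt (t • a) b = t * dt a b := by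
  simp only [dt, Pi.smul_apply, smul_eq_mul]; ring
theorem neg_dt (a b : Fin 3 → R) : dt (-a) b = - dt a b := by
  simp only [dt, Pi.neg_apply]; ring
theorem dt_cr_left (a b : Fin 3 → R) : dt a (cr a b) = 0 := by
  simp only [dt, cr_0, cr_1, cr_2]; ring
theorem dt_cr_right (a b : Fin 3 → R) : dt b (cr a b) = 0 := by
  simp only [dt, cr_0, cr_1, cr_2]; ring
theorem cr_dt_left (a b : Fin 3 → R) : dt (cr a b) a = 0 := by
  simp only [dt, cr_0, cr_1, cr_2]; ring
theorem cr_dt_right (a b : Fin 3 → R) : dt (cr a b) b = 0 := by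
  simp only [dt, cr_0, cr_1, cr_2]; ring
theorem cr_anti (a b : Fin 3 → R) : cr b a = - cr a b := by
  apply vec_ext <;> simp only [Pi.neg_apply, cr_0, cr_1, cr_2] <;> ring
theorem cr_neg_left (a b : Fin 3 → R) : cr (-a) b = - cr a b := by
  apply vec_ext <;> simp only [Pi.neg_apply, cr_0, cr_1, cr_2] <;> ring
theorem cr_neg_right (a b : Fin 3 → R) : cr a (-b) = - cr a b := by
  apply vec_ext <;> simp only [Pi.neg_apply, cr_0, cr_1, cr_2] <;> ring
/-- `a × (b × c)`. -/
theorem cr_cr (a b c : Fin 3 → R) : cr a (cr b c) = dt a c • b - dt a b • c := by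
  apply vec_ext <;> simp only [Pi.sub_apply, Pi.smul_apply, smul_eq_mul, dt, cr_0, cr_1, cr_2] <;> ring
theorem dt_cr_cycle (a b c : Fin 3 → R) : dt (cr a b) c = dt (cr b c) a := by
  simp only [dt, cr_0, cr_1, cr_2]; ring
theorem dt_cr_swap (a b c : Fin 3 → R) : dt (cr b a) c = - dt (cr a b) c := by
  simp only [dt, cr_0, cr_1, cr_2]; ring
theorem cr_smul_left (t : R) (a b : Fin 3 → R) : cr (t • a) b = t • cr a b := by
  apply vec_ext <;> simp only [Pi.smul_apply, smul_eq_mul, cr_0, cr_1, cr_2] <;> ring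
theorem cr_smul_right (t : R) (a b : Fin 3 → R) : cr a (t • b) = t • cr a b := by
  apply vec_ext <;> simp only [Pi.smul_apply, smul_eq_mul, cr_0, cr_1, cr_2] <;> ring
/-- Cramer's rule for a vector -/
theorem cramer (a b c x : Fin 3 → R) :
    dt (cr a b) c • x = dt (cr b c) x • a + dt (cr c a) x • b + dt (cr a b) x • c := by
  apply vec_ext <;>
  simp only [Pi.add_apply, Pi.smul_apply, smul_eq_mul, dt, cr_0, cr_1, cr_2] <;> ring
/-- Dual Cramer -/
theorem cramer_dual (a b c x : Fin 3 → R) :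
    dt (cr a b) c • x = dt a x • cr b c + dt b x • cr c a + dt c x • cr a b := by
  apply vec_ext <;>
  simp only [Pi.add_apply, Pi.smul_apply, smul_eq_mul, dt, cr_0, cr_1, cr_2] <;> ring
end vec

theorem toR_add (a b : Fin 3 → ℤ) : toR (a + b) = toR a + toR b := by
  funext i; simp [toR]
theorem toR_sub (a b : Fin 3 → ℤ) : toR (a - b) = toR a - toR b := by
  funext i; simp [toR]
theorem toR_neg (a : Fin 3 → ℤ) : toR (-a) = - toR a := by
  funext i; simp [toR]
theorem toR_smul (t : ℤ) (a : Fin 3 → ℤ) : toR (t • a) = (t : ℝ) • toR a := by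
  funext i; simp [toR]
theorem toR_cr (a b : Fin 3 → ℤ) : toR (cr a b) = cr (toR a) (toR b) := by
  apply vec_ext <;> simp [toR]
theorem dt_toR (a b : Fin 3 → ℤ) : dt (toR a) (toR b) = ((dt a b : ℤ) : ℝ) := by
  simp [toR, dt]
theorem toR_inj {a b : Fin 3 → ℤ} (h : toR a = toR b) : a = b := by
  funext i; have := congrFun h i; simpa [toR] using this
theorem inner3_eq (a b : Fin 3 → ℝ) : inner3 a b = dt a b := by
  simp [inner3, dt, Fin.sum_univ_three]
theorem det3_eq (a b c : Fin 3 → ℝ) : det3 a b c = dt (cr a b) c := by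
  simp [det3, dt, Matrix.det_fin_three]; ring
theorem dt_self_pos {a : Fin 3 → ℝ} (h : a ≠ 0) : 0 < dt a a := by
  by_contra hn
  apply h
  simp only [dt] at hn
  have h0 : a 0 = 0 := by nlinarith [mul_self_nonneg (a 0), mul_self_nonneg (a 1), mul_self_nonneg (a 2)]
  have h1 : a 1 = 0 := by nlinarith [mul_self_nonneg (a 0), mul_self_nonneg (a 1), mul_self_nonneg (a 2)]
  have h2 : a 2 = 0 := by nlinarith [mul_self_nonneg (a 0), mul_self_nonneg (a 1), mul_self_nonneg (a 2)]
  exact vec_ext (by simpa) (by simpa) (by simpa)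

/-! ### gcd -/

theorem gcd3_dvd (v : Fin 3 → ℤ) (i : Fin 3) : (gcd3 v : ℤ) ∣ v i := by
  unfold gcd3
  have h2 : ((Int.gcd (v 0) (Int.gcd (v 1) (v 2)) : ℕ) : ℤ) ∣ ((Int.gcd (v 1) (v 2) : ℕ) : ℤ) :=
    Int.gcd_dvd_right ..
  fin_cases i
  · exact Int.gcd_dvd_left ..
  · exact h2.trans (Int.gcd_dvd_left ..)
  · exact h2.trans (Int.gcd_dvd_right ..)

theorem gcd3_bezout (v : Fin 3 → ℤ) : ∃ y : Fin 3 → ℤ, dt v y = gcd3 v := by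
  have h1 := Int.gcd_eq_gcd_ab (v 1) (v 2)
  have h0 := Int.gcd_eq_gcd_ab (v 0) (Int.gcd (v 1) (v 2) : ℕ)
  refine ⟨![Int.gcdA (v 0) (Int.gcd (v 1) (v 2) : ℕ),
    Int.gcdB (v 0) (Int.gcd (v 1) (v 2) : ℕ) * Int.gcdA (v 1) (v 2),
    Int.gcdB (v 0) (Int.gcd (v 1) (v 2) : ℕ) * Int.gcdB (v 1) (v 2)], ?_⟩
  unfold gcd3
  rw [h0, dt]
  simp
  generalize Int.gcdB (v 0) _ = u
  rw [h1]; ring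

theorem dvd_gcd3 {v : Fin 3 → ℤ} {d : ℤ} (h : ∀ i, d ∣ v i) : d ∣ gcd3 v := by
  obtain ⟨y, hy⟩ := gcd3_bezout v
  rw [← hy, dt]
  exact dvd_add (dvd_add ((h 0).mul_right _) ((h 1).mul_right _)) ((h 2).mul_right _)

theorem prim_bezout {v : Fin 3 → ℤ} (h : IsPrimitive v) : ∃ y : Fin 3 → ℤ, dt v y = 1 := by
  obtain ⟨y, hy⟩ := gcd3_bezout v
  exact ⟨y, by rw [hy]; exact_mod_cast h⟩

theorem prim_of_bezout {v y : Fin 3 → ℤ} (h : dt v y = 1) : IsPrimitive v := by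
  have : (gcd3 v : ℤ) ∣ 1 := by
    rw [← h, dt]
    exact dvd_add (dvd_add ((gcd3_dvd v 0).mul_right _) ((gcd3_dvd v 1).mul_right _))
      ((gcd3_dvd v 2).mul_right _)
  have h2 : gcd3 v = 1 := by
    have := Int.eq_one_of_dvd_one (by positivity) this
    exact_mod_cast this
  exact h2

theorem prim_ne_zero {v : Fin 3 → ℤ} (h : IsPrimitive v) : v ≠ 0 := by
  rintro rfl
  obtain ⟨y, hy⟩ := prim_bezout h
  simp [dt] at hy

theorem prim_neg {v : Fin 3 → ℤ} (h : IsPrimitive v) : IsPrimitive (-v) := by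
  obtain ⟨y, hy⟩ := prim_bezout h
  exact prim_of_bezout (y := -y) (by rw [neg_dt, dt_neg, hy]; ring)

theorem gcd3_pos {v : Fin 3 → ℤ} (h : v ≠ 0) : 0 < gcd3 v := by
  rw [Nat.pos_iff_ne_zero]
  intro h0
  apply h
  funext i
  have := gcd3_dvd v i
  rw [h0] at this
  simpa using this

/-- Every nonzero vector is `gcd` times a primitive one. -/
theorem exists_prim {v : Fin 3 → ℤ} (h : v ≠ 0) :
    ∃ f : Fin 3 → ℤ, IsPrimitive f ∧ v = (gcd3 v : ℤ) • f := by
  have hp := gcd3_pos h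
  choose f hf using gcd3_dvd v
  refine ⟨f, ?_, by funext i; simp [← hf i]⟩
  obtain ⟨y, hy⟩ := gcd3_bezout v
  apply prim_of_bezout (y := y)
  have h2 : v = (gcd3 v : ℤ) • f := by funext i; simp [← hf i]
  have h3 : dt v y = (gcd3 v : ℤ) * dt f y := by conv_lhs => rw [h2, smul_dt]
  rw [hy] at h3
  have : (gcd3 v : ℤ) ≠ 0 := by exact_mod_cast hp.ne'
  have := mul_left_cancel₀ this (show (gcd3 v : ℤ) * dt f y = (gcd3 v : ℤ) * 1 by rw [← h3, mul_one])
  exact this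

theorem gcd3_smul_prim {f : Fin 3 → ℤ} (hf : IsPrimitive f) (t : ℤ) : (gcd3 (t • f) : ℤ) = |t| := by
  apply Int.dvd_antisymm (by positivity) (by positivity)
  · rw [dvd_abs]
    obtain ⟨y, hy⟩ := prim_bezout hf
    have : dt (t • f) y = t := by rw [smul_dt, hy, mul_one]
    have h2 : (gcd3 (t • f) : ℤ) ∣ dt (t • f) y := by
      rw [dt]
      exact dvd_add (dvd_add ((gcd3_dvd _ 0).mul_right _) ((gcd3_dvd _ 1).mul_right _))
        ((gcd3_dvd _ 2).mul_right _)
    rwa [this] at h2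
  · apply dvd_gcd3; intro i; rw [abs_dvd]; simp

theorem gcd3_neg (v : Fin 3 → ℤ) : gcd3 (-v) = gcd3 v := by
  simp [gcd3]

theorem gcd3_sub_comm (a b : Fin 3 → ℤ) : gcd3 (a - b) = gcd3 (b - a) := by
  rw [← gcd3_neg, neg_sub]

theorem prim_dvd {v : Fin 3 → ℤ} (h : IsPrimitive v) {q k : ℤ} (hd : ∀ i, q ∣ k * v i) : q ∣ k := by
  obtain ⟨y, hy⟩ := prim_bezout h
  have : k = k * dt v y := by rw [hy, mul_one]
  rw [this, dt, mul_add, mul_add, ← mul_assoc, ← mul_assoc, ← mul_assoc]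
  exact dvd_add (dvd_add ((hd 0).mul_right _) ((hd 1).mul_right _)) ((hd 2).mul_right _)

/-- A vector parallel to a primitive one is an integer multiple. -/
theorem prim_parallel {v w : Fin 3 → ℤ} (h : IsPrimitive v) (hc : cr v w = 0) :
    ∃ t : ℤ, w = t • v := by
  obtain ⟨y, hy⟩ := prim_bezout h
  refine ⟨dt w y, ?_⟩
  have h2 := cr_cr y v w
  rw [hc] at h2
  have h3 : cr y (0 : Fin 3 → ℤ) = 0 := by apply vec_ext <;> simp
  rw [h3, dt_comm y v, hy, one_smul, dt_comm y w] at h2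
  exact (sub_eq_zero.1 h2.symm).symm

theorem prim_eq_or_neg {v w : Fin 3 → ℤ} (h : IsPrimitive v) (h' : IsPrimitive w)
    (hc : cr v w = 0) : w = v ∨ w = -v := by
  obtain ⟨t, rfl⟩ := prim_parallel h hc
  have := gcd3_smul_prim h t
  have h2 : gcd3 (t • v) = 1 := h'
  rw [h2] at this
  rcases abs_eq (by norm_num : (0:ℤ) ≤ 1) |>.1 this.symm with h | h
  · left; simp [h]
  · right; simp [h]

/-- for primitive `v` and any `w` there is `p` with `w ≡ p v` modulo `gcd (v × w)`. -/
theorem exists_residue {v : Fin 3 → ℤ} (w : Fin 3 → ℤ) (h : IsPrimitive v) :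
    ∃ p : ℤ, ∀ i, (gcd3 (cr v w) : ℤ) ∣ w i - p * v i := by
  obtain ⟨y, hy⟩ := prim_bezout h
  refine ⟨dt y w, fun i => ?_⟩
  have h2 := cr_cr y v w
  rw [dt_comm y v, hy, one_smul] at h2
  have h3 : w i - dt y w * v i = - cr y (cr v w) i := by
    rw [h2]; simp
  rw [h3, dvd_neg]
  have hd := gcd3_dvd (cr v w)
  generalize cr v w = z at *
  fin_cases i
  · exact dvd_sub ((hd 2).mul_left _) ((hd 1).mul_left _)
  · exact dvd_sub ((hd 0).mul_left _) ((hd 2).mul_left _)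
  · exact dvd_sub ((hd 1).mul_left _) ((hd 0).mul_left _)

end

section

/-! ### Sawtooth functions -/

/-- A one-sided sawtooth function; the side is chosen by the sign of `r`. -/
def Bf (r y : ℝ) : ℝ := if 0 < r then Int.fract y - 1 / 2 else 1 / 2 - Int.fract (-y)

theorem Bf_pos {r : ℝ} (h : 0 < r) (y : ℝ) : Bf r y = Int.fract y - 1 / 2 := if_pos h
theorem Bf_nonpos {r : ℝ} (h : ¬ 0 < r) (y : ℝ) : Bf r y = 1 / 2 - Int.fract (-y) := if_neg h

theorem Bf_congr {r r' : ℝ} (h : 0 < r ↔ 0 < r') (y : ℝ) : Bf r y = Bf r' y := by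
  unfold Bf; simp only [h]

theorem Bf_add_int (r y : ℝ) (n : ℤ) : Bf r (y + n) = Bf r y := by
  unfold Bf
  rw [show -(y + (n : ℝ)) = -y + ((-n : ℤ) : ℝ) by push_cast; ring, Int.fract_add_intCast,
    Int.fract_add_intCast]

theorem Bf_neg {r : ℝ} (h : r ≠ 0) (y : ℝ) : Bf (-r) (-y) = - Bf r y := by
  rcases lt_or_gt_of_ne h with h | h
  · rw [Bf_pos (show 0 < -r by linarith), Bf_nonpos (by linarith)]; ring
  · rw [Bf_nonpos (show ¬ 0 < -r by linarith), Bf_pos h, neg_neg]; ring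

theorem Bf_le (r y : ℝ) : Bf r y ≤ 1 / 2 := by
  unfold Bf
  split_ifs
  · have := Int.fract_lt_one y; linarith
  · have := Int.fract_nonneg (-y); linarith

theorem le_Bf (r y : ℝ) : -(1 / 2) ≤ Bf r y := by
  unfold Bf
  split_ifs
  · have := Int.fract_nonneg y; linarith
  · have := Int.fract_lt_one (-y); linarith

/-- `y - 1/2 - Bf r y` is an integer. -/
theorem Bf_int (r y : ℝ) : ∃ n : ℤ, y = n + 1 / 2 + Bf r y := by
  unfold Bf
  split_ifs
  · exact ⟨⌊y⌋, by rw [Int.fract]; ring⟩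
  · exact ⟨-⌊-y⌋ - 1, by rw [Int.fract]; push_cast; ring⟩

/-- the sign condition -/
theorem Bf_cond {r y : ℝ} (n : ℤ) (h : y = n + 1 / 2 + Bf r y) :
    (0 < y ∨ (y = 0 ∧ 0 < r)) ↔ 0 ≤ n := by
  by_cases h0 : 0 < r
  · have h1 : (n : ℝ) = ⌊y⌋ := by rw [Bf_pos h0, Int.fract] at h; linarith
    have h1 : n = ⌊y⌋ := by exact_mod_cast h1
    rw [h1, Int.floor_nonneg]
    simp only [h0, and_true]
    constructor
    · rintro (h | h) <;> linarith
    · intro h; rcases h.lt_or_eq with h | h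
      · exact Or.inl h
      · exact Or.inr h.symm
  · have h1 : (n : ℝ) = -⌊-y⌋ - 1 := by rw [Bf_nonpos h0, Int.fract] at h; linarith
    have h1 : n = -⌊-y⌋ - 1 := by exact_mod_cast h1
    simp only [h0, and_false, or_false]
    rw [h1]
    have : 0 ≤ -⌊-y⌋ - 1 ↔ ⌊-y⌋ < 0 := by omega
    rw [this, Int.floor_lt]
    simp

/-! ### Sums of periodic functions over `range q` -/

theorem per_mul {q : ℤ} {f : ℤ → ℝ} (hf : ∀ a, f (a + q) = f a) (a n : ℤ) : f (a + n * q) = f a := by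
  induction n using Int.induction_on with
  | zero => simp
  | succ k ih => rw [← ih, ← hf (a + k * q)]; congr 1; ring
  | pred k ih => rw [← ih, ← hf (a + (-(k:ℤ) - 1) * q)]; congr 1; ring

theorem per_congr {q : ℤ} {f : ℤ → ℝ} (hf : ∀ a, f (a + q) = f a) {a b : ℤ} (h : q ∣ a - b) :
    f a = f b := by
  obtain ⟨n, hn⟩ := h
  rw [show a = b + n * q by linarith, per_mul hf]

theorem sum_per_zmod (q : ℕ) [NeZero q] {f : ℤ → ℝ} :
    ∑ a ∈ Finset.range q, f a = ∑ x : ZMod q, f (x.val : ℤ) := by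
  symm
  apply Finset.sum_bij (fun (x : ZMod q) _ => x.val)
  · intro a _; simpa using ZMod.val_lt a
  · intro a _ b _ h; exact ZMod.val_injective q h
  · intro b hb; exact ⟨(b : ZMod q), Finset.mem_univ _, ZMod.val_cast_of_lt (by simpa using hb)⟩
  · intros; rfl

theorem per_val {q : ℕ} [NeZero q] {f : ℤ → ℝ} (hf : ∀ a, f (a + q) = f a) (n : ℤ) :
    f (((n : ZMod q).val : ℕ) : ℤ) = f n := by
  apply per_congr hf
  rw [← ZMod.intCast_eq_intCast_iff_dvd_sub]
  simp

theorem sum_per_add {q : ℕ} {f : ℤ → ℝ} (hf : ∀ a, f (a + q) = f a) (c : ℤ) :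
    ∑ a ∈ Finset.range q, f (a + c) = ∑ a ∈ Finset.range q, f a := by
  rcases Nat.eq_zero_or_pos q with rfl | hq
  · simp
  have : NeZero q := ⟨hq.ne'⟩
  rw [sum_per_zmod q (f := fun a => f (a + c)), sum_per_zmod q (f := f),
    ← Equiv.sum_comp (Equiv.addRight (c : ZMod q)) (fun x : ZMod q => f (x.val : ℤ))]
  apply Finset.sum_congr rfl
  intro x _
  rw [← per_val hf]
  congr 2; simp

theorem sum_per_mul {q : ℕ} {f : ℤ → ℝ} (hf : ∀ a, f (a + q) = f a) (u u' : ℤ)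
    (hu : (q : ℤ) ∣ u * u' - 1) :
    ∑ a ∈ Finset.range q, f (u * a) = ∑ a ∈ Finset.range q, f a := by
  rcases Nat.eq_zero_or_pos q with rfl | hq
  · simp
  have : NeZero q := ⟨hq.ne'⟩
  have h1 : (u : ZMod q) * (u' : ZMod q) = 1 := by
    have := (ZMod.intCast_zmod_eq_zero_iff_dvd _ q).2 hu
    push_cast at this
    exact sub_eq_zero.1 this
  rw [sum_per_zmod q (f := fun a => f (u * a)), sum_per_zmod q (f := f),
    ← Equiv.sum_comp (Units.mulLeft (⟨u, u', h1, by rw [mul_comm, h1]⟩ : (ZMod q)ˣ))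
      (fun x : ZMod q => f (x.val : ℤ))]
  apply Finset.sum_congr rfl
  intro x _
  rw [← per_val hf]
  congr 2; simp

theorem sum_per_neg {q : ℕ} {f : ℤ → ℝ} (hf : ∀ a, f (a + q) = f a) :
    ∑ a ∈ Finset.range q, f (-a) = ∑ a ∈ Finset.range q, f a := by
  rw [← sum_per_mul hf (-1) (-1) (by simp)]
  simp

theorem Bf_per {q : ℕ} (hq : 0 < q) (r y : ℝ) (p : ℤ) (a : ℤ) :
    Bf r (y + p * ((a + q : ℤ) : ℝ) / q) = Bf r (y + p * (a : ℝ) / q) := by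
  have : (q : ℝ) ≠ 0 := by positivity
  rw [← Bf_add_int r (y + p * (a : ℝ) / q) p]
  congr 1
  push_cast
  field_simp
  ring

theorem Bf_per' {q : ℕ} (hq : 0 < q) (r y : ℝ) (a : ℤ) :
    Bf r (y + ((a + q : ℤ) : ℝ) / q) = Bf r (y + (a : ℝ) / q) := by
  have := Bf_per hq r y 1 a
  simpa using this

theorem sum_range_id_real (n : ℕ) : ∑ a ∈ Finset.range n, (a : ℝ) = n * (n - 1) / 2 := by
  induction n with
  | zero => simp
  | succ n ih => rw [Finset.sum_range_succ, ih]; push_cast; ring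

theorem sum_range_sq_real (n : ℕ) :
    ∑ a ∈ Finset.range n, (a : ℝ) ^ 2 = n * (n - 1) * (2 * n - 1) / 6 := by
  induction n with
  | zero => simp
  | succ n ih => rw [Finset.sum_range_succ, ih]; push_cast; ring

theorem Bf_distrib_pos {n : ℕ} (hn : 0 < n) (y : ℝ) :
    ∑ t ∈ Finset.range n, Bf 1 (y + (t : ℝ) / n) = Bf 1 (n * y) := by
  have hn' : (0:ℝ) < n := by exact_mod_cast hn
  set m := ⌊n * y⌋ with hm
  set f := Int.fract (n * y) with hf
  have hy : y = f / n + (m : ℝ) / n := by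
    have : n * y = m + f := by rw [hm, hf]; exact (Int.floor_add_fract _).symm
    field_simp; linarith
  have h1 : ∑ t ∈ Finset.range n, Bf 1 (y + (t : ℝ) / n)
      = ∑ t ∈ Finset.range n, (fun a : ℤ => Bf 1 (f / n + (a : ℝ) / n)) (t + m) := by
    apply Finset.sum_congr rfl; intro t _
    simp only
    congr 1; rw [hy]; push_cast; ring
  rw [h1, sum_per_add (f := fun a : ℤ => Bf 1 (f / n + (a : ℝ) / n))
    (fun a => Bf_per' hn 1 _ a)]
  have h0 := Int.fract_nonneg (n * y)
  have h1 := Int.fract_lt_one (n * y)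
  rw [Bf_pos one_pos, ← hf]
  have h3 : ∀ t ∈ Finset.range n, (fun a : ℤ => Bf 1 (f / n + (a : ℝ) / n)) t
      = (f / n - 1 / 2) + (1 / n) * (t : ℝ) := by
    intro t ht
    have ht' : (t : ℝ) + 1 ≤ n := by exact_mod_cast Finset.mem_range.1 ht
    simp only
    rw [Bf_pos one_pos, Int.fract_eq_self.2]
    · push_cast; ring
    · constructor
      · push_cast; positivity
      · rw [← add_div, div_lt_one hn']; push_cast; linarith
  rw [Finset.sum_congr rfl h3, Finset.sum_add_distrib, ← Finset.mul_sum, sum_range_id_real]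
  simp
  field_simp
  ring

theorem Bf_distrib {n : ℕ} (hn : 0 < n) (r y : ℝ) :
    ∑ t ∈ Finset.range n, Bf r (y + (t : ℝ) / n) = Bf r (n * y) := by
  by_cases h : 0 < r
  · simp only [Bf_congr (show 0 < r ↔ (0:ℝ) < 1 by simp [h])]
    exact Bf_distrib_pos hn y
  · have hc : ∀ z, Bf r z = - Bf 1 (-z) := by
      intro z; rw [Bf_nonpos h, Bf_pos one_pos]; ring
    simp only [hc]
    rw [Finset.sum_neg_distrib, show -(n * y) = n * (-y) by ring, ← Bf_distrib_pos hn]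
    congr 1
    rw [show ∑ t ∈ Finset.range n, Bf 1 (-y + (t : ℝ) / n)
      = ∑ t ∈ Finset.range n, (fun a : ℤ => Bf 1 (-y + (a : ℝ) / n)) t by simp,
      ← sum_per_neg (f := fun a : ℤ => Bf 1 (-y + (a : ℝ) / n)) (fun a => Bf_per' hn 1 _ a)]
    apply Finset.sum_congr rfl
    intro t _
    congr 1; push_cast; ring

theorem Bf_sq_sum {h : ℕ} (hh : 0 < h) (r : ℝ) :
    ∑ a ∈ Finset.range h, Bf r ((a : ℝ) / h) ^ 2 = h / 12 + 1 / (6 * h) := by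
  have hh' : (0:ℝ) < h := by exact_mod_cast hh
  have key : ∑ a ∈ Finset.range h, Bf 1 ((a : ℝ) / h) ^ 2 = h / 12 + 1 / (6 * h) := by
    have h3 : ∀ a ∈ Finset.range h, Bf 1 ((a : ℝ) / h) ^ 2
      = (1 / h ^ 2) * (a : ℝ) ^ 2 + (-1 / h) * a + 1 / 4 := by
      intro a ha
      have ha' : (a : ℝ) + 1 ≤ h := by exact_mod_cast Finset.mem_range.1 ha
      rw [Bf_pos one_pos, Int.fract_eq_self.2]
      · field_simp; ring
      · constructor
        · positivity
        · rw [div_lt_one hh']; linarith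
    rw [Finset.sum_congr rfl h3, Finset.sum_add_distrib, Finset.sum_add_distrib, ← Finset.mul_sum,
      ← Finset.mul_sum, sum_range_id_real, sum_range_sq_real]
    simp
    field_simp
    ring
  by_cases h0 : 0 < r
  · simp only [Bf_congr (show 0 < r ↔ (0:ℝ) < 1 by simp [h0])]
    exact key
  · have hc : ∀ z, Bf r z = - Bf 1 (-z) := by
      intro z; rw [Bf_nonpos h0, Bf_pos one_pos]; ring
    have hper : ∀ a : ℤ, (fun a : ℤ => Bf 1 ((a : ℝ) / h) ^ 2) (a + h)
        = (fun a : ℤ => Bf 1 ((a : ℝ) / h) ^ 2) a := by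
      intro a
      have := Bf_per' hh 1 0 a
      simp only [zero_add] at this
      simp only [this]
    rw [← key, show ∑ a ∈ Finset.range h, Bf 1 ((a : ℝ) / h) ^ 2
      = ∑ a ∈ Finset.range h, (fun a : ℤ => Bf 1 ((a : ℝ) / h) ^ 2) a by simp,
      ← sum_per_neg (q := h) (f := fun a : ℤ => Bf 1 ((a : ℝ) / h) ^ 2) hper]
    apply Finset.sum_congr rfl
    intro t _
    simp only [hc]
    rw [neg_sq]
    congr 2; push_cast; ring

/-! ### Generalised Dedekind sums -/

def kap (q : ℕ) (p : ℤ) (r s : ℝ) : ℝ :=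
  ∑ a ∈ Finset.range q, Bf r ((a : ℝ) / q) * Bf s (p * (a : ℝ) / q)

theorem kap_congr_sign {q : ℕ} {p : ℤ} {r s r' s' : ℝ} (hr : 0 < r ↔ 0 < r')
    (hs : 0 < s ↔ 0 < s') : kap q p r s = kap q p r' s' := by
  unfold kap
  simp only [Bf_congr hr, Bf_congr hs]

theorem kap_fun_per {q : ℕ} (hq : 0 < q) (p p' : ℤ) (r s y z : ℝ) (a : ℤ) :
    (fun a : ℤ => Bf r (y + p' * (a : ℝ) / q) * Bf s (z + p * (a : ℝ) / q)) (a + q)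
    = (fun a : ℤ => Bf r (y + p' * (a : ℝ) / q) * Bf s (z + p * (a : ℝ) / q)) a := by
  simp only [Bf_per hq]

theorem kap_fun_per0 {q : ℕ} (hq : 0 < q) (p p' : ℤ) (r s : ℝ) (a : ℤ) :
    (fun a : ℤ => Bf r (p' * (a : ℝ) / q) * Bf s (p * (a : ℝ) / q)) (a + q)
    = (fun a : ℤ => Bf r (p' * (a : ℝ) / q) * Bf s (p * (a : ℝ) / q)) a := by
  simpa using kap_fun_per hq p p' r s 0 0 a

theorem Bf_mod {q : ℕ} (hq : 0 < q) (r : ℝ) {a b : ℤ} (h : (q : ℤ) ∣ a - b) :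
    Bf r ((a : ℝ) / q) = Bf r ((b : ℝ) / q) := by
  obtain ⟨n, hn⟩ := h
  have : (q : ℝ) ≠ 0 := by positivity
  rw [show (a : ℝ) / q = (b : ℝ) / q + n by
    rw [show a = b + q * n by linarith]; push_cast; field_simp, Bf_add_int]

theorem kap_congr {q : ℕ} (hq : 0 < q) {p p' : ℤ} (h : (q : ℤ) ∣ p - p') (r s : ℝ) :
    kap q p r s = kap q p' r s := by
  unfold kap
  apply Finset.sum_congr rfl
  intro a _
  congr 1
  have := Bf_mod hq s (a := p * a) (b := p' * a) (by
    rw [← sub_mul]; exact h.mul_right _)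
  push_cast at this
  exact this

theorem kap_symm {q : ℕ} (hq : 0 < q) {p p' : ℤ} (h : (q : ℤ) ∣ p * p' - 1) (r s : ℝ) :
    kap q p r s = kap q p' s r := by
  unfold kap
  have h1 : ∑ a ∈ Finset.range q, Bf r ((a : ℝ) / q) * Bf s (p * (a : ℝ) / q)
    = ∑ a ∈ Finset.range q, (fun a : ℤ => Bf r ((1:ℤ) * (a : ℝ) / q) * Bf s (p * (a : ℝ) / q)) a := by
    simp
  rw [h1, ← sum_per_mul (q := q) (f := fun a : ℤ => Bf r ((1:ℤ) * (a : ℝ) / q) * Bf s (p * (a : ℝ) / q))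
      (kap_fun_per0 hq p 1 r s) p' p (by rwa [mul_comm])]
  apply Finset.sum_congr rfl
  intro a _
  rw [mul_comm]
  congr 1
  · have := Bf_mod hq s (a := p * (p' * a)) (b := a) (by
      rw [← mul_assoc, show p * p' * (a:ℤ) - a = (p * p' - 1) * a by ring]; exact h.mul_right _)
    push_cast at this ⊢
    exact this
  · push_cast; simp

theorem kap_neg_right {q : ℕ} (p : ℤ) {r s : ℝ} (hs : s ≠ 0) :
    kap q (-p) r (-s) = - kap q p r s := by
  unfold kap
  rw [← Finset.sum_neg_distrib]
  apply Finset.sum_congr rfl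
  intro a _
  rw [show ((-p : ℤ) : ℝ) * a / q = - (p * a / q) by push_cast; ring, Bf_neg hs]
  ring

theorem kap_shift {q : ℕ} (hq : 0 < q) (p : ℤ) (r s : ℝ) (c : ℤ) :
    ∑ a ∈ Finset.range q, Bf r (((c + a : ℤ) : ℝ) / q) * Bf s (p * ((c + a : ℤ) : ℝ) / q)
      = kap q p r s := by
  have h1 : kap q p r s
    = ∑ a ∈ Finset.range q, (fun a : ℤ => Bf r ((1:ℤ) * (a : ℝ) / q) * Bf s (p * (a : ℝ) / q)) a := by
    simp [kap]
  rw [h1, ← sum_per_add (q := q) (f := fun a : ℤ => Bf r ((1:ℤ) * (a : ℝ) / q) * Bf s (p * (a : ℝ) / q))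
      (kap_fun_per0 hq p 1 r s) c]
  apply Finset.sum_congr rfl
  intro a _
  congr 2 <;> push_cast <;> ring

theorem saw_eq {p q : ℤ} (hq : 0 < q) (h : ¬ q ∣ p) :
    ((saw ((p : ℚ) / (q : ℚ)) : ℚ) : ℝ) = Bf 1 ((p : ℝ) / q) := by
  have h1 : ((p : ℚ) / (q : ℚ)).den ≠ 1 := by
    intro hd
    apply h
    have := (Rat.den_eq_one_iff _).1 hd
    refine ⟨((p : ℚ) / (q : ℚ)).num, ?_⟩
    have hq0 : (q : ℚ) ≠ 0 := by positivity
    rw [eq_div_iff hq0] at this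
    have h2 : ((p : ℚ) / (q : ℚ)).num * q = p := by exact_mod_cast this
    linarith
  unfold saw
  rw [if_neg h1, Bf_pos one_pos, Int.fract]
  push_cast
  congr 2
  have : ((p : ℝ) / q) = (((p : ℚ) / q : ℚ) : ℝ) := by push_cast; rfl
  rw [this, Rat.floor_cast]

theorem saw_eq_zero {p q : ℤ} (h : q ∣ p) : saw ((p : ℚ) / (q : ℚ)) = 0 := by
  obtain ⟨n, rfl⟩ := h
  unfold saw
  rw [if_pos]
  by_cases hq : q = 0
  · simp [hq]
  · rw [show ((q * n : ℤ) : ℚ) / q = (n : ℚ) by push_cast; field_simp]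
    simp

theorem kap_dedekind {p q : ℤ} (hq : 0 < q) (hpq : IsCoprime p q) {r s : ℝ} (hr : 0 < r)
    (hs : 0 < s) : kap q.toNat p r s = (dedekindSum p q : ℝ) + 1 / 4 := by
  rw [kap_congr_sign (r' := 1) (s' := 1) (by simp [hr]) (by simp [hs])]
  have hcast : ((q.toNat : ℕ) : ℤ) = q := Int.toNat_of_nonneg hq.le
  have hcastR : ((q.toNat : ℕ) : ℝ) = q := by exact_mod_cast hcast
  obtain ⟨n, hn⟩ : ∃ n : ℕ, q.toNat = n + 1 := ⟨q.toNat - 1, by omega⟩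
  have hqn : q = n + 1 := by omega
  unfold kap dedekindSum
  have e1 : ∑ i ∈ Finset.Icc (1 : ℤ) q, saw ((i : ℚ) / (q : ℚ)) * saw ((p : ℚ) * (i : ℚ) / (q : ℚ))
    = ∑ a ∈ Finset.range q.toNat, saw (((a + 1 : ℤ) : ℚ) / (q : ℚ)) *
        saw ((p : ℚ) * ((a + 1 : ℤ) : ℚ) / (q : ℚ)) := by
    symm
    apply Finset.sum_bij (fun (a : ℕ) _ => (a : ℤ) + 1)
    · intro a ha; simp at ha ⊢; omega
    · intro a _ b _ h; simpa using h
    · intro b hb; simp at hb; exact ⟨(b - 1).toNat, by simp; omega, by simp; omega⟩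
    · intros; rfl
  rw [e1, hcastR, hn, Finset.sum_range_succ', Finset.sum_range_succ]
  have hz : saw (((n + 1 : ℤ) : ℚ) / (q : ℚ)) = 0 := saw_eq_zero (by rw [hqn])
  rw [hz]
  push_cast
  have h0 : Bf 1 (0 / (q:ℝ)) * Bf 1 (p * 0 / (q:ℝ)) = 1 / 4 := by
    rw [Bf_pos one_pos, Bf_pos one_pos]; simp; norm_num
  rw [h0]
  congr 1
  rw [zero_mul, add_zero]
  apply Finset.sum_congr rfl
  intro a ha
  have ha : a < n := by simpa using ha
  have hnd : ¬ q ∣ ((a + 1 : ℤ)) := by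
    intro hd
    have := Int.le_of_dvd (by omega) hd
    omega
  have hnd2 : ¬ q ∣ p * ((a + 1 : ℤ)) := fun hd => hnd (hpq.symm.dvd_of_dvd_mul_left hd)
  have e2 := saw_eq hq hnd
  have e3 := saw_eq hq hnd2
  push_cast at e2 e3 ⊢
  rw [e2, e3]

end

section

theorem gcd3_smul (t : ℤ) (x : Fin 3 → ℤ) : (gcd3 (t • x) : ℤ) = |t| * gcd3 x := by
  by_cases hx : x = 0
  · subst hx; simp [gcd3]
  obtain ⟨f, hf, hxf⟩ := exists_prim hx
  conv_lhs => rw [hxf, smul_smul]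
  rw [gcd3_smul_prim hf, abs_mul]
  simp

theorem gcd3_cr_comm (v w : Fin 3 → ℤ) : gcd3 (cr w v) = gcd3 (cr v w) := by
  rw [cr_anti, gcd3_neg]

theorem dvd_dt {q : ℤ} {a : Fin 3 → ℤ} (h : ∀ i, q ∣ a i) (b : Fin 3 → ℤ) : q ∣ dt a b :=
  dvd_add (dvd_add ((h 0).mul_right _) ((h 1).mul_right _)) ((h 2).mul_right _)

open Classical in
/-- a residue `p` with `w ≡ p v` -/
def resd (v w : Fin 3 → ℤ) : ℤ :=
  if h : ∃ p : ℤ, ∀ i, (gcd3 (cr v w) : ℤ) ∣ w i - p * v i then h.choose else 0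

def kapV (v w : Fin 3 → ℤ) (r s : ℝ) : ℝ := kap (gcd3 (cr v w)) (resd v w) r s

theorem kapV_eq {v w : Fin 3 → ℤ} (hv : IsPrimitive v) {p : ℤ}
    (hp : ∀ i, (gcd3 (cr v w) : ℤ) ∣ w i - p * v i) (r s : ℝ) :
    kapV v w r s = kap (gcd3 (cr v w)) p r s := by
  unfold kapV
  have hex : ∃ p : ℤ, ∀ i, (gcd3 (cr v w) : ℤ) ∣ w i - p * v i := ⟨p, hp⟩
  have h1 : resd v w = hex.choose := by unfold resd; rw [dif_pos hex]
  have h2 := hex.choose_spec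
  rw [← h1] at h2
  rcases Nat.eq_zero_or_pos (gcd3 (cr v w)) with h0 | h0
  · rw [h0]; simp [kap]
  apply kap_congr h0
  apply prim_dvd hv
  intro i
  have := dvd_sub (hp i) (h2 i)
  rwa [show w i - p * v i - (w i - resd v w * v i) = (resd v w - p) * v i by ring] at this

theorem kapV_symm {v w : Fin 3 → ℤ} (hv : IsPrimitive v) (hw : IsPrimitive w) (r s : ℝ) :
    kapV v w r s = kapV w v s r := by
  obtain ⟨p, hp⟩ := exists_residue w hv
  obtain ⟨p', hp'⟩ := exists_residue v hw
  rw [kapV_eq hv hp, kapV_eq hw hp', gcd3_cr_comm v w]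
  rw [gcd3_cr_comm v w] at hp'
  rcases Nat.eq_zero_or_pos (gcd3 (cr v w)) with h0 | h0
  · rw [h0]; simp [kap]
  apply kap_symm h0
  apply prim_dvd hv
  intro i
  have := dvd_add ((hp i).mul_left p') (hp' i)
  rw [← dvd_neg]
  convert this using 1
  ring

theorem kapV_neg_right {v w : Fin 3 → ℤ} (hv : IsPrimitive v) (r : ℝ) {s : ℝ} (hs : s ≠ 0) :
    kapV v (-w) r (-s) = - kapV v w r s := by
  obtain ⟨p, hp⟩ := exists_residue w hv
  have hg : gcd3 (cr v (-w)) = gcd3 (cr v w) := by rw [cr_neg_right, gcd3_neg]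
  rw [kapV_eq hv hp, kapV_eq hv (p := -p), hg, kap_neg_right _ hs]
  intro i
  rw [hg, ← dvd_neg, Pi.neg_apply]
  have h2 : -(-w i - -p * v i) = w i - p * v i := by ring
  rw [h2]; exact hp i

theorem kapV_sign (v w : Fin 3 → ℤ) {r s r' s' : ℝ} (hr : 0 < r ↔ 0 < r')
    (hs : 0 < s ↔ 0 < s') : kapV v w r s = kapV v w r' s' := kap_congr_sign hr hs

/-- the correction term -/
def nu (v w : Fin 3 → ℤ) : ℝ :=
  (1 / (12 * (gcd3 (cr v w) : ℝ))) * ((dt v w : ℤ) : ℝ) *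
    (1 / ((dt v v : ℤ) : ℝ) + 1 / ((dt w w : ℤ) : ℝ))

theorem nu_symm (v w : Fin 3 → ℤ) : nu v w = nu w v := by
  unfold nu; rw [gcd3_cr_comm, dt_comm v w]; ring

theorem nu_neg_right (v w : Fin 3 → ℤ) : nu v (-w) = - nu v w := by
  unfold nu; rw [cr_neg_right, gcd3_neg, dt_neg, dt_neg, neg_dt, neg_neg]; push_cast; ring

/-- contribution of an edge `XY` with incident normals `v, w`. -/
def Mv (R : Fin 3 → ℝ) (X Y v w : Fin 3 → ℤ) : ℝ :=
  (gcd3 (Y - X) : ℝ) *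
    (kapV v w (dt (toR v) (R - toR X)) (dt (toR w) (R - toR X)) - nu v w)

/-- genericity -/
def Gen (R : Fin 3 → ℝ) : Prop := ∀ v : Fin 3 → ℤ, v ≠ 0 → ∀ c : ℤ, dt (toR v) R ≠ c

theorem Gen.ne {R : Fin 3 → ℝ} (hR : Gen R) {v : Fin 3 → ℤ} (hv : v ≠ 0) (X : Fin 3 → ℤ) :
    dt (toR v) (R - toR X) ≠ 0 := by
  rw [dt_sub, dt_toR]
  exact sub_ne_zero.2 (hR v hv _)

theorem Mv_symm {R : Fin 3 → ℝ} (X Y : Fin 3 → ℤ) {v w : Fin 3 → ℤ} (hv : IsPrimitive v)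
    (hw : IsPrimitive w) : Mv R X Y v w = Mv R X Y w v := by
  unfold Mv; rw [kapV_symm hv hw, nu_symm]

theorem Mv_neg_right {R : Fin 3 → ℝ} (hR : Gen R) (X Y : Fin 3 → ℤ) {v w : Fin 3 → ℤ}
    (hv : IsPrimitive v) (hw : IsPrimitive w) : Mv R X Y v (-w) = - Mv R X Y v w := by
  unfold Mv
  rw [toR_neg, neg_dt, kapV_neg_right hv _ (hR.ne (prim_ne_zero hw) X), nu_neg_right]; ring

theorem Mv_neg_left {R : Fin 3 → ℝ} (hR : Gen R) (X Y : Fin 3 → ℤ) {v w : Fin 3 → ℤ}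
    (hv : IsPrimitive v) (hw : IsPrimitive w) : Mv R X Y (-v) w = - Mv R X Y v w := by
  rw [Mv_symm X Y (prim_neg hv) hw, Mv_neg_right hR X Y hw hv, Mv_symm X Y hw hv]

theorem Mv_swap {R : Fin 3 → ℝ} {X Y : Fin 3 → ℤ} {v w : Fin 3 → ℤ} (hv : dt v X = dt v Y)
    (hw : dt w X = dt w Y) : Mv R X Y v w = Mv R Y X v w := by
  unfold Mv
  rw [gcd3_sub_comm, dt_sub, dt_sub, dt_sub, dt_sub, dt_toR, dt_toR, dt_toR, dt_toR, hv, hw]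

theorem Mv_parallel {R : Fin 3 → ℝ} (X Y : Fin 3 → ℤ) {v w : Fin 3 → ℤ} (h : cr v w = 0) :
    Mv R X Y v w = 0 := by
  have : gcd3 (cr v w) = 0 := by rw [h]; simp [gcd3]
  unfold Mv kapV nu
  rw [this]; simp [kap]

end

section

/-! ### Tetrahedra -/

structure Tet (V v : Fin 4 → Fin 3 → ℤ) (h : Fin 4 → ℕ) (c : Fin 4 → ℤ) : Prop where
  prim : ∀ i, IsPrimitive (v i)
  pos : ∀ i, 0 < h i
  eval : ∀ i j, dt (v i) (V j) = c i + if i = j then (h i : ℤ) else 0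

def nn (r y : ℝ) : ℤ := (Bf_int r y).choose
theorem nn_spec (r y : ℝ) : y = nn r y + 1 / 2 + Bf r y := (Bf_int r y).choose_spec
theorem nn_add (r y : ℝ) (m : ℤ) : nn r (y + m) = nn r y + m := by
  have h1 := nn_spec r y
  have h2 := nn_spec r (y + m)
  rw [Bf_add_int] at h2
  have : (nn r (y + m) : ℝ) = nn r y + m := by linarith
  exact_mod_cast this

def tD (V : Fin 4 → Fin 3 → ℤ) : ℤ := dt (cr (V 1 - V 0) (V 2 - V 0)) (V 3 - V 0)

def tMat (V : Fin 4 → Fin 3 → ℤ) : Matrix (Fin 3) (Fin 3) ℤ :=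
  Matrix.of fun i j => ![V 1 - V 0, V 2 - V 0, V 3 - V 0] j i

def Tf (V : Fin 4 → Fin 3 → ℤ) : (Fin 3 → ℤ) →ₗ[ℤ] (Fin 3 → ℤ) := Matrix.toLin' (tMat V)

theorem Tf_apply (V : Fin 4 → Fin 3 → ℤ) (m : Fin 3 → ℤ) :
    Tf V m = m 0 • (V 1 - V 0) + m 1 • (V 2 - V 0) + m 2 • (V 3 - V 0) := by
  funext i
  simp [Tf, tMat, Matrix.mulVec, dotProduct, Fin.sum_univ_three]
  ring

theorem Tf_det (V : Fin 4 → Fin 3 → ℤ) : LinearMap.det (Tf V) = tD V := by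
  rw [Tf, LinearMap.det_toLin', Matrix.det_fin_three]
  simp only [tMat, tD, dt, cr_0, cr_1, cr_2, Matrix.of_apply, Matrix.cons_val_zero,
    Matrix.cons_val_one, Matrix.cons_val]
  ring

def TL (V : Fin 4 → Fin 3 → ℤ) : Submodule ℤ (Fin 3 → ℤ) := LinearMap.range (Tf V)

theorem det_mul {R : Type*} [CommRing R] (a b c x y z : Fin 3 → R) :
    dt (cr a b) c * dt (cr x y) z =
      dt a x * (dt b y * dt c z - dt b z * dt c y) - dt a y * (dt b x * dt c z - dt b z * dt c x)
      + dt a z * (dt b x * dt c y - dt b y * dt c x) := by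
  simp only [dt, cr_0, cr_1, cr_2]; ring

section
variable {V v : Fin 4 → Fin 3 → ℤ} {h : Fin 4 → ℕ} {c : Fin 4 → ℤ}

theorem Tet.ev (T : Tet V v h c) (i j k : Fin 4) :
    dt (v i) (V j - V k) = (if i = j then (h i : ℤ) else 0) - (if i = k then (h i : ℤ) else 0) := by
  rw [dt_sub, T.eval, T.eval]; ring

theorem Tet.det_ne (T : Tet V v h c) : dt (cr (v 1) (v 2)) (v 3) * tD V = h 1 * h 2 * h 3 := by
  unfold tD
  rw [det_mul]
  simp [T.ev]
  ring

theorem Tet.tD_ne (T : Tet V v h c) : tD V ≠ 0 := by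
  intro h0
  have := T.det_ne
  rw [h0, mul_zero] at this
  have h1 := T.pos 1; have h2 := T.pos 2; have h3 := T.pos 3
  have : (0:ℤ) < h 1 * h 2 * h 3 := by positivity
  omega

theorem Tet.det_ne' (T : Tet V v h c) : dt (cr (v 1) (v 2)) (v 3) ≠ 0 := by
  intro h0
  have := T.det_ne
  rw [h0, zero_mul] at this
  have h1 := T.pos 1; have h2 := T.pos 2; have h3 := T.pos 3
  have : (0:ℤ) < h 1 * h 2 * h 3 := by positivity
  omega

theorem Tet.eq_zero (T : Tet V v h c) {x : Fin 3 → ℤ} (h1 : dt (v 1) x = 0) (h2 : dt (v 2) x = 0)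
    (h3 : dt (v 3) x = 0) : x = 0 := by
  have := cramer_dual (v 1) (v 2) (v 3) x
  rw [h1, h2, h3] at this
  simp only [zero_smul, add_zero] at this
  exact (smul_eq_zero.1 this).resolve_left T.det_ne'

theorem Tet.dtTf (T : Tet V v h c) (m : Fin 3 → ℤ) :
    dt (v 0) (Tf V m) = -(m 0 + m 1 + m 2) * h 0 ∧ dt (v 1) (Tf V m) = m 0 * h 1 ∧
    dt (v 2) (Tf V m) = m 1 * h 2 ∧ dt (v 3) (Tf V m) = m 2 * h 3 := by
  rw [Tf_apply]
  simp only [dt_add, dt_smul, T.ev]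
  refine ⟨?_, ?_, ?_, ?_⟩ <;> simp <;> ring

theorem Tet.inj (T : Tet V v h c) : Function.Injective (Tf V) := by
  rw [← LinearMap.ker_eq_bot, LinearMap.ker_eq_bot']
  intro m hm
  obtain ⟨-, h1, h2, h3⟩ := T.dtTf m
  rw [hm] at h1 h2 h3
  have p1 := T.pos 1; have p2 := T.pos 2; have p3 := T.pos 3
  simp only [dt_zero] at h1 h2 h3
  apply vec_ext
  · simpa [p1.ne'] using h1.symm
  · simpa [p2.ne'] using h2.symm
  · simpa [p3.ne'] using h3.symm

theorem Tet.card (T : Tet V v h c) : Nat.card ((Fin 3 → ℤ) ⧸ TL V) = (tD V).natAbs := by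
  have := Submodule.natAbs_det_equiv (TL V) (LinearEquiv.ofInjective (Tf V) T.inj)
  rw [← this, ← Tf_det]
  rfl

theorem Tet.fin (T : Tet V v h c) : Finite ((Fin 3 → ℤ) ⧸ TL V) := by
  apply Nat.finite_of_card_ne_zero
  rw [T.card]
  exact Int.natAbs_ne_zero.2 T.tD_ne

theorem Tet.sum_zero (T : Tet V v h c) (x : Fin 3 → ℝ) :
    ∑ i, dt (toR (v i)) x / h i = 0 := by
  have hD : ((tD V : ℤ) : ℝ) ≠ 0 := by exact_mod_cast T.tD_ne
  have hp : ∀ i, (h i : ℝ) ≠ 0 := fun i => by have := T.pos i; positivity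
  have hc := cramer (toR (V 1 - V 0)) (toR (V 2 - V 0)) (toR (V 3 - V 0)) x
  have hD' : dt (cr (toR (V 1 - V 0)) (toR (V 2 - V 0))) (toR (V 3 - V 0)) = tD V := by
    rw [← toR_cr, dt_toR]; rfl
  rw [hD'] at hc
  generalize dt (cr (toR (V 2 - V 0)) (toR (V 3 - V 0))) x = α at hc
  generalize dt (cr (toR (V 3 - V 0)) (toR (V 1 - V 0))) x = β at hc
  generalize dt (cr (toR (V 1 - V 0)) (toR (V 2 - V 0))) x = γ at hc
  have key : ∀ i, (tD V : ℝ) * dt (toR (v i)) x = α * (dt (v i) (V 1 - V 0) : ℤ)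
      + β * (dt (v i) (V 2 - V 0) : ℤ) + γ * (dt (v i) (V 3 - V 0) : ℤ) := by
    intro i
    rw [← dt_smul, hc, dt_add, dt_add, dt_smul, dt_smul, dt_smul, dt_toR, dt_toR, dt_toR]
  apply mul_left_cancel₀ hD
  rw [mul_zero, Finset.mul_sum]
  simp only [← mul_div_assoc, key, Fin.sum_univ_four, T.ev]
  have := hp 0; have := hp 1; have := hp 2; have := hp 3
  simp
  field_simp
  ring

def tcond (R : Fin 3 → ℝ) (v : Fin 4 → Fin 3 → ℤ) (c : Fin 4 → ℤ) (l : ℕ) (x : Fin 3 → ℤ) : Prop :=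
  ∀ i, 0 < dt (v i) x - c i * l ∨ (dt (v i) x - c i * l = 0 ∧ 0 < dt (toR (v i)) R - c i)

def NT (R : Fin 3 → ℝ) (v : Fin 4 → Fin 3 → ℤ) (c : Fin 4 → ℤ) (l : ℕ) : ℕ :=
  Set.ncard {x | tcond R v c l x}

theorem cond_div {r : ℝ} (t : ℤ) (k : ℕ) (hk : 0 < k) :
    (0 < t ∨ (t = 0 ∧ 0 < r)) ↔ 0 ≤ nn r ((t : ℝ) / k) := by
  have hk' : (0:ℝ) < k := by exact_mod_cast hk
  rw [← Bf_cond _ (nn_spec r ((t : ℝ) / k))]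
  have h1 : 0 < (t : ℝ) / k ↔ 0 < t := by
    rw [div_pos_iff_of_pos_right hk']; exact_mod_cast Iff.rfl
  have h2 : (t : ℝ) / k = 0 ↔ t = 0 := by
    rw [div_eq_zero_iff]; simp [hk'.ne']
  rw [h1, h2]

/-- the value `k` for a coset representative. -/
def tk (R : Fin 3 → ℝ) (v : Fin 4 → Fin 3 → ℤ) (h : Fin 4 → ℕ) (c : Fin 4 → ℤ)
    (i : Fin 4) (x : Fin 3 → ℤ) : ℤ := nn (dt (toR (v i)) R - c i) (((dt (v i) x : ℤ) : ℝ) / h i)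

theorem tcond_iff (T : Tet V v h c) (R : Fin 3 → ℝ) (l : ℕ) (x m : Fin 3 → ℤ) :
    tcond R v c l (x + (l : ℤ) • V 0 + Tf V m) ↔
      0 ≤ tk R v h c 0 x + (l - (m 0 + m 1 + m 2)) ∧ 0 ≤ tk R v h c 1 x + m 0 ∧
      0 ≤ tk R v h c 2 x + m 1 ∧ 0 ≤ tk R v h c 3 x + m 2 := by
  have hp : ∀ i, (h i : ℝ) ≠ 0 := fun i => by have := T.pos i; positivity
  obtain ⟨d0, d1, d2, d3⟩ := T.dtTf m
  have gen : ∀ i (s : ℤ), dt (v i) (x + (l : ℤ) • V 0 + Tf V m) - c i * l = dt (v i) x + s * h i →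
      ((0 < dt (v i) (x + (l : ℤ) • V 0 + Tf V m) - c i * l ∨
        (dt (v i) (x + (l : ℤ) • V 0 + Tf V m) - c i * l = 0 ∧ 0 < dt (toR (v i)) R - c i)) ↔
      0 ≤ tk R v h c i x + s) := by
    intro i s hs
    rw [cond_div _ (h i) (T.pos i), hs, tk, ← nn_add]
    rw [show (((dt (v i) x + s * h i : ℤ)) : ℝ) / h i = ((dt (v i) x : ℤ) : ℝ) / h i + s by
      have := hp i
      push_cast; field_simp]
  unfold tcond
  rw [Fin.forall_fin_succ, Fin.forall_fin_succ, Fin.forall_fin_succ, Fin.forall_fin_one]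
  refine and_congr (gen 0 _ ?_) (and_congr (gen 1 _ ?_) (and_congr (gen 2 _ ?_) (gen 3 _ ?_)))
  · rw [dt_add, dt_add, dt_smul, T.eval, d0]; simp; ring
  · rw [dt_add, dt_add, dt_smul, T.eval, d1]; simp; ring
  · rw [dt_add, dt_add, dt_smul, T.eval, d2]; simp; ring
  · rw [dt_add, dt_add, dt_smul, T.eval, d3]; simp; ring

/-- lattice points in a simplex -/
def sK (K : ℕ) : Finset (Σ _ : ℕ, Σ _ : ℕ, ℕ) :=
  (Finset.range K).sigma fun a => (Finset.range (K - a)).sigma fun b => Finset.range (K - a - b)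

theorem mem_sK {K a b d : ℕ} : (⟨a, b, d⟩ : Σ _ : ℕ, Σ _ : ℕ, ℕ) ∈ sK K ↔ a + b + d < K := by
  simp [sK]; omega

theorem sK_card (K : ℕ) : ((sK K).card : ℝ) = K * (K + 1) * (K + 2) / 6 := by
  have h1 : ∀ n : ℕ, ((∑ b ∈ Finset.range n, (n - b) : ℕ) : ℝ) = n * (n + 1) / 2 := by
    intro n
    have : ∑ b ∈ Finset.range n, (n - b) = ∑ b ∈ Finset.range n, (b + 1) := by
      rw [← Finset.sum_range_reflect]
      apply Finset.sum_congr rfl; intro b hb; simp at hb; omega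
    rw [this]
    push_cast
    rw [Finset.sum_add_distrib, sum_range_id_real]; simp; ring
  have h2 : (sK K).card = ∑ a ∈ Finset.range K, (∑ b ∈ Finset.range (a + 1), (a + 1 - b)) := by
    simp only [sK, Finset.card_sigma, Finset.card_range]
    rw [← Finset.sum_range_reflect]
    apply Finset.sum_congr rfl; intro b hb; simp at hb
    rw [show K - (K - 1 - b) = b + 1 by omega]
  rw [h2]
  rw [Nat.cast_sum, Finset.sum_congr rfl (fun a _ => h1 (a + 1))]
  clear h2
  induction K with
  | zero => simp
  | succ n ih => rw [Finset.sum_range_succ, ih]; push_cast; ring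

/-- sum of the `n_i` plus two -/
def tks (R : Fin 3 → ℝ) (v : Fin 4 → Fin 3 → ℤ) (h : Fin 4 → ℕ) (c : Fin 4 → ℤ)
    (x : Fin 3 → ℤ) : ℤ := 2 + ∑ i, tk R v h c i x

def tB (R : Fin 3 → ℝ) (v : Fin 4 → Fin 3 → ℤ) (h : Fin 4 → ℕ) (c : Fin 4 → ℤ)
    (i : Fin 4) (x : Fin 3 → ℤ) : ℝ := Bf (dt (toR (v i)) R - c i) (((dt (v i) x : ℤ) : ℝ) / h i)

theorem tks_eq (T : Tet V v h c) (R : Fin 3 → ℝ) (x : Fin 3 → ℤ) :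
    (tks R v h c x : ℝ) = -∑ i, tB R v h c i x := by
  have h0 := T.sum_zero (toR x)
  have h1 : ∀ i, dt (toR (v i)) (toR x) / h i = tk R v h c i x + 1 / 2 + tB R v h c i x := by
    intro i; rw [dt_toR]; exact nn_spec _ _
  rw [Finset.sum_congr rfl (fun i _ => h1 i), Finset.sum_add_distrib, Finset.sum_add_distrib] at h0
  unfold tks
  push_cast
  simp at h0 ⊢
  linarith

theorem tks_ge (T : Tet V v h c) (R : Fin 3 → ℝ) (x : Fin 3 → ℤ) : -2 ≤ tks R v h c x := by
  have h1 := tks_eq T R x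
  have h2 : ∀ i, tB R v h c i x ≤ 1 / 2 := fun i => Bf_le _ _
  rw [Fin.sum_univ_four] at h1
  have h3 : (-2 : ℝ) ≤ tks R v h c x := by
    rw [h1]; linarith [h2 0, h2 1, h2 2, h2 3]
  exact_mod_cast h3

theorem tet_count (T : Tet V v h c) (R : Fin 3 → ℝ) [Fintype ((Fin 3 → ℤ) ⧸ TL V)] (l : ℕ)
    (hl : 1 ≤ l) : (NT R v c l : ℝ) = ∑ g : (Fin 3 → ℤ) ⧸ TL V,
      (((l : ℝ) + tks R v h c g.out) ^ 3 - ((l : ℝ) + tks R v h c g.out)) / 6 := by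
  classical
  set Kf : ((Fin 3 → ℤ) ⧸ TL V) → ℕ := fun g => (l + tks R v h c g.out - 1).toNat with hKf
  let Fs := (Finset.univ : Finset ((Fin 3 → ℤ) ⧸ TL V)).sigma fun g => sK (Kf g)
  let Φ : (Σ _ : ((Fin 3 → ℤ) ⧸ TL V), Σ _ : ℕ, Σ _ : ℕ, ℕ) → (Fin 3 → ℤ) := fun z =>
    z.1.out + (l : ℤ) • V 0 + Tf V ![z.2.1 - tk R v h c 1 z.1.out, z.2.2.1 - tk R v h c 2 z.1.out,
      z.2.2.2 - tk R v h c 3 z.1.out]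
  have hmk : ∀ x m, (Submodule.Quotient.mk (p := TL V) (x + Tf V m)) = Submodule.Quotient.mk x := by
    intro x m
    rw [Submodule.Quotient.eq]
    rw [add_sub_cancel_left]
    exact ⟨m, rfl⟩
  have hout : ∀ g : (Fin 3 → ℤ) ⧸ TL V, (Submodule.Quotient.mk (p := TL V) g.out) = g :=
    fun g => Quotient.out_eq' g
  have hinj : Function.Injective Φ := by
    rintro ⟨g, a, b, d⟩ ⟨g', a', b', d'⟩ he
    simp only [Φ] at he
    have hg : g = g' := by
      have e1 := congrArg (fun x => Submodule.Quotient.mk (p := TL V) (x - (l : ℤ) • V 0)) he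
      simp only [add_sub_right_comm _ (Tf V _), add_sub_cancel_right] at e1
      rw [hmk, hmk, hout, hout] at e1
      exact e1
    subst hg
    have e2 := T.inj (add_left_cancel he)
    have f0 := congrFun e2 0
    have f1 := congrFun e2 1
    have f2 := congrFun e2 2
    simp at f0 f1 f2
    subst f0; subst f1; subst f2; rfl
  have himg : {x | tcond R v c l x} = Φ '' (Fs : Set _) := by
    ext x
    simp only [Set.mem_ofPred_eq, Set.mem_image, Finset.mem_coe]
    constructor
    · intro hx
      set g : (Fin 3 → ℤ) ⧸ TL V := Submodule.Quotient.mk (x - (l : ℤ) • V 0) with hg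
      have : x - (l : ℤ) • V 0 - g.out ∈ TL V := by
        rw [← Submodule.Quotient.eq, hout]
      obtain ⟨m, hm⟩ := this
      have hxe : x = g.out + (l : ℤ) • V 0 + Tf V m := by rw [hm]; abel
      rw [hxe, tcond_iff T] at hx
      obtain ⟨q0, q1, q2, q3⟩ := hx
      refine ⟨⟨g, (tk R v h c 1 g.out + m 0).toNat, (tk R v h c 2 g.out + m 1).toNat,
        (tk R v h c 3 g.out + m 2).toNat⟩, ?_, ?_⟩
      · simp only [Fs, Finset.mem_sigma, Finset.mem_univ, true_and, mem_sK, hKf, tks,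
          Fin.sum_univ_four]
        omega
      · conv_rhs => rw [hxe]
        simp only [Φ]
        congr 2
        apply vec_ext
        · simp [Int.toNat_of_nonneg q1]
        · simp [Int.toNat_of_nonneg q2]
        · simp [Int.toNat_of_nonneg q3]
    · rintro ⟨⟨g, a, b, d⟩, hz, rfl⟩
      simp only [Fs, Finset.mem_sigma, Finset.mem_univ, true_and, mem_sK, hKf, tks,
          Fin.sum_univ_four] at hz
      simp only [Φ]
      rw [tcond_iff T]
      simp
      omega
  rw [NT, himg, Set.ncard_image_of_injective _ hinj, Set.ncard_coe_finset, Finset.card_sigma]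
  push_cast
  apply Finset.sum_congr rfl
  intro g _
  rw [sK_card]
  have hge := tks_ge T R g.out
  rcases (show l + tks R v h c g.out - 1 = -2 ∨ 0 ≤ l + tks R v h c g.out - 1 + 1 by omega) with h1 | h1
  · have : (l : ℝ) + tks R v h c g.out = -1 := by
      have : (l : ℤ) + tks R v h c g.out = -1 := by omega
      exact_mod_cast this
    simp only [hKf, this, h1]; norm_num
  rcases (show l + tks R v h c g.out - 1 = -1 ∨ 0 ≤ l + tks R v h c g.out - 1 by omega) with h1 | h1
  · have : (l : ℝ) + tks R v h c g.out = 0 := by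
      have : (l : ℤ) + tks R v h c g.out = 0 := by omega
      exact_mod_cast this
    simp only [hKf, this, h1]; norm_num
  · have : ((Kf g : ℕ) : ℝ) = (l : ℝ) + tks R v h c g.out - 1 := by
      have : ((Kf g : ℕ) : ℤ) = (l : ℤ) + tks R v h c g.out - 1 := Int.toNat_of_nonneg h1
      exact_mod_cast this
    rw [this]; ring
end

end

section

section
variable {V v : Fin 4 → Fin 3 → ℤ} {h : Fin 4 → ℕ} {c : Fin 4 → ℤ}

theorem out_per {f : (Fin 3 → ℤ) → ℝ} (hf : ∀ x m, f (x + Tf V m) = f x) (x : Fin 3 → ℤ) :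
    f ((Submodule.Quotient.mk (p := TL V) x).out) = f x := by
  have : (Submodule.Quotient.mk (p := TL V) x).out - x ∈ TL V := by
    rw [← Submodule.Quotient.eq]; exact Quotient.out_eq' _
  obtain ⟨m, hm⟩ := this
  rw [← hf x m, hm]
  congr 1; abel

theorem sum_trans [Fintype ((Fin 3 → ℤ) ⧸ TL V)] {f : (Fin 3 → ℤ) → ℝ}
    (hf : ∀ x m, f (x + Tf V m) = f x) (y : Fin 3 → ℤ) :
    ∑ g : (Fin 3 → ℤ) ⧸ TL V, f (g.out + y) = ∑ g : (Fin 3 → ℤ) ⧸ TL V, f g.out := by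
  rw [← Equiv.sum_comp (Equiv.addRight (Submodule.Quotient.mk (p := TL V) y))
    (fun g : (Fin 3 → ℤ) ⧸ TL V => f g.out)]
  apply Finset.sum_congr rfl
  intro g _
  have : g + Submodule.Quotient.mk (p := TL V) y = Submodule.Quotient.mk (p := TL V) (g.out + y) := by
    rw [Submodule.Quotient.mk_add]; congr 1; exact (Quotient.out_eq' g).symm
  simp only [Equiv.coe_addRight]
  rw [this, out_per hf]

theorem tB_per (T : Tet V v h c) (R : Fin 3 → ℝ) (i : Fin 4) (x m : Fin 3 → ℤ) :
    tB R v h c i (x + Tf V m) = tB R v h c i x := by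
  have hp : ∀ i, (h i : ℝ) ≠ 0 := fun i => by have := T.pos i; positivity
  have : ∃ s : ℤ, dt (v i) (Tf V m) = s * h i := by
    obtain ⟨d0, d1, d2, d3⟩ := T.dtTf m
    fin_cases i
    exacts [⟨_, d0⟩, ⟨_, d1⟩, ⟨_, d2⟩, ⟨_, d3⟩]
  obtain ⟨s, hs⟩ := this
  unfold tB
  rw [dt_add, hs, ← Bf_add_int (dt (toR (v i)) R - c i) (((dt (v i) x : ℤ) : ℝ) / h i) s]
  congr 1
  have := hp i
  push_cast; field_simp

theorem pair_sum [Fintype ((Fin 3 → ℤ) ⧸ TL V)] {v w : Fin 3 → ℤ} (hv : IsPrimitive v)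
    (hne : cr v w ≠ 0) {h k : ℕ} (hh : 0 < h) (hk : 0 < k)
    (hqh : gcd3 (cr v w) ∣ h) (hqk : gcd3 (cr v w) ∣ k) (r s : ℝ)
    (hper : ∀ x m, Bf r (((dt v (x + Tf V m) : ℤ) : ℝ) / h) * Bf s (((dt w (x + Tf V m) : ℤ) : ℝ) / k)
      = Bf r (((dt v x : ℤ) : ℝ) / h) * Bf s (((dt w x : ℤ) : ℝ) / k)) :
    ∑ g : (Fin 3 → ℤ) ⧸ TL V, Bf r (((dt v g.out : ℤ) : ℝ) / h) * Bf s (((dt w g.out : ℤ) : ℝ) / k)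
      = (Fintype.card ((Fin 3 → ℤ) ⧸ TL V) : ℝ) * (gcd3 (cr v w) / (h * k)) * kapV v w r s := by
  obtain ⟨p, hp⟩ := exists_residue w hv
  obtain ⟨f, hf, hvw⟩ := exists_prim hne
  obtain ⟨w0, hw0⟩ := prim_bezout hf
  obtain ⟨y3, hy3⟩ := prim_bezout hv
  have hq0 : 0 < gcd3 (cr v w) := gcd3_pos hne
  rw [kapV_eq hv hp]
  have hy : dt (cr v w) w0 = gcd3 (cr v w) := by
    conv_lhs => rw [hvw]
    rw [smul_dt, hw0, mul_one]
  set q := gcd3 (cr v w) with hqdef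
  obtain ⟨n1, rfl⟩ := hqh
  obtain ⟨n2, rfl⟩ := hqk
  have hn1 : 0 < n1 := Nat.pos_of_mul_pos_left hh
  have hn2 : 0 < n2 := Nat.pos_of_mul_pos_left hk
  have hq' : (q : ℝ) ≠ 0 := by positivity
  have hn1' : (n1 : ℝ) ≠ 0 := by positivity
  have hn2' : (n2 : ℝ) ≠ 0 := by positivity
  have a1 : dt v (cr w w0) = q := by rw [← hy, dt_comm, dt_cr_cycle, dt_cr_cycle]
  have a2 : dt w (cr w w0) = 0 := dt_cr_left _ _
  have b1 : dt v (cr w0 v) = 0 := dt_cr_right _ _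
  have b2 : dt w (cr w0 v) = q := by rw [← hy, dt_comm, dt_cr_cycle]
  set S := ∑ g : (Fin 3 → ℤ) ⧸ TL V, Bf r (((dt v g.out : ℤ) : ℝ) / (q * n1 : ℕ)) *
    Bf s (((dt w g.out : ℤ) : ℝ) / (q * n2 : ℕ)) with hS
  have key : ∑ e ∈ Finset.range q, ∑ a ∈ Finset.range n1, ∑ b ∈ Finset.range n2, S
      = ∑ g : (Fin 3 → ℤ) ⧸ TL V, kap q p r s := by
    have step : ∀ e a b : ℕ, S = ∑ g : (Fin 3 → ℤ) ⧸ TL V,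
        Bf r ((((dt v g.out + e : ℤ) : ℝ)) / (q * n1 : ℕ) + a / n1) *
        Bf s ((((dt w g.out + e * dt w y3 : ℤ) : ℝ)) / (q * n2 : ℕ) + b / n2) := by
      intro e a b
      rw [hS, ← sum_trans (V := V) (f := fun x => Bf r (((dt v x : ℤ) : ℝ) / (q * n1 : ℕ)) * Bf s (((dt w x : ℤ) : ℝ) / (q * n2 : ℕ))) hper ((e : ℤ) • y3 + (a : ℤ) • cr w w0 + (b : ℤ) • cr w0 v)]
      apply Finset.sum_congr rfl
      intro g _
      simp only [dt_add, dt_smul, a1, a2, b1, b2, hy3]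
      congr 2 <;> (push_cast; field_simp; ring)
    rw [Finset.sum_congr rfl (fun e _ => Finset.sum_congr rfl (fun a _ =>
      Finset.sum_congr rfl (fun b _ => step e a b)))]
    rw [Finset.sum_congr rfl (fun e _ => Finset.sum_congr rfl (fun a _ => Finset.sum_comm)),
      Finset.sum_congr rfl (fun e _ => Finset.sum_comm), Finset.sum_comm]
    apply Finset.sum_congr rfl
    intro g _
    simp only [← Finset.mul_sum, ← Finset.sum_mul]
    simp only [Bf_distrib hn1, Bf_distrib hn2]
    rw [← kap_shift hq0 p r s (dt v g.out)]
    apply Finset.sum_congr rfl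
    intro e _
    congr 1
    · congr 1; push_cast; field_simp
    · have h1 : (n2 : ℝ) * (((dt w g.out + e * dt w y3 : ℤ) : ℝ) / (q * n2 : ℕ))
        = ((dt w g.out + e * dt w y3 : ℤ) : ℝ) / q := by push_cast; field_simp
      rw [h1, Bf_mod hq0 s (b := p * (dt v g.out + e))]
      · push_cast; rfl
      · have := dvd_dt (q := q) (a := w - p • v) (fun i => by simpa using hp i) (g.out + (e : ℤ) • y3)
        rw [sub_dt, smul_dt, dt_add, dt_add, dt_smul, dt_smul, hy3] at this
        convert this using 1
        ring
  simp at key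
  push_cast
  field_simp
  linarith

theorem sq_sum [Fintype ((Fin 3 → ℤ) ⧸ TL V)] {v : Fin 3 → ℤ} (hv : IsPrimitive v)
    {h : ℕ} (hh : 0 < h) (r : ℝ)
    (hper : ∀ x m, Bf r (((dt v (x + Tf V m) : ℤ) : ℝ) / h) ^ 2
      = Bf r (((dt v x : ℤ) : ℝ) / h) ^ 2) :
    ∑ g : (Fin 3 → ℤ) ⧸ TL V, Bf r (((dt v g.out : ℤ) : ℝ) / h) ^ 2
      = (Fintype.card ((Fin 3 → ℤ) ⧸ TL V) : ℝ) * (1 / 12 + 1 / (6 * (h : ℝ) ^ 2)) := by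
  obtain ⟨y3, hy3⟩ := prim_bezout hv
  have hh' : (h : ℝ) ≠ 0 := by positivity
  set S := ∑ g : (Fin 3 → ℤ) ⧸ TL V, Bf r (((dt v g.out : ℤ) : ℝ) / h) ^ 2 with hS
  have key : ∑ e ∈ Finset.range h, S
      = ∑ g : (Fin 3 → ℤ) ⧸ TL V, ((h : ℝ) / 12 + 1 / (6 * h)) := by
    have step : ∀ e : ℕ, S = ∑ g : (Fin 3 → ℤ) ⧸ TL V,
        Bf r ((((e : ℤ) + dt v g.out : ℤ) : ℝ) / h) ^ 2 := by
      intro e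
      rw [hS, ← sum_trans (V := V) (f := fun x => Bf r (((dt v x : ℤ) : ℝ) / h) ^ 2) hper ((e : ℤ) • y3)]
      apply Finset.sum_congr rfl
      intro g _
      simp only [dt_add, dt_smul, hy3]
      congr 3; push_cast; ring
    rw [Finset.sum_congr rfl (fun e _ => step e), Finset.sum_comm]
    apply Finset.sum_congr rfl
    intro g _
    rw [← Bf_sq_sum hh r]
    have hp : ∀ a : ℤ, (fun a : ℤ => Bf r ((a : ℝ) / h) ^ 2) (a + h)
        = (fun a : ℤ => Bf r ((a : ℝ) / h) ^ 2) a := by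
      intro a
      have := Bf_per' hh r 0 a
      simp only [zero_add] at this
      simp only [this]
    have := sum_per_add (q := h) (f := fun a : ℤ => Bf r ((a : ℝ) / h) ^ 2) hp (dt v g.out)
    simpa using this
  simp at key
  field_simp
  field_simp at key
  linarith

/-- incidence facts for a pair -/
theorem Tet.pair (T : Tet V v h c) {i j k l : Fin 4} (hij : i ≠ j) (hik : i ≠ k) (hil : i ≠ l)
    (hjk : j ≠ k) (hjl : j ≠ l) :
    cr (v i) (v j) ≠ 0 ∧ gcd3 (cr (v i) (v j)) ∣ h i ∧
    (|dt (cr (V i - V k) (V j - V k)) (V l - V k)| * gcd3 (cr (v i) (v j)) : ℤ)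
      = gcd3 (V l - V k) * h i * h j := by
  have z1 : cr (V i - V k) (cr (v i) (v j)) = - ((h i : ℤ) • v j) := by
    rw [cr_cr, dt_comm _ (v j), dt_comm _ (v i), T.ev, T.ev]
    simp [hij.symm, hik, hjk]
  have hne : cr (v i) (v j) ≠ 0 := by
    intro h0
    rw [h0] at z1
    have h3 : cr (V i - V k) (0 : Fin 3 → ℤ) = 0 := by apply vec_ext <;> simp
    rw [h3, zero_eq_neg, smul_eq_zero] at z1
    rcases z1 with h1 | h1
    · have := T.pos i; omega
    · exact prim_ne_zero (T.prim j) h1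
  have hd := gcd3_dvd (cr (v i) (v j))
  refine ⟨hne, ?_, ?_⟩
  · have : (gcd3 (cr (v i) (v j)) : ℤ) ∣ h i := by
      apply prim_dvd (T.prim j)
      intro a
      have h1 : (h i : ℤ) * v j a = - cr (V i - V k) (cr (v i) (v j)) a := by rw [z1]; simp
      rw [h1, dvd_neg]
      generalize cr (v i) (v j) = z at *
      fin_cases a
      · exact dvd_sub ((hd 2).mul_left _) ((hd 1).mul_left _)
      · exact dvd_sub ((hd 0).mul_left _) ((hd 2).mul_left _)
      · exact dvd_sub ((hd 1).mul_left _) ((hd 0).mul_left _)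
    exact_mod_cast this
  · obtain ⟨f, hf, hvw⟩ := exists_prim hne
    have hpar : cr (cr (v i) (v j)) (V l - V k) = 0 := by
      rw [cr_anti, cr_cr, dt_comm _ (v j), dt_comm _ (v i), T.ev, T.ev]
      simp [hik, hil, hjk, hjl]
    set q := gcd3 (cr (v i) (v j)) with hq
    have hq0 : 0 < q := gcd3_pos hne
    have hpar2 : cr f (V l - V k) = 0 := by
      rw [hvw, cr_smul_left, smul_eq_zero] at hpar
      exact hpar.resolve_left (by omega)
    obtain ⟨t, ht⟩ := prim_parallel hf hpar2
    have hV := gcd3_smul_prim hf t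
    rw [← ht] at hV
    rw [hV]
    have hG : dt (cr (V i - V k) (V j - V k)) (cr (v i) (v j)) = h i * h j := by
      have : ∀ a b x y : Fin 3 → ℤ, dt (cr a b) (cr x y) = dt x a * dt y b - dt x b * dt y a := by
        intro a b x y; simp only [dt, cr_0, cr_1, cr_2]; ring
      rw [this, T.ev, T.ev, T.ev, T.ev]
      simp [hij, hij.symm, hik, hjk]
    rw [hvw, dt_smul] at hG
    rw [ht, dt_smul, abs_mul]
    have hpos : 0 ≤ dt (cr (V i - V k) (V j - V k)) f := by
      by_contra hn
      have : (q : ℤ) * dt (cr (V i - V k) (V j - V k)) f < 0 :=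
        mul_neg_of_pos_of_neg (by exact_mod_cast hq0) (by omega)
      have h2 : (0:ℤ) ≤ (h i : ℤ) * h j := by positivity
      omega
    rw [abs_of_nonneg hpos, mul_assoc |t|, mul_assoc |t|, ← hG]
    ring

/-- total edge contribution of a tetrahedron. -/
def tM (R : Fin 3 → ℝ) (V v : Fin 4 → Fin 3 → ℤ) : ℝ :=
  Mv R (V 2) (V 3) (v 0) (v 1) + Mv R (V 1) (V 3) (v 0) (v 2) + Mv R (V 1) (V 2) (v 0) (v 3)
  + Mv R (V 0) (V 3) (v 1) (v 2) + Mv R (V 0) (V 2) (v 1) (v 3) + Mv R (V 0) (V 1) (v 2) (v 3)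

theorem Tet.cross (T : Tet V v h c) (R : Fin 3 → ℝ) [Fintype ((Fin 3 → ℤ) ⧸ TL V)]
    {i j k l : Fin 4} (hij : i ≠ j) (hik : i ≠ k) (hil : i ≠ l)
    (hjk : j ≠ k) (hjl : j ≠ l)
    (hD : |dt (cr (V i - V k) (V j - V k)) (V l - V k)| = |tD V|) :
    ∑ g : (Fin 3 → ℤ) ⧸ TL V, tB R v h c i g.out * tB R v h c j g.out
      - (Fintype.card ((Fin 3 → ℤ) ⧸ TL V) : ℝ) / (12 * (h i * h j)) *
        (((dt (v i) (v j) : ℤ) : ℝ) *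
          (1 / ((dt (v i) (v i) : ℤ) : ℝ) + 1 / ((dt (v j) (v j) : ℤ) : ℝ)))
      = Mv R (V k) (V l) (v i) (v j) := by
  obtain ⟨hne, hdi, hvol⟩ := T.pair hij hik hil hjk hjl
  obtain ⟨-, hdj, -⟩ := T.pair hij.symm hjk hjl hik hil
  rw [gcd3_cr_comm] at hdj
  have hps := pair_sum (V := V) (T.prim i) hne (T.pos i) (T.pos j) hdi hdj
    (dt (toR (v i)) R - c i) (dt (toR (v j)) R - c j) (fun x m => by
      have h1 := tB_per T R i x m
      have h2 := tB_per T R j x m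
      unfold tB at h1 h2
      rw [h1, h2])
  have hcard : (Fintype.card ((Fin 3 → ℤ) ⧸ TL V) : ℤ) = |tD V| := by
    rw [← Nat.card_eq_fintype_card, T.card]; exact Int.natCast_natAbs _
  rw [hD, ← hcard] at hvol
  have hvolR : (Fintype.card ((Fin 3 → ℤ) ⧸ TL V) : ℝ) * gcd3 (cr (v i) (v j))
      = gcd3 (V l - V k) * h i * h j := by exact_mod_cast hvol
  have hq0 : 0 < gcd3 (cr (v i) (v j)) := gcd3_pos hne
  have hi := T.pos i
  have hj := T.pos j
  have q1 : (gcd3 (cr (v i) (v j)) : ℝ) ≠ 0 := by positivity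
  have q2 : (h i : ℝ) ≠ 0 := by positivity
  have q3 : (h j : ℝ) ≠ 0 := by positivity
  unfold tB
  rw [hps]
  unfold Mv nu
  rw [dt_sub, dt_sub, dt_toR, dt_toR, T.eval, T.eval, if_neg hik, if_neg hjk, add_zero, add_zero]
  have e1 : (gcd3 (V l - V k) : ℝ) = (Fintype.card ((Fin 3 → ℤ) ⧸ TL V) : ℝ) *
      gcd3 (cr (v i) (v j)) / (h i * h j) := by
    rw [hvolR]; field_simp
  rw [e1]
  field_simp

theorem Tet.linear (T : Tet V v h c) (R : Fin 3 → ℝ) [Fintype ((Fin 3 → ℤ) ⧸ TL V)] :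
    ∑ g : (Fin 3 → ℤ) ⧸ TL V, ((tks R v h c g.out : ℝ) ^ 2 / 2 - 1 / 6) = tM R V v := by
  have c01 := T.cross R (i := 0) (j := 1) (k := 2) (l := 3) (by decide) (by decide) (by decide)
    (by decide) (by decide) (by
      congr 1; simp only [tD, dt, cr_0, cr_1, cr_2, Pi.sub_apply]; ring)
  have c02 := T.cross R (i := 0) (j := 2) (k := 1) (l := 3) (by decide) (by decide) (by decide)
    (by decide) (by decide) (by
      rw [← abs_neg]; congr 1; simp only [tD, dt, cr_0, cr_1, cr_2, Pi.sub_apply]; ring)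
  have c03 := T.cross R (i := 0) (j := 3) (k := 1) (l := 2) (by decide) (by decide) (by decide)
    (by decide) (by decide) (by
      congr 1; simp only [tD, dt, cr_0, cr_1, cr_2, Pi.sub_apply]; ring)
  have c12 := T.cross R (i := 1) (j := 2) (k := 0) (l := 3) (by decide) (by decide) (by decide)
    (by decide) (by decide) (by
      congr 1)
  have c13 := T.cross R (i := 1) (j := 3) (k := 0) (l := 2) (by decide) (by decide) (by decide)
    (by decide) (by decide) (by
      rw [← abs_neg]; congr 1; simp only [tD, dt, cr_0, cr_1, cr_2, Pi.sub_apply]; ring)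
  have c23 := T.cross R (i := 2) (j := 3) (k := 0) (l := 1) (by decide) (by decide) (by decide)
    (by decide) (by decide) (by
      congr 1; simp only [tD, dt, cr_0, cr_1, cr_2, Pi.sub_apply]; ring)
  have sq : ∀ i, ∑ g : (Fin 3 → ℤ) ⧸ TL V, tB R v h c i g.out ^ 2
      = (Fintype.card ((Fin 3 → ℤ) ⧸ TL V) : ℝ) * (1 / 12 + 1 / (6 * (h i : ℝ) ^ 2)) := by
    intro i
    apply sq_sum (T.prim i) (T.pos i)
    intro x m
    have h1 := tB_per T R i x m
    unfold tB at h1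
    rw [h1]
  have expand : ∀ g : (Fin 3 → ℤ) ⧸ TL V, ((tks R v h c g.out : ℝ) ^ 2 / 2 - 1 / 6)
      = (1/2) * tB R v h c 0 g.out ^ 2 + (1/2) * tB R v h c 1 g.out ^ 2
      + (1/2) * tB R v h c 2 g.out ^ 2
      + (1/2) * tB R v h c 3 g.out ^ 2 + tB R v h c 0 g.out * tB R v h c 1 g.out
      + tB R v h c 0 g.out * tB R v h c 2 g.out + tB R v h c 0 g.out * tB R v h c 3 g.out
      + tB R v h c 1 g.out * tB R v h c 2 g.out + tB R v h c 1 g.out * tB R v h c 3 g.out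
      + tB R v h c 2 g.out * tB R v h c 3 g.out - 1 / 6 := by
    intro g
    rw [tks_eq T, Fin.sum_univ_four]
    ring
  rw [Finset.sum_congr rfl (fun g _ => expand g)]
  simp only [Finset.sum_add_distrib, Finset.sum_sub_distrib, ← Finset.mul_sum, sq]
  unfold tM
  rw [← c01, ← c02, ← c03, ← c12, ← c13, ← c23]
  simp only [Finset.sum_const, Finset.card_univ, nsmul_eq_mul]
  have rel : ∀ i, ∑ j, ((dt (v i) (v j) : ℤ) : ℝ) / h j = 0 := by
    intro i
    have := T.sum_zero (toR (v i))
    simp only [dt_toR] at this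
    rw [← this]
    apply Finset.sum_congr rfl; intro j _; rw [dt_comm]
  have r0 := rel 0; have r1 := rel 1; have r2 := rel 2; have r3 := rel 3
  rw [Fin.sum_univ_four] at r0 r1 r2 r3
  have hp : ∀ i, (h i : ℝ) ≠ 0 := fun i => by have := T.pos i; positivity
  have hn : ∀ i, ((dt (v i) (v i) : ℤ) : ℝ) ≠ 0 := by
    intro i
    rw [← dt_toR]
    apply (dt_self_pos _).ne'
    intro h0
    exact prim_ne_zero (T.prim i) (toR_inj (by rw [h0]; funext; simp [toR]))
  have m0 := hp 0; have m1 := hp 1; have m2 := hp 2; have m3 := hp 3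
  have n0 := hn 0; have n1 := hn 1; have n2 := hn 2; have n3 := hn 3
  have s10 := dt_comm (v 1) (v 0); have s20 := dt_comm (v 2) (v 0); have s30 := dt_comm (v 3) (v 0)
  have s21 := dt_comm (v 2) (v 1); have s31 := dt_comm (v 3) (v 1); have s32 := dt_comm (v 3) (v 2)
  rw [s10] at r1; rw [s20, s21] at r2; rw [s30, s31, s32] at r3
  generalize (Fintype.card ((Fin 3 → ℤ) ⧸ TL V) : ℝ) = G at *
  generalize ((dt (v 0) (v 0) : ℤ) : ℝ) = a00 at *
  generalize ((dt (v 1) (v 1) : ℤ) : ℝ) = a11 at *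
  generalize ((dt (v 2) (v 2) : ℤ) : ℝ) = a22 at *
  generalize ((dt (v 3) (v 3) : ℤ) : ℝ) = a33 at *
  generalize ((dt (v 0) (v 1) : ℤ) : ℝ) = a01 at *
  generalize ((dt (v 0) (v 2) : ℤ) : ℝ) = a02 at *
  generalize ((dt (v 0) (v 3) : ℤ) : ℝ) = a03 at *
  generalize ((dt (v 1) (v 2) : ℤ) : ℝ) = a12 at *
  generalize ((dt (v 1) (v 3) : ℤ) : ℝ) = a13 at *
  generalize ((dt (v 2) (v 3) : ℤ) : ℝ) = a23 at *
  have t0 : 1 / (h 0 : ℝ) = -(a01 / h 1 + a02 / h 2 + a03 / h 3) / a00 := by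
    rw [eq_div_iff n0]; rw [one_div, inv_mul_eq_div]; linarith
  have t1 : 1 / (h 1 : ℝ) = -(a01 / h 0 + a12 / h 2 + a13 / h 3) / a11 := by
    rw [eq_div_iff n1]; rw [one_div, inv_mul_eq_div]; linarith
  have t2 : 1 / (h 2 : ℝ) = -(a02 / h 0 + a12 / h 1 + a23 / h 3) / a22 := by
    rw [eq_div_iff n2]; rw [one_div, inv_mul_eq_div]; linarith
  have t3 : 1 / (h 3 : ℝ) = -(a03 / h 0 + a13 / h 1 + a23 / h 2) / a33 := by
    rw [eq_div_iff n3]; rw [one_div, inv_mul_eq_div]; linarith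
  have u : ∀ i, 1 / (6 * (h i : ℝ) ^ 2) = (1 / 6) * (1 / h i) * (1 / h i) := by
    intro i; have := hp i; field_simp
  rw [u 0, u 1, u 2, u 3]
  linear_combination (G / 12) * (1 / h 0) * t0 + (G / 12) * (1 / h 1) * t1
    + (G / 12) * (1 / h 2) * t2 + (G / 12) * (1 / h 3) * t3
end

end

section

section
variable {V v : Fin 4 → Fin 3 → ℤ} {h : Fin 4 → ℕ} {c : Fin 4 → ℤ}

theorem Tet.sum_one (T : Tet V v h c) (R : Fin 3 → ℝ) :
    ∑ i, (dt (toR (v i)) R - c i) / h i = 1 := by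
  have h0 := T.sum_zero (R - toR (V 0))
  have hp : ∀ i, (h i : ℝ) ≠ 0 := fun i => by have := T.pos i; positivity
  simp only [dt_sub, dt_toR, T.eval] at h0
  rw [Fin.sum_univ_four] at h0 ⊢
  have := hp 0; have := hp 1; have := hp 2; have := hp 3
  simp at h0
  rw [← sub_eq_zero]
  rw [← h0]
  field_simp
  ring

theorem Bf_half {r y : ℝ} (hB : Bf r y = -(1/2)) : 0 < r ∧ Int.fract y = 0 := by
  by_cases h : 0 < r
  · rw [Bf_pos h] at hB; exact ⟨h, by linarith⟩
  · rw [Bf_nonpos h] at hB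
    have := Int.fract_lt_one (-y); linarith

theorem Bf_half' {r y : ℝ} (hB : Bf r y = 1/2) : ¬ 0 < r := by
  intro h
  rw [Bf_pos h] at hB
  have := Int.fract_lt_one y; linarith

theorem Tet.const (T : Tet V v h c) (R : Fin 3 → ℝ) [Fintype ((Fin 3 → ℤ) ⧸ TL V)]
    [Decidable (∀ i, 0 < dt (toR (v i)) R - c i)] :
    ∑ g : (Fin 3 → ℤ) ⧸ TL V, ((tks R v h c g.out : ℝ) ^ 3 - tks R v h c g.out) / 6
      = if ∀ i, 0 < dt (toR (v i)) R - c i then 1 else 0 := by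
  classical
  have hp : ∀ i, (h i : ℝ) ≠ 0 := fun i => by have := T.pos i; positivity
  have hlo : ∀ x i, -(1/2) ≤ tB R v h c i x := fun x i => le_Bf _ _
  have hhi : ∀ x i, tB R v h c i x ≤ 1/2 := fun x i => Bf_le _ _
  have hsum : ∀ x, (tks R v h c x : ℝ) = -(tB R v h c 0 x + tB R v h c 1 x + tB R v h c 2 x
      + tB R v h c 3 x) := by
    intro x; rw [tks_eq T, Fin.sum_univ_four]
  -- range of k
  have hle : ∀ x, tks R v h c x ≤ 2 := by
    intro x
    have : (tks R v h c x : ℝ) ≤ 2 := by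
      rw [hsum]; linarith [hlo x 0, hlo x 1, hlo x 2, hlo x 3]
    exact_mod_cast this
  have hne : ∀ x, tks R v h c x ≠ -2 := by
    intro x hx
    have h1 := hsum x
    rw [hx] at h1
    push_cast at h1
    have h2 : ∀ i, ¬ 0 < dt (toR (v i)) R - c i := by
      have h0 : tB R v h c 0 x = 1/2 := by linarith [hhi x 0, hhi x 1, hhi x 2, hhi x 3]
      have h1 : tB R v h c 1 x = 1/2 := by linarith [hhi x 0, hhi x 1, hhi x 2, hhi x 3]
      have h2 : tB R v h c 2 x = 1/2 := by linarith [hhi x 0, hhi x 1, hhi x 2, hhi x 3]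
      have h3 : tB R v h c 3 x = 1/2 := by linarith [hhi x 0, hhi x 1, hhi x 2, hhi x 3]
      intro i
      fin_cases i
      exacts [Bf_half' h0, Bf_half' h1, Bf_half' h2, Bf_half' h3]
    have h3 := T.sum_one R
    have : ∑ i, (dt (toR (v i)) R - c i) / h i ≤ 0 := by
      apply Finset.sum_nonpos
      intro i _
      exact div_nonpos_of_nonpos_of_nonneg (not_lt.1 (h2 i)) (by positivity)
    linarith
  have htwo : ∀ x, tks R v h c x = 2 → (∀ i, 0 < dt (toR (v i)) R - c i) ∧ x ∈ TL V := by
    intro x hx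
    have h1 := hsum x
    rw [hx] at h1
    push_cast at h1
    have k0 : tB R v h c 0 x = -(1/2) := by linarith [hlo x 0, hlo x 1, hlo x 2, hlo x 3]
    have k1 : tB R v h c 1 x = -(1/2) := by linarith [hlo x 0, hlo x 1, hlo x 2, hlo x 3]
    have k2 : tB R v h c 2 x = -(1/2) := by linarith [hlo x 0, hlo x 1, hlo x 2, hlo x 3]
    have k3 : tB R v h c 3 x = -(1/2) := by linarith [hlo x 0, hlo x 1, hlo x 2, hlo x 3]
    have ka := Bf_half k0; have kb := Bf_half k1; have kc := Bf_half k2; have kd := Bf_half k3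
    constructor
    · intro i
      fin_cases i
      exacts [ka.1, kb.1, kc.1, kd.1]
    have hz : ∀ i, Int.fract (((dt (v i) x : ℤ) : ℝ) / h i) = 0 → ∃ m : ℤ, dt (v i) x = m * h i := by
      intro i hi
      refine ⟨⌊((dt (v i) x : ℤ) : ℝ) / h i⌋, ?_⟩
      have h4 : ((dt (v i) x : ℤ) : ℝ) / h i = ⌊((dt (v i) x : ℤ) : ℝ) / h i⌋ := by
        rw [Int.fract] at hi; linarith
      have := hp i
      rw [div_eq_iff this] at h4
      exact_mod_cast h4
    obtain ⟨m1, e1⟩ := hz 1 kb.2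
    obtain ⟨m2, e2⟩ := hz 2 kc.2
    obtain ⟨m3, e3⟩ := hz 3 kd.2
    refine ⟨![m1, m2, m3], ?_⟩
    obtain ⟨d0, d1, d2, d3⟩ := T.dtTf ![m1, m2, m3]
    rw [← sub_eq_zero]
    apply T.eq_zero <;> rw [dt_sub]
    · rw [d1, e1]; simp
    · rw [d2, e2]; simp
    · rw [d3, e3]; simp
  have hterm : ∀ x, tks R v h c x ≠ 2 →
      ((tks R v h c x : ℝ) ^ 3 - tks R v h c x) / 6 = 0 := by
    intro x hx
    have h1 := hle x; have h2 := hne x; have h3 := tks_ge T R x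
    have : tks R v h c x = -1 ∨ tks R v h c x = 0 ∨ tks R v h c x = 1 := by omega
    rcases this with h | h | h <;> rw [h] <;> norm_num
  split_ifs with hall
  · rw [Finset.sum_eq_single (0 : (Fin 3 → ℤ) ⧸ TL V)]
    · set x := (0 : (Fin 3 → ℤ) ⧸ TL V).out
      have hx : x ∈ TL V := by
        rw [← Submodule.Quotient.mk_eq_zero]; exact Quotient.out_eq' _
      obtain ⟨m, hm⟩ := hx
      have hB : ∀ i, tB R v h c i x = -(1/2) := by
        intro i
        have := tB_per T R i 0 m
        rw [zero_add, hm] at this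
        rw [this, tB, Bf_pos (hall i)]
        have : dt (v i) 0 = 0 := by simp [dt]
        rw [this]; simp
      rw [hsum, hB, hB, hB, hB]; norm_num
    · intro g _ hg
      apply hterm
      intro h2
      apply hg
      have := (htwo _ h2).2
      rw [← Submodule.Quotient.mk_eq_zero] at this
      rw [← this]; exact (Quotient.out_eq' g).symm
    · simp
  · apply Finset.sum_eq_zero
    intro g _
    apply hterm
    intro h2
    exact hall (htwo _ h2).1

open Classical in
theorem Tet.main (T : Tet V v h c) (R : Fin 3 → ℝ) :
    ∃ c3 c2 : ℚ, ∀ l : ℕ, 1 ≤ l → (NT R v c l : ℝ) = c3 * (l : ℝ) ^ 3 + c2 * (l : ℝ) ^ 2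
      + tM R V v * l + (if ∀ i, 0 < dt (toR (v i)) R - c i then 1 else 0) := by
  have := T.fin
  have := Fintype.ofFinite ((Fin 3 → ℤ) ⧸ TL V)
  refine ⟨(Fintype.card ((Fin 3 → ℤ) ⧸ TL V)) / 6,
    (∑ g : (Fin 3 → ℤ) ⧸ TL V, (tks R v h c g.out : ℚ)) / 2, ?_⟩
  intro l hl
  rw [tet_count T R l hl, ← T.const R, ← T.linear R]
  push_cast
  rw [Finset.sum_mul, Finset.sum_div, Finset.sum_mul]
  have : (Fintype.card ((Fin 3 → ℤ) ⧸ TL V) : ℝ) / 6 * (l : ℝ) ^ 3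
      = ∑ g : (Fin 3 → ℤ) ⧸ TL V, (l : ℝ) ^ 3 / 6 := by
    simp; ring
  rw [this, ← Finset.sum_add_distrib, ← Finset.sum_add_distrib, ← Finset.sum_add_distrib]
  apply Finset.sum_congr rfl
  intro g _
  ring

end

/-- the primitive normal of a nonzero vector, and the primitive part -/
def prm (x : Fin 3 → ℤ) : Fin 3 → ℤ := fun i => x i / gcd3 x

theorem prm_spec (x : Fin 3 → ℤ) : x = (gcd3 x : ℤ) • prm x := by
  funext i
  simp only [Pi.smul_apply, smul_eq_mul, prm]
  rw [Int.mul_ediv_cancel' (gcd3_dvd x i)]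

theorem prm_prim {x : Fin 3 → ℤ} (hx : x ≠ 0) : IsPrimitive (prm x) := by
  have h := prm_spec x
  have h1 := gcd3_smul (gcd3 x) (prm x)
  rw [← h] at h1
  have := gcd3_pos hx
  rw [abs_of_nonneg (by positivity)] at h1
  change gcd3 (prm x) = 1
  have h2 : gcd3 x * 1 = gcd3 x * gcd3 (prm x) := by rw [mul_one]; exact_mod_cast h1
  exact (Nat.eq_of_mul_eq_mul_left this h2).symm

theorem prm_neg (x : Fin 3 → ℤ) : prm (-x) = - prm x := by
  funext i
  simp only [prm, Pi.neg_apply, gcd3_neg]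
  exact Int.neg_ediv_of_dvd (gcd3_dvd x i)

theorem dt_prm (x y : Fin 3 → ℤ) : dt x y = gcd3 x * dt (prm x) y := by
  conv_lhs => rw [prm_spec x]
  rw [smul_dt]

end

section

/-- signed edge contribution -/
def Th (R : Fin 3 → ℝ) (X Y n m : Fin 3 → ℤ) : ℝ :=
  ((Int.sign (dt (cr n m) (Y - X)) : ℤ) : ℝ) * Mv R X Y n m

section
variable {R : Fin 3 → ℝ} {X Y n m : Fin 3 → ℤ}

theorem Th_neg_right (hR : Gen R) (hn : IsPrimitive n) (hm : IsPrimitive m) :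
    Th R X Y n (-m) = Th R X Y n m := by
  unfold Th
  rw [Mv_neg_right hR X Y hn hm, cr_neg_right, neg_dt, Int.sign_neg]; push_cast; ring

theorem Th_anti (hn : IsPrimitive n) (hm : IsPrimitive m) :
    Th R X Y m n = - Th R X Y n m := by
  unfold Th
  rw [Mv_symm X Y hm hn, cr_anti, neg_dt, Int.sign_neg]; push_cast; ring

theorem Th_neg_left (hR : Gen R) (hn : IsPrimitive n) (hm : IsPrimitive m) :
    Th R X Y (-n) m = Th R X Y n m := by
  rw [Th_anti hm (prim_neg hn), Th_neg_right hR hm hn, Th_anti hm hn]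

theorem Th_swap (h1 : dt n X = dt n Y) (h2 : dt m X = dt m Y) :
    Th R Y X n m = - Th R X Y n m := by
  unfold Th
  rw [Mv_swap h1 h2, show X - Y = -(Y - X) by abel, dt_neg, Int.sign_neg]; push_cast; ring

theorem Th_parallel (h : cr n m = 0) : Th R X Y n m = 0 := by
  unfold Th; rw [Mv_parallel X Y h, mul_zero]

theorem Th_self : Th R X Y n n = 0 := Th_parallel (by apply vec_ext <;> simp <;> ring)

theorem Th_congr (hR : Gen R) {n' m' : Fin 3 → ℤ} (hn : IsPrimitive n) (hm : IsPrimitive m)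
    (h1 : n' = n ∨ n' = -n) (h2 : m' = m ∨ m' = -m) : Th R X Y n' m' = Th R X Y n m := by
  rcases h1 with rfl | rfl <;> rcases h2 with rfl | rfl
  · rfl
  · exact Th_neg_right hR hn hm
  · exact Th_neg_left hR hn hm
  · rw [Th_neg_left hR hn (prim_neg hm), Th_neg_right hR hn hm]
end

def thS (R : Fin 3 → ℝ) (V n : Fin 4 → Fin 3 → ℤ) : ℝ :=
  Th R (V 0) (V 1) (n 2) (n 3) + Th R (V 0) (V 2) (n 3) (n 1) + Th R (V 0) (V 3) (n 1) (n 2)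
  + Th R (V 2) (V 3) (n 0) (n 1) + Th R (V 3) (V 1) (n 0) (n 2) + Th R (V 1) (V 2) (n 0) (n 3)

theorem edge_det (a b e x y : Fin 3 → ℤ) (hx : dt x e = 0) (hy : dt y e = 0) :
    dt (cr a b) e * dt (cr x y) e = dt e e * (dt x a * dt y b - dt x b * dt y a) := by
  rw [det_mul, dt_comm e x, dt_comm e y, hx, hy, dt_comm x a, dt_comm y b, dt_comm x b, dt_comm y a]; ring

theorem dt_self_pos_int {e : Fin 3 → ℤ} (he : e ≠ 0) : 0 < dt e e := by
  have : e 0 ≠ 0 ∨ e 1 ≠ 0 ∨ e 2 ≠ 0 := by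
    by_contra hc
    push Not at hc
    exact he (vec_ext hc.1 hc.2.1 hc.2.2)
  unfold dt
  rcases this with h | h | h
  · nlinarith [mul_self_pos.2 h, mul_self_nonneg (e 1), mul_self_nonneg (e 2)]
  · nlinarith [mul_self_pos.2 h, mul_self_nonneg (e 0), mul_self_nonneg (e 2)]
  · nlinarith [mul_self_pos.2 h, mul_self_nonneg (e 1), mul_self_nonneg (e 0)]

theorem sign_eq_of_mul_pos {a b : ℤ} (h : 0 < a * b) : Int.sign a = Int.sign b := by
  rcases pos_and_pos_or_neg_and_neg_of_mul_pos h with ⟨h1, h2⟩ | ⟨h1, h2⟩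
  · rw [Int.sign_eq_one_of_pos h1, Int.sign_eq_one_of_pos h2]
  · rw [Int.sign_eq_neg_one_of_neg h1, Int.sign_eq_neg_one_of_neg h2]

section
variable {V v : Fin 4 → Fin 3 → ℤ} {h : Fin 4 → ℕ} {c : Fin 4 → ℤ}

theorem Tet.sgn (T : Tet V v h c) {i j k l : Fin 4} (hij : i ≠ j) (hik : i ≠ k) (hil : i ≠ l)
    (hjk : j ≠ k) (hjl : j ≠ l)
    (hD : dt (cr (V i - V k) (V j - V k)) (V l - V k) = tD V) :
    Int.sign (dt (cr (v i) (v j)) (V l - V k)) = Int.sign (tD V) := by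
  symm
  rw [← hD]
  apply sign_eq_of_mul_pos
  rw [edge_det]
  · rw [T.ev, T.ev, T.ev, T.ev]
    simp [hij, hij.symm, hik, hjk]
    have he : V l - V k ≠ 0 := by
      intro h0
      apply T.tD_ne
      rw [← hD, h0]; simp [dt]
    have := dt_self_pos_int he
    have := T.pos i; have := T.pos j
    positivity
  · rw [T.ev]; simp [hik, hil]
  · rw [T.ev]; simp [hjk, hjl]

theorem Tet.theta (T : Tet V v h c) (R : Fin 3 → ℝ) :
    ((Int.sign (tD V) : ℤ) : ℝ) * tM R V v = thS R V v := by
  have d : ∀ i k l : Fin 4, i ≠ k → i ≠ l → dt (v i) (V k) = dt (v i) (V l) := by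
    intro i k l h1 h2; rw [T.eval, T.eval, if_neg h1, if_neg h2]
  unfold thS tM Th
  rw [T.sgn (i := 2) (j := 3) (k := 0) (l := 1) (by decide) (by decide) (by decide)
    (by decide) (by decide) (by simp only [tD, dt, cr_0, cr_1, cr_2, Pi.sub_apply]; ring),
    T.sgn (i := 3) (j := 1) (k := 0) (l := 2) (by decide) (by decide) (by decide)
    (by decide) (by decide) (by simp only [tD, dt, cr_0, cr_1, cr_2, Pi.sub_apply]; ring),
    T.sgn (i := 1) (j := 2) (k := 0) (l := 3) (by decide) (by decide) (by decide)
    (by decide) (by decide) (by simp only [tD, dt, cr_0, cr_1, cr_2, Pi.sub_apply]),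
    T.sgn (i := 0) (j := 1) (k := 2) (l := 3) (by decide) (by decide) (by decide)
    (by decide) (by decide) (by simp only [tD, dt, cr_0, cr_1, cr_2, Pi.sub_apply]; ring),
    T.sgn (i := 0) (j := 2) (k := 3) (l := 1) (by decide) (by decide) (by decide)
    (by decide) (by decide) (by simp only [tD, dt, cr_0, cr_1, cr_2, Pi.sub_apply]; ring),
    T.sgn (i := 0) (j := 3) (k := 1) (l := 2) (by decide) (by decide) (by decide)
    (by decide) (by decide) (by simp only [tD, dt, cr_0, cr_1, cr_2, Pi.sub_apply]; ring)]
  rw [Mv_swap (X := V 3) (Y := V 1) (d 0 3 1 (by decide) (by decide)) (d 2 3 1 (by decide) (by decide)),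
    Mv_symm (V 0) (V 2) (T.prim 3) (T.prim 1)]
  ring

theorem thS_congr {R : Fin 3 → ℝ} (hR : Gen R) {n : Fin 4 → Fin 3 → ℤ} (hn : ∀ i, IsPrimitive (n i))
    (h : ∀ i, v i = n i ∨ v i = -n i) : thS R V v = thS R V n := by
  unfold thS
  simp only [Th_congr hR (hn _) (hn _) (h _) (h _)]

theorem tet_exists (hD : tD V ≠ 0) {n : Fin 4 → Fin 3 → ℤ} (hn : ∀ i, IsPrimitive (n i))
    (hc : ∀ i j k, i ≠ j → i ≠ k → dt (n i) (V j) = dt (n i) (V k)) :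
    ∃ v h c, Tet V v h c ∧ ∀ i, v i = n i ∨ v i = -n i := by
  have key : ∀ i, ∃ (vi : Fin 3 → ℤ) (hi : ℕ) (ci : ℤ), (IsPrimitive vi ∧ 0 < hi ∧
      ∀ j, dt vi (V j) = ci + if i = j then (hi : ℤ) else 0) ∧ (vi = n i ∨ vi = - n i) := by
    intro i
    obtain ⟨k, hk⟩ : ∃ k : Fin 4, i ≠ k := by
      fin_cases i
      exacts [⟨1, by decide⟩, ⟨0, by decide⟩, ⟨0, by decide⟩, ⟨0, by decide⟩]
    have hne : dt (n i) (V i) - dt (n i) (V k) ≠ 0 := by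
      intro h0
      have hall : ∀ j, dt (n i) (V j) = dt (n i) (V k) := by
        intro j
        by_cases hij : i = j
        · rw [← hij]; linarith
        · exact hc i j k hij hk
      have hcr := cramer_dual (V 1 - V 0) (V 2 - V 0) (V 3 - V 0) (n i)
      have z : ∀ j, dt (n i) (V j - V 0) = 0 := by
        intro j; rw [dt_sub, hall j, hall 0, sub_self]
      have z' : ∀ j, dt (V j - V 0) (n i) = 0 := fun j => by rw [dt_comm]; exact z j
      simp only [z, z', zero_smul, add_zero] at hcr
      rw [smul_eq_zero] at hcr
      rcases hcr with h1 | h1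
      · exact hD h1
      · exact prim_ne_zero (hn i) h1
    rcases lt_or_gt_of_ne hne with hlt | hgt
    · refine ⟨-n i, (dt (n i) (V k) - dt (n i) (V i)).toNat, - dt (n i) (V k),
        ⟨prim_neg (hn i), by omega, ?_⟩, Or.inr rfl⟩
      intro j
      rw [neg_dt]
      split_ifs with hij
      · subst hij; omega
      · rw [hc i j k hij hk]; omega
    · refine ⟨n i, (dt (n i) (V i) - dt (n i) (V k)).toNat, dt (n i) (V k),
        ⟨hn i, by omega, ?_⟩, Or.inl rfl⟩
      intro j
      split_ifs with hij
      · subst hij; omega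
      · rw [hc i j k hij hk]; omega
  choose v h c h1 h2 using key
  exact ⟨v, h, c, ⟨fun i => (h1 i).1, fun i => (h1 i).2.1, fun i j => (h1 i).2.2 j⟩, h2⟩

theorem Tet.finite (T : Tet V v h c) (R : Fin 3 → ℝ) (l : ℕ) : {x | tcond R v c l x}.Finite := by
  have hp : ∀ i, (0:ℝ) < (h i : ℝ) := fun i => by have := T.pos i; positivity
  have hge : ∀ x, tcond R v c l x → ∀ i, 0 ≤ dt (v i) x - c i * l := by
    intro x hx i
    rcases hx i with h1 | h1
    · exact h1.le
    · exact h1.1.ge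
  have hle : ∀ x, tcond R v c l x → ∀ i, dt (v i) x - c i * l ≤ h i * l := by
    intro x hx i
    have h0 := T.sum_zero (toR x)
    have h1 := T.sum_zero (toR (V 0))
    have h2 : ∑ j, (((dt (v j) x - c j * l : ℤ) : ℝ)) / h j = l := by
      have : ∀ j, (((dt (v j) x - c j * l : ℤ) : ℝ)) / h j = dt (toR (v j)) (toR x) / h j
          - l * (dt (toR (v j)) (toR (V 0)) / h j) + l * (if j = 0 then 1 else 0) := by
        intro j
        have := (hp j).ne'
        rw [dt_toR, dt_toR, T.eval]
        split_ifs <;> push_cast <;> field_simp <;> ring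
      rw [Finset.sum_congr rfl (fun j _ => this j), Finset.sum_add_distrib, Finset.sum_sub_distrib,
        h0, ← Finset.mul_sum, h1, ← Finset.mul_sum]
      simp
    have h3 : (((dt (v i) x - c i * l : ℤ) : ℝ)) / h i ≤ l := by
      rw [← h2]
      apply Finset.single_le_sum (f := fun j => (((dt (v j) x - c j * l : ℤ) : ℝ)) / h j) _
        (Finset.mem_univ i)
      intro j _
      have : (0:ℝ) ≤ ((dt (v j) x - c j * l : ℤ) : ℝ) := by exact_mod_cast hge x hx j
      have := hp j
      positivity
    rw [div_le_iff₀ (hp i)] at h3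
    have : (((dt (v i) x - c i * l : ℤ) : ℝ)) ≤ ((h i * l : ℤ) : ℝ) := by push_cast at h3 ⊢; linarith
    exact_mod_cast this
  apply Set.Finite.of_finite_image (f := fun x => (fun i => dt (v i) x : Fin 4 → ℤ))
  · apply Set.Finite.subset (Set.Finite.pi' (fun i => Set.finite_Icc (c i * l) (c i * l + h i * l)))
    rintro _ ⟨x, hx, rfl⟩ i
    exact ⟨by have := hge x hx i; simp; omega, by have := hle x hx i; simp; omega⟩
  · intro x _ y _ hxy
    rw [← sub_eq_zero]
    have z : ∀ i, dt (v i) (x - y) = 0 := by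
      intro i; rw [dt_sub]; have := congrFun hxy i; simp only at this; omega
    exact T.eq_zero (z 1) (z 2) (z 3)

end
end

section

/-- generic half-space condition -/
def hcond (R : Fin 3 → ℝ) (l : ℕ) (x n : Fin 3 → ℤ) (c : ℤ) : Prop :=
  0 < dt n x - c * l ∨ (dt n x - c * l = 0 ∧ 0 < dt (toR n) R - c)

theorem hcond_comb {R : Fin 3 → ℝ} {l : ℕ} {x n n' n'' : Fin 3 → ℤ} {c c' c'' A B C : ℤ}
    (hA : 0 < A) (hB : 0 < B) (hC : 0 < C) (hn : A • n = B • n' + C • n'')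
    (hc : A * c = B * c' + C * c'') (h1 : hcond R l x n' c') (h2 : hcond R l x n'' c'') :
    hcond R l x n c := by
  have e1 : A * (dt n x - c * l) = B * (dt n' x - c' * l) + C * (dt n'' x - c'' * l) := by
    have := congrArg (fun z => dt z x) hn
    simp only [add_dt, smul_dt] at this
    linear_combination this - (l : ℤ) * hc
  have e2 : (A : ℝ) * (dt (toR n) R - c) = B * (dt (toR n') R - c') + C * (dt (toR n'') R - c'') := by
    have := congrArg (fun z => dt (toR z) R) hn
    simp only [toR_add, toR_smul, add_dt, smul_dt] at this
    have hc' : (A : ℝ) * c = B * c' + C * c'' := by exact_mod_cast hc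
    linear_combination this - hc'
  unfold hcond at *
  have hA' : (0:ℝ) < A := by exact_mod_cast hA
  have hB' : (0:ℝ) < B := by exact_mod_cast hB
  have hC' : (0:ℝ) < C := by exact_mod_cast hC
  rcases h1 with h1 | ⟨h1, h1'⟩ <;> rcases h2 with h2 | ⟨h2, h2'⟩
  · left
    have : 0 < A * (dt n x - c * l) := by rw [e1]; positivity
    exact pos_of_mul_pos_right this hA.le
  · left
    rw [h2] at e1
    have : 0 < A * (dt n x - c * l) := by rw [e1]; nlinarith [mul_pos hB h1]
    exact pos_of_mul_pos_right this hA.le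
  · left
    rw [h1] at e1
    have : 0 < A * (dt n x - c * l) := by rw [e1]; nlinarith [mul_pos hC h2]
    exact pos_of_mul_pos_right this hA.le
  · right
    rw [h1, h2] at e1
    simp at e1
    refine ⟨e1.resolve_left (by omega), ?_⟩
    have : 0 < (A:ℝ) * (dt (toR n) R - c) := by rw [e2]; positivity
    exact pos_of_mul_pos_right this hA'.le

theorem hcond_neg {R : Fin 3 → ℝ} (hR : Gen R) {l : ℕ} {x n : Fin 3 → ℤ} {c : ℤ} (hn : n ≠ 0) :
    hcond R l x (-n) (-c) ↔ ¬ hcond R l x n c := by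
  have h0 : dt (toR n) R - c ≠ 0 := sub_ne_zero.2 (hR n hn c)
  have e1 : dt (-n) x - (-c) * l = -(dt n x - c * l) := by rw [neg_dt]; ring
  have e2 : dt (toR (-n)) R - ((-c : ℤ) : ℝ) = -(dt (toR n) R - c) := by
    rw [toR_neg, neg_dt]; push_cast; ring
  unfold hcond
  rw [e1, e2]
  generalize dt n x - c * l = a
  generalize dt (toR n) R - (c : ℝ) = b at *
  rcases lt_trichotomy a 0 with h | h | h
  · constructor
    · intro _ h3; omega
    · intro _; left; omega
  · subst h
    simp only [neg_zero, lt_irrefl, true_and, false_or, neg_pos, not_lt]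
    exact ⟨fun h => h.le, fun h => lt_of_le_of_ne h h0⟩
  · constructor
    · intro h3; omega
    · intro h3; exact absurd (Or.inl h) h3

theorem tcond_four {R : Fin 3 → ℝ} {v : Fin 4 → Fin 3 → ℤ} {c : Fin 4 → ℤ} {l : ℕ} {x : Fin 3 → ℤ} :
    tcond R v c l x ↔ hcond R l x (v 0) (c 0) ∧ hcond R l x (v 1) (c 1) ∧ hcond R l x (v 2) (c 2) ∧
      hcond R l x (v 3) (c 3) := by
  unfold tcond
  rw [Fin.forall_fin_succ, Fin.forall_fin_succ, Fin.forall_fin_succ, Fin.forall_fin_one]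
  rfl

theorem cubic_lin {A B C D : ℝ} (h : ∀ l : ℕ, 1 ≤ l → A * (l : ℝ) ^ 3 + B * (l : ℝ) ^ 2 + C * l + D = 0) :
    C = 0 := by
  have h1 := h 1 le_rfl
  have h2 := h 2 (by norm_num)
  have h3 := h 3 (by norm_num)
  have h4 := h 4 (by norm_num)
  push_cast at h1 h2 h3 h4
  linarith

theorem eq_of_three {a b c : Fin 3 → ℤ} (hD : dt (cr a b) c ≠ 0) {u w : Fin 3 → ℤ}
    (h1 : dt u a = dt w a) (h2 : dt u b = dt w b) (h3 : dt u c = dt w c) : u = w := by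
  have hc := cramer_dual a b c (u - w)
  have z1 : dt a (u - w) = 0 := by rw [dt_sub, dt_comm a u, dt_comm a w, h1, sub_self]
  have z2 : dt b (u - w) = 0 := by rw [dt_sub, dt_comm b u, dt_comm b w, h2, sub_self]
  have z3 : dt c (u - w) = 0 := by rw [dt_sub, dt_comm c u, dt_comm c w, h3, sub_self]
  rw [z1, z2, z3] at hc
  simp only [zero_smul, add_zero, smul_eq_zero] at hc
  exact sub_eq_zero.1 (hc.resolve_left hD)

theorem dt_prm_cr_l (a b : Fin 3 → ℤ) (h : cr a b ≠ 0) : dt (prm (cr a b)) a = 0 ∧ dt (prm (cr a b)) b = 0 := by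
  have h1 := dt_prm (cr a b) a
  have h2 := dt_prm (cr a b) b
  rw [cr_dt_left] at h1
  rw [cr_dt_right] at h2
  have hp := gcd3_pos h
  constructor
  · rcases mul_eq_zero.1 h1.symm with h | h
    · omega
    · exact h
  · rcases mul_eq_zero.1 h2.symm with h | h
    · omega
    · exact h

set_option maxHeartbeats 1000000 in
theorem cocycle_aux {R : Fin 3 → ℝ} (hR : Gen R) {X Y Z W M n1 n2 n3 : Fin 3 → ℤ}
    (hD : dt (cr (Y - X) (Z - X)) (W - X) ≠ 0) (hM : M - Z = W - M)
    (p1 : IsPrimitive n1) (p2 : IsPrimitive n2) (p3 : IsPrimitive n3)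
    (a1 : dt n1 X = dt n1 Y) (b1 : dt n1 X = dt n1 Z)
    (a2 : dt n2 X = dt n2 Y) (b2 : dt n2 X = dt n2 M)
    (a3 : dt n3 X = dt n3 Y) (b3 : dt n3 X = dt n3 W) :
    Th R X Y n2 n1 + Th R X Y n3 n2 - Th R X Y n3 n1 = 0 := by
  classical
  -- remaining normals
  have cp : cr (Z - X) (W - X) ≠ 0 := by
    intro h0; apply hD; rw [dt_cr_cycle, h0]; simp [dt]
  have cq : cr (Z - Y) (W - Y) ≠ 0 := by
    intro h0; apply hD
    have : dt (cr (Y - X) (Z - X)) (W - X) = dt (cr (Z - Y) (W - Y)) (Y - X) := by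
      simp only [dt, cr_0, cr_1, cr_2, Pi.sub_apply]; ring
    rw [this, h0]; simp [dt]
  obtain ⟨dp1, dp2⟩ := dt_prm_cr_l _ _ cp
  obtain ⟨dq1, dq2⟩ := dt_prm_cr_l _ _ cq
  have pp := prm_prim cp
  have pq := prm_prim cq
  set p := prm (cr (Z - X) (W - X))
  set q := prm (cr (Z - Y) (W - Y))
  rw [dt_sub] at dp1 dp2 dq1 dq2
  obtain ⟨v, h, c, T, hv⟩ := tet_exists (V := ![X, Y, Z, W]) (n := ![q, p, n3, n1]) hD (by
      intro i; fin_cases i <;> assumption) (by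
      intro i j k h1 h2
      fin_cases i <;> fin_cases j <;> first | (exact absurd rfl h1) | skip
      all_goals fin_cases k <;> first | (exact absurd rfl h2) | skip
      all_goals simp
      all_goals omega)
  have e := T.eval
  have e00 := e 0 0; have e01 := e 0 1; have e02 := e 0 2; have e03 := e 0 3
  have e10 := e 1 0; have e11 := e 1 1; have e12 := e 1 2; have e13 := e 1 3
  have e20 := e 2 0; have e21 := e 2 1; have e22 := e 2 2; have e23 := e 2 3
  have e30 := e 3 0; have e31 := e 3 1; have e32 := e 3 2; have e33 := e 3 3
  simp at e00 e01 e02 e03 e10 e11 e12 e13 e20 e21 e22 e23 e30 e31 e32 e33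
  have h0 := T.pos 0; have h1 := T.pos 1; have h2 := T.pos 2; have h3 := T.pos 3
  have mid : ∀ n, 2 * dt n M = dt n Z + dt n W := by
    intro n
    have := congrArg (dt n) hM
    rw [dt_sub, dt_sub] at this; omega
  -- choose sign of n2
  have hne : dt n2 Z - dt n2 X ≠ 0 := by
    intro h0
    have hz : n2 = 0 := by
      apply eq_of_three hD
      · rw [dt_sub]; simp [dt] at *; omega
      · rw [dt_sub]; simp [dt] at *; omega
      · have := mid n2; rw [dt_sub]; simp [dt] at *; omega
    exact prim_ne_zero p2 hz
  obtain ⟨m, pm, hm2, am, bm, hmp⟩ : ∃ m, IsPrimitive m ∧ (m = n2 ∨ m = -n2) ∧ dt m X = dt m Y ∧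
      dt m X = dt m M ∧ 0 < dt m Z - dt m X := by
    rcases lt_or_gt_of_ne hne with hlt | hgt
    · exact ⟨-n2, prim_neg p2, Or.inr rfl, by simp only [neg_dt]; omega, by simp only [neg_dt]; omega,
        by simp only [neg_dt]; omega⟩
    · exact ⟨n2, p2, Or.inl rfl, a2, b2, hgt⟩
  have mm := mid m; have m0 := mid (v 0); have m1 := mid (v 1); have m2 := mid (v 2)
  have m3 := mid (v 3)
  have T1 : Tet ![X, Y, Z, M] ![v 0, v 1, m, v 3]
      ![h 0, h 1, (dt m Z - dt m X).toNat, (dt (v 3) M - dt (v 3) X).toNat]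
      ![c 0, c 1, dt m X, c 3] := by
    refine ⟨?_, ?_, ?_⟩
    · intro i; fin_cases i
      exacts [T.prim 0, T.prim 1, pm, T.prim 3]
    · intro i; fin_cases i <;> simp <;> omega
    · intro i j
      fin_cases i <;> fin_cases j <;> simp <;> omega
  have T2 : Tet ![X, Y, M, W] ![v 0, v 1, v 2, -m]
      ![h 0, h 1, (dt (v 2) M - dt (v 2) X).toNat, (dt m Z - dt m X).toNat]
      ![c 0, c 1, c 2, -dt m X] := by
    refine ⟨?_, ?_, ?_⟩
    · intro i; fin_cases i
      exacts [T.prim 0, T.prim 1, T.prim 2, prim_neg pm]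
    · intro i; fin_cases i <;> simp <;> omega
    · intro i j
      fin_cases i <;> fin_cases j <;> simp [neg_dt] <;> omega
  -- relation
  set H := dt m Z - dt m X with hH
  have rel : (H * h 3) • v 2 = (h 2 * h 3 : ℤ) • m + (h 2 * H : ℤ) • v 3 := by
    apply eq_of_three hD
    · simp only [smul_dt, add_dt, dt_sub]
      rw [← am, e21, e20, e31, e30]; ring
    · simp only [smul_dt, add_dt, dt_sub]
      rw [e22, e20, e32, e30]; linear_combination (h 2 * h 3 : ℤ) * hH
    · simp only [smul_dt, add_dt, dt_sub]
      have : dt m W - dt m X = -H := by omega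
      rw [e23, e20, e33, e30]; linear_combination (-(h 2 * h 3 : ℤ)) * this
  have relc : (H * h 3) * c 2 = (h 2 * h 3 : ℤ) * dt m X + (h 2 * H : ℤ) * c 3 := by
    have := congrArg (fun z => dt z X) rel
    simp only [add_dt, smul_dt] at this
    rw [e20, e30] at this; exact this
  have hcount : ∀ l, NT R v c l = NT R ![v 0, v 1, m, v 3] ![c 0, c 1, dt m X, c 3] l
      + NT R ![v 0, v 1, v 2, -m] ![c 0, c 1, c 2, -dt m X] l := by
    intro l
    unfold NT
    rw [← Set.ncard_union_eq _ (T1.finite R l) (T2.finite R l)]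
    · congr 1
      ext x
      simp only [Set.mem_union, Set.mem_ofPred_eq, tcond_four]
      simp only [Matrix.cons_val_zero, Matrix.cons_val_one, Matrix.cons_val]
      rw [hcond_neg hR (prim_ne_zero pm)]
      constructor
      · rintro ⟨q0, q1, q2, q3⟩
        by_cases hc : hcond R l x m (dt m X)
        · exact Or.inl ⟨q0, q1, hc, q3⟩
        · exact Or.inr ⟨q0, q1, q2, hc⟩
      · rintro (⟨q0, q1, q2, q3⟩ | ⟨q0, q1, q2, q3⟩)
        · exact ⟨q0, q1, hcond_comb (by positivity) (by positivity) (by positivity) rel relc q2 q3, q3⟩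
        · refine ⟨q0, q1, q2, hcond_comb (A := h 2 * H) (B := H * h 3) (C := h 2 * h 3)
            (by positivity) (by positivity) (by positivity) ?_ ?_ q2
            ((hcond_neg hR (prim_ne_zero pm)).2 q3)⟩
          · rw [rel]; simp
          · rw [relc]; ring
    · rw [Set.disjoint_left]
      intro x hx1 hx2
      simp only [Set.mem_ofPred_eq, tcond_four] at hx1 hx2
      simp only [Matrix.cons_val_zero, Matrix.cons_val_one, Matrix.cons_val] at hx1 hx2
      exact ((hcond_neg hR (prim_ne_zero pm)).1 hx2.2.2.2) hx1.2.2.1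
  obtain ⟨A, B, hp⟩ := T.main R
  obtain ⟨A1, B1, hp1⟩ := T1.main R
  obtain ⟨A2, B2, hp2⟩ := T2.main R
  have hlin : tM R ![X, Y, Z, M] ![v 0, v 1, m, v 3] + tM R ![X, Y, M, W] ![v 0, v 1, v 2, -m]
      - tM R ![X, Y, Z, W] v = 0 := by
    apply cubic_lin (A := A1 + A2 - A) (B := B1 + B2 - B)
      (D := (if ∀ i, 0 < dt (toR (![v 0, v 1, m, v 3] i)) R - (![c 0, c 1, dt m X, c 3] i : ℤ) then 1 else 0)
        + (if ∀ i, 0 < dt (toR (![v 0, v 1, v 2, -m] i)) R - (![c 0, c 1, c 2, -dt m X] i : ℤ) then 1 else 0)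
        - (if ∀ i, 0 < dt (toR (v i)) R - c i then 1 else 0))
    intro l hl
    have k := hcount l
    have k' : (NT R v c l : ℝ) = NT R ![v 0, v 1, m, v 3] ![c 0, c 1, dt m X, c 3] l
      + NT R ![v 0, v 1, v 2, -m] ![c 0, c 1, c 2, -dt m X] l := by exact_mod_cast k
    rw [hp l hl, hp1 l hl, hp2 l hl] at k'
    linear_combination -k'
  have s1 : Int.sign (tD ![X, Y, Z, M]) = Int.sign (tD ![X, Y, Z, W]) := by
    apply sign_eq_of_mul_pos
    have : 2 * tD ![X, Y, Z, M] = tD ![X, Y, Z, W] := by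
      have := mid (cr (Y - X) (Z - X))
      have z : dt (cr (Y - X) (Z - X)) Z = dt (cr (Y - X) (Z - X)) X := by
        rw [← sub_eq_zero, ← dt_sub, cr_dt_right]
      simp only [tD, Matrix.cons_val_zero, Matrix.cons_val_one, Matrix.cons_val]
      rw [dt_sub, dt_sub]; omega
    have h5 := mul_self_pos.2 T1.tD_ne
    rw [← this]; linarith
  have s2 : Int.sign (tD ![X, Y, M, W]) = Int.sign (tD ![X, Y, Z, W]) := by
    apply sign_eq_of_mul_pos
    have : 2 * tD ![X, Y, M, W] = tD ![X, Y, Z, W] := by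
      have := mid (cr (W - X) (Y - X))
      have z : dt (cr (W - X) (Y - X)) W = dt (cr (W - X) (Y - X)) X := by
        rw [← sub_eq_zero, ← dt_sub, cr_dt_left]
      simp only [tD, Matrix.cons_val_zero, Matrix.cons_val_one, Matrix.cons_val]
      rw [← dt_cr_cycle (W - X) (Y - X), ← dt_cr_cycle (W - X) (Y - X), dt_sub, dt_sub]; omega
    have h5 := mul_self_pos.2 T2.tD_ne
    rw [← this]; linarith
  have t0 := T.theta R
  have t1 := T1.theta R
  have t2 := T2.theta R
  rw [s1] at t1
  rw [s2] at t2
  have tt : thS R ![X, Y, Z, M] ![v 0, v 1, m, v 3] + thS R ![X, Y, M, W] ![v 0, v 1, v 2, -m]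
      - thS R ![X, Y, Z, W] v = 0 := by
    rw [← t0, ← t1, ← t2, ← mul_add, ← mul_sub, hlin, mul_zero]
  simp only [thS, Matrix.cons_val_zero, Matrix.cons_val_one, Matrix.cons_val] at tt
  have hmid : Th R Z M (v 0) (v 1) + Th R M W (v 0) (v 1) = Th R Z W (v 0) (v 1) := by
    have z1 : W - Z = (2 : ℤ) • (M - Z) := by
      have : W - Z = (M - Z) + (W - M) := by abel
      rw [this, ← hM]; funext i; simp; ring
    have g2 := gcd3_smul 2 (M - Z)
    have g2' : (gcd3 ((2:ℤ) • (M - Z)) : ℝ) = 2 * gcd3 (M - Z) := by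
      rw [show |(2:ℤ)| = 2 by rfl] at g2; exact_mod_cast g2
    have r1 : dt (toR (v 0)) (R - toR M) = dt (toR (v 0)) (R - toR Z) := by
      rw [dt_sub, dt_sub, dt_toR, dt_toR]; congr 2; omega
    have r2 : dt (toR (v 1)) (R - toR M) = dt (toR (v 1)) (R - toR Z) := by
      rw [dt_sub, dt_sub, dt_toR, dt_toR]; congr 2; omega
    unfold Th Mv
    rw [r1, r2, z1, ← hM, g2', dt_smul]
    have : Int.sign (2 * dt (cr (v 0) (v 1)) (M - Z)) = Int.sign (dt (cr (v 0) (v 1)) (M - Z)) := by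
      rw [Int.sign_mul, show Int.sign 2 = 1 from rfl, one_mul]
    rw [this]; ring
  have q1 := Th_neg_right (X := X) (Y := Y) hR (T.prim 2) pm
  have q2 := Th_neg_left (X := X) (Y := M) hR pm (T.prim 1)
  have q3 := Th_neg_right (X := Y) (Y := M) hR (T.prim 0) pm
  have q4 := Th_anti (R := R) (X := X) (Y := M) (T.prim 1) pm
  have q5 := Th_swap (R := R) (X := Y) (Y := M) (n := v 0) (m := m) (by omega) (by omega)
  have f1 := Th_congr (X := X) (Y := Y) hR p2 p1 hm2 (hv 3)
  have f2 := Th_congr (X := X) (Y := Y) hR p3 p2 (hv 2) hm2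
  have f3 := Th_congr (X := X) (Y := Y) hR p3 p1 (hv 2) (hv 3)
  rw [← f1, ← f2, ← f3]
  linear_combination tt - hmid - q1 - q2 - q3 - q4 - q5


theorem cr_cr_same (a b e : Fin 3 → ℤ) : cr (cr a e) (cr b e) = dt (cr a b) e • e := by
  apply vec_ext <;> simp only [Pi.smul_apply, smul_eq_mul, dt, cr_0, cr_1, cr_2] <;> ring

theorem perp_coplanar {e n1 n2 n3 : Fin 3 → ℤ} (he : e ≠ 0) (h1 : dt n1 e = 0) (h2 : dt n2 e = 0)
    (h3 : dt n3 e = 0) :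
    dt (cr n2 n3) e • n1 + dt (cr n3 n1) e • n2 + dt (cr n1 n2) e • n3 = 0 := by
  have hd := cramer_dual n1 n2 n3 e
  rw [h1, h2, h3] at hd
  simp only [zero_smul, add_zero, smul_eq_zero] at hd
  rw [← cramer, hd.resolve_right he, zero_smul]

theorem cr_ne_dt {e n1 n2 : Fin 3 → ℤ} (he : e ≠ 0) (h1 : dt n1 e = 0) (h2 : dt n2 e = 0)
    (hc : cr n1 n2 ≠ 0) : dt (cr n1 n2) e ≠ 0 := by
  intro h0
  apply hc
  have z1 : cr e (cr n1 n2) = 0 := by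
    rw [cr_cr, dt_comm e, dt_comm e, h1, h2]; simp
  have z2 := cr_cr e e (cr n1 n2)
  rw [z1, dt_comm e (cr n1 n2), h0] at z2
  have z3 : cr e (0 : Fin 3 → ℤ) = 0 := by apply vec_ext <;> simp
  rw [z3, zero_smul, zero_sub, zero_eq_neg, smul_eq_zero] at z2
  exact z2.resolve_left (dt_self_pos_int he).ne'

theorem cocycle {R : Fin 3 → ℝ} (hR : Gen R) {X Y n1 n2 n3 : Fin 3 → ℤ} (hXY : X ≠ Y)
    (p1 : IsPrimitive n1) (p2 : IsPrimitive n2) (p3 : IsPrimitive n3)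
    (a1 : dt n1 X = dt n1 Y) (a2 : dt n2 X = dt n2 Y) (a3 : dt n3 X = dt n3 Y) :
    Th R X Y n1 n2 + Th R X Y n2 n3 + Th R X Y n3 n1 = 0 := by
  by_cases c12 : cr n1 n2 = 0
  · rw [Th_parallel c12, Th_congr hR p1 p3 (prim_eq_or_neg p1 p2 c12) (Or.inl rfl), Th_anti p1 p3]
    ring
  by_cases c23 : cr n2 n3 = 0
  · rw [Th_parallel c23, Th_congr hR p2 p1 (prim_eq_or_neg p2 p3 c23) (Or.inl rfl), Th_anti p1 p2]
    ring
  by_cases c31 : cr n3 n1 = 0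
  · rw [Th_parallel c31, Th_congr hR p3 p2 (prim_eq_or_neg p3 p1 c31) (Or.inl rfl), Th_anti p3 p2]
    ring
  have he : Y - X ≠ 0 := sub_ne_zero.2 hXY.symm
  have d1 : dt n1 (Y - X) = 0 := by rw [dt_sub, a1, sub_self]
  have d2 : dt n2 (Y - X) = 0 := by rw [dt_sub, a2, sub_self]
  have d3 : dt n3 (Y - X) = 0 := by rw [dt_sub, a3, sub_self]
  have rel := perp_coplanar he d1 d2 d3
  have k1 := cr_ne_dt he d2 d3 c23
  have k2 := cr_ne_dt he d3 d1 c31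
  have k3 := cr_ne_dt he d1 d2 c12
  set e := Y - X with hedef
  set α := dt (cr n2 n3) e
  set β := dt (cr n3 n1) e with hβ
  set γ := dt (cr n1 n2) e
  have rel2 : α • cr n1 e + γ • cr n3 e = -(β • cr n2 e) := by
    have := congrArg (fun z => cr z e) rel
    have z : cr (0 : Fin 3 → ℤ) e = 0 := by apply vec_ext <;> simp
    simp only [z] at this
    rw [← cr_smul_left, ← cr_smul_left, ← cr_smul_left]
    have lin : ∀ a b c : Fin 3 → ℤ, cr (a + b + c) e = cr a e + cr b e + cr c e := by
      intro a b c; apply vec_ext <;> simp <;> ring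
    rw [lin] at this
    rw [eq_neg_iff_add_eq_zero, ← this]; abel
  have := cocycle_aux hR (X := X) (Y := Y) (Z := X + (2 * α) • cr n1 e) (W := X + (2 * γ) • cr n3 e)
    (M := X - β • cr n2 e) (n1 := n1) (n2 := n2) (n3 := n3) (by
      rw [add_sub_cancel_left, add_sub_cancel_left, ← hedef, cr_smul_right, smul_dt, dt_smul,
        dt_cr_cycle, cr_cr_same, smul_dt, dt_cr_swap n3 n1, ← hβ]
      have := (dt_self_pos_int he).ne'
      simp; tauto) (by
      rw [sub_eq_add_neg X, ← rel2]
      module) p1 p2 p3 a1 (by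
      rw [dt_add, dt_smul, dt_cr_left]; ring) a2 (by
      rw [dt_sub, dt_smul, dt_cr_left]; ring) a3 (by
      rw [dt_add, dt_smul, dt_cr_left]; ring)
  have q1 := Th_anti (R := R) (X := X) (Y := Y) p1 p2
  have q2 := Th_anti (R := R) (X := X) (Y := Y) p2 p3
  linear_combination -this + q1 + q2

end

section

abbrev V3 := Fin 3 → ℝ
abbrev Z3 := Fin 3 → ℤ

def dtL (u : V3) : V3 →ₗ[ℝ] ℝ where
  toFun := fun x => dt u x
  map_add' := fun x y => dt_add _ _ _
  map_smul' := fun t x => by simp [dt_smul]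

@[simp] theorem dtL_apply (u x : V3) : dtL u x = dt u x := rfl

theorem dt_continuous (u : V3) : Continuous fun x : V3 => dt u x := by
  unfold dt; fun_prop

theorem eq_zero_of_dt {u : V3} (h : ∀ x, dt u x = 0) : u = 0 := by
  by_contra hu
  exact (dt_self_pos hu).ne' (h u)

theorem toR_ne {v : Z3} (h : v ≠ 0) : toR v ≠ 0 := by
  intro h0; apply h; apply toR_inj; rw [h0]; funext i; simp [toR]

theorem finrank_ker_dtL {u : V3} (hu : u ≠ 0) : Module.finrank ℝ (LinearMap.ker (dtL u)) = 2 := by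
  have h1 := LinearMap.finrank_range_add_finrank_ker (dtL u)
  have h2 : LinearMap.range (dtL u) = ⊤ := by
    rw [LinearMap.range_eq_top]
    intro y
    refine ⟨(y / dt u u) • u, ?_⟩
    have := (dt_self_pos hu).ne'
    simp [dt_smul]
    field_simp
  rw [h2] at h1
  simp at h1
  omega

theorem vectorSpan_le_ker {S : Set V3} {u : V3} (h : ∀ x ∈ S, ∀ y ∈ S, dt u x = dt u y) :
    vectorSpan ℝ S ≤ LinearMap.ker (dtL u) := by
  rw [vectorSpan_def, Submodule.span_le]
  rintro _ ⟨x, hx, y, hy, rfl⟩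
  simp [dt_sub, h x hx y hy]

theorem not_const {P : Set V3} (hfull : affineSpan ℝ P = ⊤) {u : V3} (hu : u ≠ 0) :
    ¬ ∀ x ∈ P, ∀ y ∈ P, dt u x = dt u y := by
  intro h
  have h1 := vectorSpan_le_ker h
  rw [← direction_affineSpan, hfull, AffineSubspace.direction_top] at h1
  exact hu (eq_zero_of_dt fun x => by simpa using h1 (Submodule.mem_top (x := x)))

/-- maximizing face -/
def mface (P : Set V3) (w : V3) : Set V3 := {x ∈ P | ∀ y ∈ P, dt w y ≤ dt w x}

theorem isFaceOf_iff {P F : Set V3} : IsFaceOf P F ↔ F.Nonempty ∧ ∃ w, F = mface P w := by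
  unfold IsFaceOf mface
  simp only [inner3_eq]

theorem normal_of_face {P : Set V3} (hfull : affineSpan ℝ P = ⊤) {w : V3}
    (hne : (mface P w).Nonempty)
    (hdim : Module.finrank ℝ (vectorSpan ℝ (mface P w)) = 2) {v : Z3}
    (hv : IsInwardNormal P (mface P w) v) : ∃ t : ℝ, t < 0 ∧ w = t • toR v := by
  have hv0 : toR v ≠ 0 := toR_ne (prim_ne_zero hv.1)
  have h1 : ∀ u ∈ mface P w, ∀ u' ∈ P, dt (toR v) u ≤ dt (toR v) u' := by
    intro u hu u' hu'
    have := hv.2 u hu u' hu'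
    rw [inner3_eq, dt_sub] at this; linarith
  have hvS : vectorSpan ℝ (mface P w) ≤ LinearMap.ker (dtL (toR v)) :=
    vectorSpan_le_ker fun x hx y hy => le_antisymm (h1 x hx y hy.1) (h1 y hy x hx.1)
  have hwS : vectorSpan ℝ (mface P w) ≤ LinearMap.ker (dtL w) :=
    vectorSpan_le_ker fun x hx y hy => le_antisymm (hy.2 x hx.1) (hx.2 y hy.1)
  have heq : vectorSpan ℝ (mface P w) = LinearMap.ker (dtL (toR v)) :=
    Submodule.eq_of_le_of_finrank_eq hvS (by rw [hdim, finrank_ker_dtL hv0])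
  rw [heq] at hwS
  have hz : cr w (toR v) = 0 := by
    apply eq_zero_of_dt
    intro x
    rw [dt_cr_cycle, dt_comm]
    have : cr (toR v) x ∈ LinearMap.ker (dtL (toR v)) := by simp [dt_cr_left]
    simpa using hwS this
  have hpos := dt_self_pos hv0
  have hw : w = (dt (toR v) w / dt (toR v) (toR v)) • toR v := by
    have := cr_cr (toR v) w (toR v)
    rw [hz] at this
    have z : cr (toR v) (0 : V3) = 0 := by apply vec_ext <;> simp
    rw [z, eq_comm, sub_eq_zero] at this
    rw [div_eq_inv_mul, mul_smul, ← this, smul_smul, inv_mul_cancel₀ hpos.ne', one_smul]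
  refine ⟨_, ?_, hw⟩
  set t := dt (toR v) w / dt (toR v) (toR v)
  by_contra hneg
  push Not at hneg
  obtain ⟨x0, hx0⟩ := hne
  have hc : ∀ y ∈ P, dt (toR v) y = dt (toR v) x0 := by
    rcases hneg.eq_or_lt with h0 | hp
    · intro y hy
      have hy' : y ∈ mface P w := by
        refine ⟨hy, ?_⟩
        intro y' _
        rw [hw, smul_dt, smul_dt, ← h0, zero_mul, zero_mul]
      exact le_antisymm (h1 y hy' x0 hx0.1) (h1 x0 hx0 y hy)
    · intro y hy
      have := hx0.2 y hy
      rw [hw, smul_dt, smul_dt] at this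
      exact le_antisymm (le_of_mul_le_mul_left this hp) (h1 x0 hx0 y hy)
  exact not_const hfull hv0 fun x hx y hy => by rw [hc x hx, hc y hy]

theorem facet_desc {P F : Set V3} (hfull : affineSpan ℝ P = ⊤) (hF : IsFacetOf P F) {v : Z3}
    (hv : IsInwardNormal P F v) {X : Z3} (hX : toR X ∈ F) :
    (∀ x ∈ P, ((dt v X : ℤ) : ℝ) ≤ dt (toR v) x) ∧ F = {x ∈ P | dt (toR v) x = ((dt v X : ℤ) : ℝ)} := by
  obtain ⟨hf, hdim⟩ := hF
  obtain ⟨hne, w, rfl⟩ := isFaceOf_iff.1 hf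
  obtain ⟨t, ht, hw⟩ := normal_of_face hfull hne hdim hv
  have h1 : ∀ u ∈ mface P w, ∀ u' ∈ P, dt (toR v) u ≤ dt (toR v) u' := by
    intro u hu u' hu'
    have := hv.2 u hu u' hu'
    rw [inner3_eq, dt_sub] at this; linarith
  have h2 : ∀ x ∈ P, ((dt v X : ℤ) : ℝ) ≤ dt (toR v) x := by
    intro x hx; rw [← dt_toR]; exact h1 _ hX x hx
  refine ⟨h2, ?_⟩
  ext x
  constructor
  · intro hx
    refine ⟨hx.1, le_antisymm ?_ (h2 x hx.1)⟩
    rw [← dt_toR]; exact h1 x hx _ hX.1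
  · rintro ⟨hx, hxe⟩
    refine ⟨hx, fun y hy => ?_⟩
    rw [hw, smul_dt, smul_dt, hxe]
    exact mul_le_mul_of_nonpos_left (h2 y hy) ht.le

theorem exists_perp (a b : Z3) : ∃ n : Z3, n ≠ 0 ∧ dt n a = 0 ∧ dt n b = 0 := by
  have one : ∀ a : Z3, ∃ n : Z3, n ≠ 0 ∧ dt n a = 0 := by
    intro a
    by_cases h : a 0 = 0 ∧ a 1 = 0
    · refine ⟨![1, 0, 0], ?_, ?_⟩
      · intro h0; have := congrFun h0 0; simp at this
      · simp [dt, h.1]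
    · refine ⟨![a 1, - a 0, 0], ?_, ?_⟩
      · intro h0
        have h1 := congrFun h0 0; have h2 := congrFun h0 1
        simp at h1 h2
        exact h ⟨h2, h1⟩
      · simp [dt]; ring
  by_cases h : cr a b = 0
  · by_cases ha : a = 0
    · obtain ⟨n, h1, h2⟩ := one b
      exact ⟨n, h1, by rw [ha]; simp [dt], h2⟩
    · obtain ⟨n, h1, h2⟩ := one a
      refine ⟨n, h1, h2, ?_⟩
      have := cr_cr a a b
      have z : cr a (0 : Z3) = 0 := by apply vec_ext <;> simp
      rw [h, z, eq_comm, sub_eq_zero] at this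
      have h3 := congrArg (dt n) this
      rw [dt_smul, dt_smul, h2, mul_zero, eq_comm, mul_eq_zero] at h3
      exact h3.resolve_left (dt_self_pos_int ha).ne'
  · exact ⟨cr a b, h, cr_dt_left _ _, cr_dt_right _ _⟩

/-- If every point of `S` satisfies a linear bound and hull point attains it then a statement about
functional holds. -/
theorem mface_hull {Vs : Finset Z3} {P : Set V3} (hP : P = convexHull ℝ (toR '' (Vs : Set Z3)))
    {w : V3} {x : V3} (hx : x ∈ mface P w) :
    x ∈ convexHull ℝ (toR '' {A : Z3 | A ∈ Vs ∧ toR A ∈ mface P w}) := by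
  have hxP := hx.1
  rw [hP, _root_.convexHull_eq] at hxP
  obtain ⟨ι, t, c, z, hc0, hc1, hz, rfl⟩ := hxP
  have hzP : ∀ i ∈ t, z i ∈ P := fun i hi => by rw [hP]; exact subset_convexHull _ _ (hz i hi)
  have key : ∀ i ∈ t, c i ≠ 0 → z i ∈ mface P w := by
    intro i hi hci
    by_contra hnot
    have hlt : dt w (z i) < dt w (t.centerMass c z) := by
      by_contra hge
      push Not at hge
      exact hnot ⟨hzP i hi, fun y hy => (hx.2 y hy).trans hge⟩
    have hcm : dt w (t.centerMass c z) = ∑ i ∈ t, c i * dt w (z i) := by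
      rw [Finset.centerMass_eq_of_sum_1 _ _ hc1, ← dtL_apply, map_sum]
      simp [dt_smul]
    have : ∑ i ∈ t, c i * dt w (z i) < ∑ i ∈ t, c i * dt w (t.centerMass c z) := by
      apply Finset.sum_lt_sum
      · intro j hj; exact mul_le_mul_of_nonneg_left (hx.2 _ (hzP j hj)) (hc0 j hj)
      · exact ⟨i, hi, mul_lt_mul_of_pos_left hlt (lt_of_le_of_ne (hc0 i hi) (Ne.symm hci))⟩
    rw [← hcm, ← Finset.sum_mul, hc1, one_mul] at this
    exact lt_irrefl _ this
  classical
  have : t.centerMass c z = (t.filter fun i => c i ≠ 0).centerMass c z := by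
    rw [Finset.centerMass_filter_ne_zero]
  rw [this]
  apply Finset.centerMass_mem_convexHull
  · intro i hi; exact hc0 i (Finset.mem_filter.1 hi).1
  · rw [Finset.sum_filter_ne_zero, hc1]; norm_num
  · intro i hi
    obtain ⟨hi, hci⟩ := Finset.mem_filter.1 hi
    obtain ⟨A, hA, hAz⟩ := hz i hi
    refine ⟨A, ⟨hA, ?_⟩, hAz⟩
    rw [hAz]; exact key i hi hci

theorem face_facet {Vs : Finset Z3} {P : Set V3} (hP : P = convexHull ℝ (toR '' (Vs : Set Z3)))
    {w : V3} (hw : w ≠ 0) (hne : (mface P w).Nonempty) (O : Z3) :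
    IsFacetOf P (mface P w) ∨ ∃ n : Z3, n ≠ 0 ∧ ∀ x ∈ mface P w, dt (toR n) (x - toR O) = 0 := by
  set S : Set Z3 := {A : Z3 | A ∈ Vs ∧ toR A ∈ mface P w} with hS
  -- sufficient criterion
  have suff : ∀ n : Z3, (∀ C ∈ S, dt n (C - O) = 0) → ∀ x ∈ mface P w, dt (toR n) (x - toR O) = 0 := by
    intro n hn x hx
    have h1 := mface_hull hP hx
    have hconv : Convex ℝ {x : V3 | dt (toR n) (x - toR O) = 0} := by
      intro a ha b hb s t hs ht hst
      simp only [Set.mem_ofPred_eq, dt_sub, dt_add, dt_smul] at *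
      have : s * dt (toR n) a + t * dt (toR n) b - dt (toR n) (toR O)
        = s * (dt (toR n) a - dt (toR n) (toR O)) + t * (dt (toR n) b - dt (toR n) (toR O)) := by
        linear_combination (- dt (toR n) (toR O)) * (1 - hst) + dt (toR n) (toR O) * (1 - hst)
          - (hst) * dt (toR n) (toR O) * (-1)
      rw [this, ha, hb]; ring
    refine convexHull_min ?_ hconv h1
    rintro _ ⟨C, hC, rfl⟩
    simp only [Set.mem_ofPred_eq]
    rw [← toR_sub, dt_toR, hn C hC]; simp
  by_cases hthree : ∃ A ∈ S, ∃ B ∈ S, ∃ C ∈ S, cr (B - A) (C - A) ≠ 0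
  · left
    obtain ⟨A, hA, B, hB, C, hC, hcr⟩ := hthree
    refine ⟨isFaceOf_iff.2 ⟨hne, w, rfl⟩, ?_⟩
    have hle : vectorSpan ℝ (mface P w) ≤ LinearMap.ker (dtL w) :=
      vectorSpan_le_ker fun x hx y hy => le_antisymm (hy.2 x hx.1) (hx.2 y hy.1)
    have h2 := Submodule.finrank_mono hle
    rw [finrank_ker_dtL hw] at h2
    unfold faceDim
    refine le_antisymm h2 ?_
    have hli : LinearIndependent ℝ ![toR (B - A), toR (C - A)] := by
      rw [LinearIndependent.pair_iff]
      intro s t hst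
      have h1 := congrArg (fun z => cr z (toR (C - A))) hst
      have h2 := congrArg (fun z => cr (toR (B - A)) z) hst
      beta_reduce at h1 h2
      have e1 : cr (s • toR (B - A) + t • toR (C - A)) (toR (C - A)) = s • toR (cr (B - A) (C - A)) := by
        rw [toR_cr]; apply vec_ext <;> simp <;> ring
      have e2 : cr (toR (B - A)) (s • toR (B - A) + t • toR (C - A)) = t • toR (cr (B - A) (C - A)) := by
        rw [toR_cr]; apply vec_ext <;> simp <;> ring
      have z1 : cr (0 : V3) (toR (C - A)) = 0 := by apply vec_ext <;> simp
      have z2 : cr (toR (B - A)) (0 : V3) = 0 := by apply vec_ext <;> simp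
      rw [e1, z1, smul_eq_zero] at h1
      rw [e2, z2, smul_eq_zero] at h2
      exact ⟨h1.resolve_right (toR_ne hcr), h2.resolve_right (toR_ne hcr)⟩
    have h3 : 2 = Module.finrank ℝ (Submodule.span ℝ (Set.range ![toR (B - A), toR (C - A)])) := by
      simpa using (finrank_span_eq_card hli).symm
    rw [h3]
    apply Submodule.finrank_mono
    rw [Submodule.span_le]
    rintro _ ⟨i, rfl⟩
    fin_cases i
    · simp only [toR_sub]; exact vsub_mem_vectorSpan ℝ hB.2 hA.2
    · simp only [toR_sub]; exact vsub_mem_vectorSpan ℝ hC.2 hA.2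
  · right
    push Not at hthree
    have hSne : S.Nonempty := by
      obtain ⟨x, hx⟩ := hne
      have := mface_hull hP hx
      by_contra hc
      rw [Set.not_nonempty_iff_eq_empty] at hc
      rw [← hS, hc] at this
      simp at this
    obtain ⟨A, hA⟩ := hSne
    by_cases hall : ∀ B ∈ S, B = A
    · obtain ⟨n, hn, h1, _⟩ := exists_perp (A - O) 0
      refine ⟨n, hn, suff n fun C hC => ?_⟩
      rw [hall C hC]; exact h1
    · push Not at hall
      obtain ⟨B, hB, hBA⟩ := hall
      obtain ⟨n, hn, h1, h2⟩ := exists_perp (A - O) (B - A)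
      refine ⟨n, hn, suff n fun C hC => ?_⟩
      have hc := hthree A hA B hB C hC
      have := cr_cr (B - A) (B - A) (C - A)
      have z : cr (B - A) (0 : Z3) = 0 := by apply vec_ext <;> simp
      rw [hc, z, eq_comm, sub_eq_zero] at this
      have h3 := congrArg (dt n) this
      rw [dt_smul, dt_smul, h2, mul_zero, eq_comm, mul_eq_zero] at h3
      have h4 := h3.resolve_left (dt_self_pos_int (sub_ne_zero.2 hBA)).ne'
      rw [show C - O = (C - A) + (A - O) by abel, dt_add, h4, h1]; rfl

end

section

/-- geometric data of a lattice polytope together with its facets -/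
structure PD (P : Set V3) (n : ℕ) (Fc : Fin n → Set V3) (vn : Fin n → Z3) (c : Fin n → ℤ) : Prop where
  hull : ∃ Vs : Finset Z3, P = convexHull ℝ (toR '' (Vs : Set Z3))
  full : affineSpan ℝ P = ⊤
  prim : ∀ k, IsPrimitive (vn k)
  ge : ∀ k, ∀ x ∈ P, (c k : ℝ) ≤ dt (toR (vn k)) x
  desc : ∀ k, Fc k = {x ∈ P | dt (toR (vn k)) x = c k}
  all : ∀ w, IsFacetOf P (mface P w) → ∃ k, mface P w = Fc k ∧ ∃ t : ℝ, t < 0 ∧ w = t • toR (vn k)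
  inj : Function.Injective Fc
  ne : ∀ k, (Fc k).Nonempty

variable {P : Set V3} {n : ℕ} {Fc : Fin n → Set V3} {vn : Fin n → Z3} {c : Fin n → ℤ}

theorem PD.conv (G : PD P n Fc vn c) : Convex ℝ P := by
  obtain ⟨Vs, h⟩ := G.hull
  rw [h]; exact convex_convexHull _ _

theorem PD.compact (G : PD P n Fc vn c) : IsCompact P := by
  obtain ⟨Vs, h⟩ := G.hull
  rw [h]; exact ((Vs.finite_toSet).image toR).isCompact_convexHull (𝕜 := ℝ)

theorem PD.int_ne (G : PD P n Fc vn c) : (interior P).Nonempty :=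
  G.conv.interior_nonempty_iff_affineSpan_eq_top.2 G.full

theorem PD.clos (G : PD P n Fc vn c) : P ⊆ closure (interior P) := by
  rw [G.conv.closure_interior_eq_closure_of_nonempty_interior G.int_ne]
  exact subset_closure

theorem PD.vne (G : PD P n Fc vn c) (k) : toR (vn k) ≠ 0 := toR_ne (prim_ne_zero (G.prim k))

theorem PD.int_pos (G : PD P n Fc vn c) {x : V3} (hx : x ∈ interior P) (k) :
    (c k : ℝ) < dt (toR (vn k)) x := by
  refine lt_of_le_of_ne (G.ge k x (interior_subset hx)) ?_
  intro he
  have hp := dt_self_pos (G.vne k)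
  have hcont : Continuous fun t : ℝ => x - t • toR (vn k) := by fun_prop
  have hopen : IsOpen {t : ℝ | x - t • toR (vn k) ∈ interior P} := isOpen_interior.preimage hcont
  have h0 : (0 : ℝ) ∈ {t : ℝ | x - t • toR (vn k) ∈ interior P} := by simpa using hx
  obtain ⟨ε, hε, hb⟩ := Metric.isOpen_iff.1 hopen 0 h0
  have h1 : x - (ε / 2) • toR (vn k) ∈ interior P := hb (by
    simp [abs_of_pos hε]; exact hε)
  have h2 := G.ge k _ (interior_subset h1)
  rw [dt_sub, dt_smul, ← he] at h2
  nlinarith [mul_pos (half_pos hε) hp]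

theorem PD.vinj (G : PD P n Fc vn c) {k k' : Fin n} (h : vn k = vn k') : k = k' := by
  apply G.inj
  obtain ⟨x, hx⟩ := G.ne k
  obtain ⟨y, hy⟩ := G.ne k'
  rw [G.desc] at hx hy
  have h1 := G.ge k y hy.1
  have h2 := G.ge k' x hx.1
  rw [G.desc, G.desc]
  have : (c k : ℝ) = c k' := by
    have h3 := hx.2; have h4 := hy.2
    rw [← h] at h2 h4
    linarith
  rw [h, this]

theorem PD.not_neg (G : PD P n Fc vn c) {k k' : Fin n} (h : vn k' = - vn k) {x : V3} (hx : x ∈ Fc k)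
    (hx' : x ∈ Fc k') : False := by
  rw [G.desc] at hx hx'
  obtain ⟨y, hy⟩ := G.int_ne
  have h1 := G.int_pos hy k
  have h2 := G.int_pos hy k'
  have h3 := hx.2; have h4 := hx'.2
  rw [h, toR_neg, neg_dt] at h2 h4
  linarith

theorem PD.uniq (G : PD P n Fc vn c) {O : Z3} {k k' : Fin n} {x : V3}
    (hgen : ∀ m : Z3, m ≠ 0 → dt (toR m) (x - toR O) ≠ 0) (hx : x ∈ Fc k) (hx' : x ∈ Fc k')
    (hO' : dt (vn k') O ≠ c k') : k = k' := by
  have e1 := hx; have e2 := hx'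
  rw [G.desc] at e1 e2
  have h1 : (dt (vn k') O - c k') • vn k - (dt (vn k) O - c k) • vn k' = 0 := by
    by_contra hm
    apply hgen _ hm
    rw [toR_sub, sub_dt, toR_smul, toR_smul, smul_dt, smul_dt, dt_sub, dt_sub, e1.2, e2.2, dt_toR, dt_toR]
    push_cast; ring
  have h2 : cr (vn k) (vn k') = 0 := by
    have := congrArg (fun z => cr z (vn k')) h1
    beta_reduce at this
    have e : cr ((dt (vn k') O - c k') • vn k - (dt (vn k) O - c k) • vn k') (vn k')
      = (dt (vn k') O - c k') • cr (vn k) (vn k') := by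
      apply vec_ext <;> simp <;> ring
    have z : cr (0 : Z3) (vn k') = 0 := by apply vec_ext <;> simp
    rw [e, z, smul_eq_zero] at this
    exact this.resolve_left (sub_ne_zero.2 hO')
  rcases prim_eq_or_neg (G.prim k) (G.prim k') h2 with h | h
  · exact G.vinj h.symm
  · exact (G.not_neg h hx hx').elim

theorem PD.exit (G : PD P n Fc vn c) {O : Z3} {z d : V3} (hz : z ∈ P)
    (hex : ∀ ε : ℝ, 0 < ε → z + ε • d ∉ P)
    (hgen : ∀ m : Z3, m ≠ 0 → dt (toR m) (z - toR O) ≠ 0) :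
    ∃ k, z ∈ Fc k ∧ dt (toR (vn k)) d ≤ 0 := by
  obtain ⟨Vs, hVs⟩ := G.hull
  have hc : Convex ℝ {x : V3 | ∃ ε : ℝ, 0 < ε ∧ x = z + ε • d} := by
    rintro _ ⟨e1, h1, rfl⟩ _ ⟨e2, h2, rfl⟩ a b ha hb hab
    refine ⟨a * e1 + b * e2, ?_, ?_⟩
    · rcases ha.eq_or_lt with h | h
      · have : b = 1 := by linarith
        rw [← h, this]; simpa using h2
      · have := mul_pos h h1; have := mul_nonneg hb h2.le; linarith
    · have : z = a • z + b • z := by rw [← add_smul, hab, one_smul]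
      conv_rhs => rw [this]
      module
  have hdisj : Disjoint (interior P) {x : V3 | ∃ ε : ℝ, 0 < ε ∧ x = z + ε • d} := by
    rw [Set.disjoint_left]
    rintro x hx ⟨ε, he, rfl⟩
    exact hex ε he (interior_subset hx)
  obtain ⟨f, u, hf1, hf2⟩ := geometric_hahn_banach_open G.conv.interior isOpen_interior hc hdisj
  set w : V3 := fun i => f (Pi.single i 1) with hw
  have hfw : ∀ x, f x = dt w x := by
    intro x
    have : x = x 0 • Pi.single 0 1 + x 1 • Pi.single 1 1 + x 2 • Pi.single 2 1 := by
      funext i; fin_cases i <;> simp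
    conv_lhs => rw [this]
    simp [hw, dt]; ring
  have hle : ∀ x ∈ P, dt w x ≤ u := by
    intro x hx
    have : closure (interior P) ⊆ {x | dt w x ≤ u} := by
      apply closure_minimal
      · intro y hy; rw [Set.mem_ofPred_eq, ← hfw]; exact (hf1 y hy).le
      · exact isClosed_le (dt_continuous w) continuous_const
    exact this (G.clos hx)
  have hge : ∀ ε : ℝ, 0 < ε → u ≤ dt w z + ε * dt w d := by
    intro ε he
    have := hf2 _ ⟨ε, he, rfl⟩
    rwa [hfw, dt_add, dt_smul] at this
  have hzu : dt w z = u := by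
    apply le_antisymm (hle z hz)
    by_contra hlt
    push Not at hlt
    by_cases hd : dt w d ≤ 0
    · have := hge 1 one_pos; linarith
    · push Not at hd
      have := hge ((u - dt w z) / (2 * dt w d)) (div_pos (by linarith) (by linarith))
      have e : (u - dt w z) / (2 * dt w d) * dt w d = (u - dt w z) / 2 := by field_simp
      rw [e] at this; linarith
  have hd : 0 ≤ dt w d := by have := hge 1 one_pos; linarith
  have hw0 : w ≠ 0 := by
    intro h0
    obtain ⟨y, hy⟩ := G.int_ne
    have := hf1 y hy
    rw [hfw, ← hzu, h0] at this
    simp [dt] at this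
  have hzm : z ∈ mface P w := ⟨hz, fun y hy => hzu ▸ hle y hy⟩
  rcases face_facet hVs hw0 ⟨z, hzm⟩ O with h | ⟨m, hm, h⟩
  · obtain ⟨k, hk, t, ht, hwt⟩ := G.all w h
    refine ⟨k, hk ▸ hzm, ?_⟩
    rw [hwt, smul_dt] at hd
    by_contra hcon
    push Not at hcon
    nlinarith
  · exact (hgen m hm (h z hzm)).elim

def hit (Fc : Fin n → Set V3) (O y : V3) (k : Fin n) : Prop := ∃ t : ℝ, 1 < t ∧ O + t • (y - O) ∈ Fc k

open Classical in
theorem PD.core (G : PD P n Fc vn c) {O : Z3} {y : V3} (hy : Gen y) (hOP : toR O ∉ P)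
    (hO : ∀ k, dt (vn k) O ≠ c k) :
    ∑ k, (SignType.sign (dt (vn k) O - c k) : ℤ) * (if hit Fc (toR O) y k then 1 else 0)
      = if y ∈ P then 1 else 0 := by
  set d := y - toR O with hd
  have hgd : ∀ m : Z3, m ≠ 0 → dt (toR m) d ≠ 0 := by
    intro m hm h
    rw [hd, dt_sub, dt_toR, sub_eq_zero] at h
    exact hy m hm _ h
  let T : Set ℝ := {t | toR O + t • d ∈ P}
  have hTc : IsClosed T := G.compact.isClosed.preimage (by fun_prop)
  have hTconv : ∀ a ∈ T, ∀ b ∈ T, ∀ t, a ≤ t → t ≤ b → t ∈ T := by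
    intro a ha b hb t h1 h2
    have hco : Convex ℝ T := by
      intro a ha b hb p q hp hq hpq
      have := G.conv ha hb hp hq hpq
      have e : p • (toR O + a • d) + q • (toR O + b • d) = toR O + (p • a + q • b) • d := by
        have : toR O = p • toR O + q • toR O := by rw [← add_smul, hpq, one_smul]
        conv_rhs => rw [this]
        simp only [smul_eq_mul]; module
      rw [e] at this; exact this
    exact hco.ordConnected.out ha hb ⟨h1, h2⟩
  have h0T : ∀ t ∈ T, t ≠ 0 := by
    rintro t ht rfl
    apply hOP; simpa [T] using ht
  have hgz : ∀ t ∈ T, ∀ m : Z3, m ≠ 0 → dt (toR m) ((toR O + t • d) - toR O) ≠ 0 := by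
    intro t ht m hm
    rw [add_sub_cancel_left, dt_smul]
    exact mul_ne_zero (h0T t ht) (hgd m hm)
  have huniq : ∀ (t : ℝ) k k', toR O + t • d ∈ Fc k → toR O + t • d ∈ Fc k' → k = k' := by
    intro t k k' h h'
    have ht : t ∈ T := by have := h; rw [G.desc] at this; exact this.1
    exact G.uniq (hgz t ht) h h' (hO k')
  have hFT : ∀ (t : ℝ) k, toR O + t • d ∈ Fc k → t ∈ T := by
    intro t k h; rw [G.desc] at h; exact h.1
  have hmono : ∀ (t : ℝ) k, toR O + t • d ∈ Fc k → ∀ t' ∈ T, 0 ≤ (t' - t) * dt (toR (vn k)) d := by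
    intro t k h t' ht'
    rw [G.desc] at h
    have h1 := h.2
    have h2 := G.ge k _ ht'
    rw [dt_add, dt_smul] at h1 h2
    linarith
  have hsgn : ∀ (t : ℝ) k, 0 < t → toR O + t • d ∈ Fc k →
      (dt (toR (vn k)) d < 0 → SignType.sign (dt (vn k) O - c k) = 1) ∧
      (0 < dt (toR (vn k)) d → SignType.sign (dt (vn k) O - c k) = -1) := by
    intro t k ht h
    rw [G.desc] at h
    have h1 := h.2
    rw [dt_add, dt_smul, dt_toR] at h1
    constructor
    · intro hn
      rw [sign_eq_one_iff]
      have : (0 : ℝ) < (dt (vn k) O - c k : ℤ) := by push_cast; nlinarith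
      exact_mod_cast this
    · intro hn
      rw [sign_eq_neg_one_iff]
      have : ((dt (vn k) O - c k : ℤ) : ℝ) < 0 := by push_cast; nlinarith
      exact_mod_cast this
  have hvd : ∀ k, dt (toR (vn k)) d ≠ 0 := fun k => hgd _ (prim_ne_zero (G.prim k))
  -- no T case
  by_cases hT1 : ∃ t ∈ T, 1 < t
  swap
  · push Not at hT1
    have hyP : y ∉ P := by
      intro hyP
      -- y would be an exit point
      have h1T : (1 : ℝ) ∈ T := by simpa [T, hd] using hyP
      obtain ⟨k, hk, -⟩ := G.exit (O := O) (z := toR O + (1:ℝ) • d) (d := d) h1T (by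
        intro ε he hc
        have : 1 + ε ∈ T := by
          show toR O + (1 + ε) • d ∈ P
          rw [add_smul, ← add_assoc]; exact hc
        have := hT1 _ this
        linarith) (hgz 1 h1T)
      rw [G.desc] at hk
      have := hk.2
      simp only [one_smul, hd, add_sub_cancel] at this
      exact hy _ (prim_ne_zero (G.prim k)) _ this
    rw [if_neg hyP]
    apply Finset.sum_eq_zero
    intro k _
    rw [if_neg, mul_zero]
    rintro ⟨t, ht, htk⟩
    have := hT1 t (hFT t k htk); linarith
  obtain ⟨t0, ht0, ht01⟩ := hT1
  have hTb : ∃ M, ∀ t ∈ T, |t| ≤ M := by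
    obtain ⟨M, hM⟩ := G.compact.isBounded.exists_norm_le
    have hdd : d ≠ 0 := by
      intro h0
      apply hgd ![1,0,0] (by intro h; have := congrFun h 0; simp at this)
      rw [h0]; simp [dt]
    have hn : 0 < ‖d‖ := norm_pos_iff.2 hdd
    refine ⟨(M + ‖toR O‖) / ‖d‖, fun t ht => ?_⟩
    rw [le_div_iff₀ hn, ← Real.norm_eq_abs, ← norm_smul]
    have h1 := hM _ ht
    have h2 := norm_sub_le (toR O + t • d) (toR O)
    rw [add_sub_cancel_left] at h2
    linarith
  have hTcomp : IsCompact T := by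
    obtain ⟨M, hM⟩ := hTb
    refine Metric.isCompact_of_isClosed_isBounded hTc ?_
    exact (Metric.isBounded_closedBall (x := (0:ℝ)) (r := M)).subset fun t ht => by
      simpa using hM t ht
  obtain ⟨β, hβT, hβ⟩ := hTcomp.exists_isMaxOn ⟨t0, ht0⟩ continuousOn_id
  obtain ⟨α, hαT, hα⟩ := hTcomp.exists_isMinOn ⟨t0, ht0⟩ continuousOn_id
  have hβ : ∀ t ∈ T, t ≤ β := fun t ht => hβ ht
  have hα : ∀ t ∈ T, α ≤ t := fun t ht => hα ht
  obtain ⟨ke, hke, hke2⟩ := G.exit (O := O) (z := toR O + β • d) (d := d) hβT (by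
    intro ε he hc
    have : β + ε ∈ T := by
      show toR O + (β + ε) • d ∈ P
      rw [add_smul, ← add_assoc]; exact hc
    have := hβ _ this
    linarith) (hgz β hβT)
  obtain ⟨ki, hki, hki2⟩ := G.exit (O := O) (z := toR O + α • d) (d := -d) hαT (by
    intro ε he hc
    have : α - ε ∈ T := by
      show toR O + (α - ε) • d ∈ P
      rw [sub_smul, sub_eq_add_neg, ← smul_neg, ← add_assoc]; exact hc
    have := hα _ this
    linarith) (hgz α hαT)
  have hke3 : dt (toR (vn ke)) d < 0 := lt_of_le_of_ne hke2 (hvd ke)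
  have hki3 : 0 < dt (toR (vn ki)) d := by
    rw [dt_neg] at hki2
    exact lt_of_le_of_ne (by linarith) (hvd ki).symm
  have hne : ke ≠ ki := by rintro rfl; linarith
  have hβ1 : 1 < β := lt_of_lt_of_le ht01 (hβ _ ht0)
  have hitke : hit Fc (toR O) y ke := ⟨β, hβ1, hke⟩
  have hske := (hsgn β ke (by linarith) hke).1 hke3
  have hcases : ∀ k (t : ℝ), toR O + t • d ∈ Fc k → (t = β ∧ k = ke) ∨ (t = α ∧ k = ki) := by
    intro k t hk
    rcases lt_or_gt_of_ne (hvd k) with h | h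
    · left
      have h1 := hmono t k hk β hβT
      have h2 := hβ t (hFT t k hk)
      have : t = β := by nlinarith
      subst this
      exact ⟨rfl, huniq _ _ _ hk hke⟩
    · right
      have h1 := hmono t k hk α hαT
      have h2 := hα t (hFT t k hk)
      have : t = α := by nlinarith
      subst this
      exact ⟨rfl, huniq _ _ _ hk hki⟩
  by_cases hyP : y ∈ P
  · have h1T : (1 : ℝ) ∈ T := by simpa [T, hd] using hyP
    rw [if_pos hyP, Finset.sum_eq_single ke]
    · rw [if_pos hitke, hske]; rfl
    · intro k _ hk
      rw [if_neg, mul_zero]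
      rintro ⟨t, ht, htk⟩
      rcases hcases k t htk with h | h
      · exact hk h.2
      · have := hα 1 h1T; linarith
    · intro h; exact (h (Finset.mem_univ _)).elim
  · have h1T : (1 : ℝ) ∉ T := by
      intro h; apply hyP; simpa [T, hd] using h
    have hα1 : 1 < α := by
      by_contra hcon
      push Not at hcon
      exact h1T (hTconv α hαT β hβT 1 hcon hβ1.le)
    have hitki : hit Fc (toR O) y ki := ⟨α, hα1, hki⟩
    have hski := (hsgn α ki (by linarith) hki).2 hki3
    rw [if_neg hyP, Finset.sum_eq_add ke ki hne]
    · rw [if_pos hitke, if_pos hitki, hske, hski]; rfl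
    · intro k _ hk
      rw [if_neg, mul_zero]
      rintro ⟨t, ht, htk⟩
      rcases hcases k t htk with h | h
      · exact hk.1 h.2
      · exact hk.2 h.2
    · intro h; exact (h (Finset.mem_univ _)).elim
    · intro h; exact (h (Finset.mem_univ _)).elim

end

section

theorem exists_O {P : Set V3} (hb : Bornology.IsBounded P) {n : ℕ} {vn : Fin n → Z3} {c : Fin n → ℤ}
    (hv : ∀ k, vn k ≠ 0) : ∃ O : Z3, toR O ∉ P ∧ ∀ k, dt (vn k) O ≠ c k := by
  let q : ℕ → Z3 := fun t => ![t, t ^ 2, t ^ 3]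
  have h1 : {t : ℕ | toR (q t) ∈ P}.Finite := by
    obtain ⟨M, hM⟩ := hb.exists_norm_le
    apply (Set.finite_Iic ⌈M⌉₊).subset
    intro t ht
    have h1 := hM _ ht
    have h2 := norm_le_pi_norm (toR (q t)) 0
    have : (t : ℝ) ≤ M := by simpa [toR, q] using h2.trans h1
    rw [Set.mem_Iic]
    exact_mod_cast this.trans (Nat.le_ceil M)
  have h2 : ∀ k, {t : ℕ | dt (vn k) (q t) = c k}.Finite := by
    intro k
    open Polynomial in
    let p : ℤ[X] := C (vn k 0) * X + C (vn k 1) * X ^ 2 + C (vn k 2) * X ^ 3 - C (c k)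
    have hp : p ≠ 0 := by
      intro h0
      apply hv k
      funext i
      have e1 := congrArg (fun f => Polynomial.coeff f 1) h0
      have e2 := congrArg (fun f => Polynomial.coeff f 2) h0
      have e3 := congrArg (fun f => Polynomial.coeff f 3) h0
      simp [p, -eq_intCast, Polynomial.coeff_C_mul, Polynomial.coeff_X, Polynomial.coeff_C, Polynomial.coeff_X_pow] at e1 e2 e3
      fin_cases i <;> simp [e1, e2, e3]
    have hf : {x : ℤ | p.IsRoot x}.Finite := by
      by_contra hinf
      exact hp (Polynomial.eq_zero_of_infinite_isRoot p hinf)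
    have := hf.preimage (f := fun t : ℕ => (t : ℤ)) (fun a _ b _ h => by simpa using h)
    refine this.subset ?_
    intro t ht
    simp only [Set.mem_ofPred_eq, Set.mem_preimage, Polynomial.IsRoot] at *
    simp [p]
    rw [← ht]; simp [dt, q]
  have h3 : ({t : ℕ | toR (q t) ∈ P} ∪ ⋃ k, {t : ℕ | dt (vn k) (q t) = c k}).Finite :=
    h1.union (Set.finite_iUnion h2)
  obtain ⟨t, ht⟩ := h3.exists_notMem
  simp at ht
  exact ⟨q t, ht.1, ht.2⟩

theorem exists_gen {U : Set V3} (ho : IsOpen U) (hne : U.Nonempty) : ∃ R ∈ U, Gen R := by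
  have hd : Dense (⋂ q : {v : Z3 // v ≠ 0} × ℤ, {x : V3 | dt (toR q.1.1) x ≠ q.2}) := by
    apply dense_iInter_of_isOpen
    · intro q
      exact isOpen_ne_fun (dt_continuous _) continuous_const
    · rintro ⟨⟨v, hv⟩, a⟩
      rw [dense_iff_inter_open]
      rintro W hW ⟨x, hx⟩
      by_cases h : dt (toR v) x = a
      · have hp := dt_self_pos (toR_ne hv)
        have hcont : Continuous fun t : ℝ => x + t • toR v := by fun_prop
        obtain ⟨ε, hε, hb⟩ := Metric.isOpen_iff.1 (hW.preimage hcont) 0 (by simpa using hx)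
        have h1 : x + (ε / 2) • toR v ∈ W := hb (by simp [abs_of_pos hε]; exact hε)
        refine ⟨_, h1, ?_⟩
        simp only [Set.mem_ofPred_eq]
        rw [dt_add, dt_smul, h]
        have := mul_pos (half_pos hε) hp
        intro h'; linarith
      · exact ⟨x, hx, h⟩
  obtain ⟨R, hR, hR2⟩ := hd.inter_open_nonempty U ho hne
  refine ⟨R, hR, ?_⟩
  intro v hv a
  exact Set.mem_iInter.1 hR2 (⟨⟨v, hv⟩, a⟩)

def tr (a b c : V3) : ℝ := dt (cr a b) c

theorem tr_cyc (a b c : V3) : tr a b c = tr b c a := by unfold tr; exact dt_cr_cycle _ _ _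
theorem tr_swap (a b c : V3) : tr a b c = - tr b a c := by
  simp [tr, dt]; ring
theorem tr_same1 (a b : V3) : tr a b a = 0 := by simp [tr, dt]; ring
theorem tr_same2 (a b : V3) : tr a b b = 0 := by simp [tr, dt]; ring
theorem tr_same0 (a b : V3) : tr a a b = 0 := by simp [tr, dt]; ring
theorem tr_plucker (o a b c d : V3) :
    tr o a b * tr o c d - tr o a c * tr o b d + tr o a d * tr o b c = 0 := by
  simp [tr, dt]; ring
theorem tr_cramer (a b c w : V3) :
    tr a b c • w = tr b c w • a + tr c a w • b + tr a b w • c := by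
  apply vec_ext <;> simp [tr, dt] <;> ring
theorem tr_add (a b x y : V3) : tr a b (x + y) = tr a b x + tr a b y := dt_add _ _ _
theorem tr_smul (a b x : V3) (t : ℝ) : tr a b (t • x) = t * tr a b x := dt_smul _ _ _

/-- polygon as seen from the origin -/
structure Fan (r : ℕ) (p : ℕ → V3) (v : V3) (h σ : ℝ) : Prop where
  three : 3 ≤ r
  h0 : h ≠ 0
  per : ∀ i, p (i + r) = p i
  hv : ∀ i, dt v (p i) = h
  pos : ∀ i m, 2 ≤ m → m + 1 ≤ r → 0 < σ * tr (p i) (p (i + 1)) (p (i + m))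

variable {r : ℕ} {p : ℕ → V3} {v : V3} {h σ : ℝ}

theorem Fan.nonneg (F : Fan r p v h σ) {i j : ℕ} (hi : 1 ≤ i) (hi' : i ≤ r) (hj : 1 ≤ j) (hj' : j ≤ r) :
    0 ≤ σ * tr (p j) (p (j + 1)) (p i) := by
  have key : ∀ m, m + 1 ≤ r → 0 ≤ σ * tr (p j) (p (j + 1)) (p (j + m)) := by
    intro m hm
    rcases Nat.lt_or_ge m 2 with h2 | h2
    · interval_cases m
      · simp [tr_same1]
      · simp [tr_same2]
    · exact (F.pos j m h2 hm).le
  rcases Nat.lt_or_ge i j with h | h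
  · have := key (i + r - j) (by omega)
    rwa [show j + (i + r - j) = i + r by omega, F.per] at this
  · have := key (i - j) (by omega)
    rwa [show j + (i - j) = i by omega] at this

theorem Fan.pos12 (F : Fan r p v h σ) {j : ℕ} (hj : 3 ≤ j) (hj' : j ≤ r) :
    0 < σ * tr (p 1) (p 2) (p j) := by
  have := F.pos 1 (j - 1) (by omega) (by omega)
  rwa [show 1 + (j - 1) = j by omega] at this

theorem Fan.pos1s (F : Fan r p v h σ) {j : ℕ} (hj : 2 ≤ j) (hj' : j + 1 ≤ r) :
    0 < σ * tr (p 1) (p j) (p (j + 1)) := by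
  have := F.pos j (1 + r - j) (by omega) (by omega)
  rw [show j + (1 + r - j) = 1 + r by omega, F.per] at this
  rwa [tr_cyc]

theorem Fan.pos1 (F : Fan r p v h σ) {i : ℕ} (hi : 2 ≤ i) :
    ∀ j, i < j → j ≤ r → 0 < σ * tr (p 1) (p i) (p j) := by
  intro j
  induction j with
  | zero => intro h; omega
  | succ j ih =>
    intro h1 h2
    rcases Nat.eq_or_lt_of_le hi with h | h
    · rw [← h]; exact F.pos12 (by omega) h2
    · rcases Nat.eq_or_lt_of_le (Nat.lt_succ_iff.1 h1) with e | e
      · rw [e]; exact F.pos1s (by omega) h2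
      · have a1 := ih e (by omega)
        have a2 := F.pos12 (j := i) (by omega) (by omega)
        have a3 := F.pos1s (j := j) (by omega) (by omega)
        have a4 := F.pos12 (j := j + 1) (by omega) (by omega)
        have a5 := F.pos12 (j := j) (by omega) (by omega)
        have pl := tr_plucker (p 1) (p 2) (p i) (p j) (p (j + 1))
        have : (σ * tr (p 1) (p 2) (p j)) * (σ * tr (p 1) (p i) (p (j + 1)))
          = (σ * tr (p 1) (p 2) (p i)) * (σ * tr (p 1) (p j) (p (j + 1)))
           + (σ * tr (p 1) (p 2) (p (j + 1))) * (σ * tr (p 1) (p i) (p j)) := by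
          linear_combination (- σ ^ 2) * pl
        have hpos := add_pos (mul_pos a2 a3) (mul_pos a4 a1)
        rw [← this] at hpos
        exact (pos_iff_pos_of_mul_pos hpos).1 a5

def Tj (p : ℕ → V3) (v : V3) (h σ : ℝ) (w : V3) (j : ℕ) : Prop :=
  0 < σ * tr (p j) (p (j + 1)) w ∧ 0 < σ * tr (p 1) (p j) w ∧ 0 < σ * tr (p (j + 1)) (p 1) w ∧
    dt v w / h < 1

theorem discrete_ivt (f : ℕ → ℝ) : ∀ r : ℕ, 2 ≤ r → 0 < f 2 → f r < 0 → (∀ j, 2 ≤ j → j ≤ r → f j ≠ 0) →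
    ∃ j, 2 ≤ j ∧ j + 1 ≤ r ∧ 0 < f j ∧ f (j + 1) < 0 := by
  intro r
  induction r with
  | zero => intro h; omega
  | succ r ih =>
    intro h2 hp hn hne
    rcases Nat.eq_or_lt_of_le h2 with h | h
    · rw [← h] at hn; linarith
    · rcases lt_or_gt_of_ne (hne r (by omega) (by omega)) with h' | h'
      · obtain ⟨j, a, b, c, d⟩ := ih (by omega) hp h' fun j x y => hne j x (by omega)
        exact ⟨j, a, by omega, c, d⟩
      · exact ⟨r, by omega, le_rfl, h', hn⟩

theorem pos_smul_cancel {t x : ℝ} (ht : 0 < t) (h : 0 < t * x) : 0 < x := by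
  exact (pos_iff_pos_of_mul_pos h).1 ht

open Classical in
theorem Fan.count (F : Fan r p v h σ) {w : V3}
    (g1 : ∀ j, 2 ≤ j → j ≤ r → tr (p 1) (p j) w ≠ 0)
    (g2 : ∀ j, 1 ≤ j → j ≤ r → tr (p j) (p (j + 1)) w ≠ 0) :
    ∑ j ∈ Finset.Icc 2 (r - 1), (if Tj p v h σ w j then (1 : ℤ) else 0)
      = if (∃ t : ℝ, 1 < t ∧ t • w ∈ convexHull ℝ (p '' Set.Icc 1 r)) then 1 else 0 := by
  have hr := F.three
  have hσ : σ ≠ 0 := by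
    intro h0; have := F.pos12 (j := 3) le_rfl hr; rw [h0] at this; simp at this
  -- tetrahedron implies hit
  have expr : ∀ j, 2 ≤ j → j + 1 ≤ r → Tj p v h σ w j → ∃ a b c : ℝ, 0 < a ∧ 0 < b ∧ 0 < c ∧
      w = a • p 1 + b • p j + c • p (j + 1) := by
    intro j h1 h2 hT
    obtain ⟨t1, t2, t3, -⟩ := hT
    have hd := F.pos1s h1 h2
    refine ⟨_, _, _, div_pos t1 hd, div_pos t3 hd, div_pos t2 hd, ?_⟩
    have hc := tr_cramer (p 1) (p j) (p (j + 1)) w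
    have hne := hd.ne'
    have : (σ * tr (p 1) (p j) (p (j + 1))) • w = (σ * tr (p j) (p (j + 1)) w) • p 1
      + (σ * tr (p (j + 1)) (p 1) w) • p j + (σ * tr (p 1) (p j) w) • p (j + 1) := by
      simp only [mul_smul]
      rw [hc, smul_add, smul_add]
    rw [div_eq_inv_mul, div_eq_inv_mul, div_eq_inv_mul, mul_smul _ _ (p 1), mul_smul _ _ (p j),
      mul_smul _ _ (p (j + 1)), ← smul_add, ← smul_add, ← this, smul_smul, inv_mul_cancel₀ hne, one_smul]
  have back : ∀ j, 2 ≤ j → j + 1 ≤ r → Tj p v h σ w j →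
      ∃ t : ℝ, 1 < t ∧ t • w ∈ convexHull ℝ (p '' Set.Icc 1 r) := by
    intro j h1 h2 hT
    obtain ⟨a, b, c, ha, hb, hc, hw⟩ := expr j h1 h2 hT
    have hs : a + b + c < 1 := by
      have h4 := hT.2.2.2
      rw [hw, dt_add, dt_add, dt_smul, dt_smul, dt_smul, F.hv, F.hv, F.hv] at h4
      have h0 := F.h0
      have e : (a * h + b * h + c * h) / h = a + b + c := by field_simp
      rwa [e] at h4
    have hs0 : 0 < a + b + c := by linarith
    refine ⟨(a + b + c)⁻¹, (one_lt_inv₀ hs0).2 hs, ?_⟩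
    have m1 : p 1 ∈ convexHull ℝ (p '' Set.Icc 1 r) := subset_convexHull _ _ ⟨1, ⟨le_rfl, by omega⟩, rfl⟩
    have m2 : p j ∈ convexHull ℝ (p '' Set.Icc 1 r) := subset_convexHull _ _ ⟨j, ⟨by omega, by omega⟩, rfl⟩
    have m3 : p (j + 1) ∈ convexHull ℝ (p '' Set.Icc 1 r) :=
      subset_convexHull _ _ ⟨j + 1, ⟨by omega, by omega⟩, rfl⟩
    have hcv := convex_convexHull ℝ (p '' Set.Icc 1 r)
    have q1 : (a / (a + b)) • p 1 + (b / (a + b)) • p j ∈ convexHull ℝ (p '' Set.Icc 1 r) :=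
      hcv m1 m2 (by positivity) (by positivity) (by field_simp)
    have q2 := hcv q1 m3 (a := (a + b) / (a + b + c)) (b := c / (a + b + c)) (by positivity) (by positivity)
      (by field_simp)
    convert q2 using 1
    rw [hw, smul_add, smul_add, smul_add, smul_smul, smul_smul, smul_smul, smul_smul, smul_smul]
    congr 1
    · congr 1 <;> congr 1 <;> field_simp
    · congr 1; field_simp
  by_cases hit : ∃ t : ℝ, 1 < t ∧ t • w ∈ convexHull ℝ (p '' Set.Icc 1 r)
  swap
  · rw [if_neg hit]
    apply Finset.sum_eq_zero
    intro j hj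
    rw [Finset.mem_Icc] at hj
    rw [if_neg]
    intro hT
    exact hit (back j hj.1 (by omega) hT)
  rw [if_pos hit]
  obtain ⟨t, ht, htw⟩ := hit
  have ht0 : 0 < t := by linarith
  have hge : ∀ j, 1 ≤ j → j ≤ r → 0 < σ * tr (p j) (p (j + 1)) w := by
    intro j h1 h2
    have hc : Convex ℝ {x : V3 | 0 ≤ σ * tr (p j) (p (j + 1)) x} := by
      intro x hx y hy a b ha hb hab
      simp only [Set.mem_ofPred_eq, tr_add, tr_smul] at *
      have := add_nonneg (mul_nonneg ha hx) (mul_nonneg hb hy)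
      linarith
    have h3 : t • w ∈ {x : V3 | 0 ≤ σ * tr (p j) (p (j + 1)) x} := by
      refine convexHull_min ?_ hc htw
      rintro _ ⟨i, hi, rfl⟩
      exact F.nonneg hi.1 hi.2 h1 h2
    simp only [Set.mem_ofPred_eq, tr_smul] at h3
    have h4 : 0 ≤ t * (σ * tr (p j) (p (j + 1)) w) := by linarith
    exact lt_of_le_of_ne (nonneg_of_mul_nonneg_right h4 ht0) (mul_ne_zero hσ (g2 j h1 h2)).symm
  have hht : dt v w / h < 1 := by
    have hc : Convex ℝ {x : V3 | dt v x = h} := by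
      intro x hx y hy a b ha hb hab
      simp only [Set.mem_ofPred_eq, dt_add, dt_smul] at *
      rw [hx, hy, ← add_mul, hab, one_mul]
    have h3 : t • w ∈ {x : V3 | dt v x = h} := by
      refine convexHull_min ?_ hc htw
      rintro _ ⟨i, hi, rfl⟩
      exact F.hv i
    simp only [Set.mem_ofPred_eq, dt_smul] at h3
    have h0 := F.h0
    have : dt v w / h = 1 / t := by
      field_simp; linarith
    rw [this, div_lt_one ht0]; exact ht
  have f2 : 0 < σ * tr (p 1) (p 2) w := hge 1 le_rfl (by omega)
  have fr : σ * tr (p 1) (p r) w < 0 := by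
    have := hge r (by omega) le_rfl
    rw [Nat.add_comm r 1, F.per] at this
    rw [tr_swap]; linarith
  obtain ⟨j, hj1, hj2, hj3, hj4⟩ := discrete_ivt (fun j => σ * tr (p 1) (p j) w) r (by omega) f2 fr
    fun j a b => mul_ne_zero hσ (g1 j a b)
  have hTj : Tj p v h σ w j := ⟨hge j (by omega) (by omega), hj3, by rw [tr_swap]; linarith, hht⟩
  have less : ∀ i i', 2 ≤ i → i + 1 ≤ r → 2 ≤ i' → i' + 1 ≤ r → Tj p v h σ w i → Tj p v h σ w i' → i < i' → False := by
    intro i i' a1 a2 a3 a4 hT hT' hlt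
    obtain ⟨a, b, c, ha, hb, hc, hw⟩ := expr i a1 a2 hT
    have h1 := hT'.2.1
    rw [hw, tr_add, tr_add, tr_smul, tr_smul, tr_smul, tr_same1] at h1
    have n1 := F.pos1 a1 i' hlt (by omega)
    rw [tr_cyc, tr_swap, tr_cyc, tr_cyc] at n1
    have n2 : σ * tr (p 1) (p i') (p (i + 1)) ≤ 0 := by
      rcases Nat.eq_or_lt_of_le (Nat.succ_le_of_lt hlt) with e | e
      · rw [← e]; simp [tr_same2]
      · have := F.pos1 (i := i + 1) (by omega) i' e (by omega)
        rw [tr_cyc, tr_swap, tr_cyc, tr_cyc] at this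
        have e2 : tr (p 1) (p i') (p (i + 1)) = tr (p i') (p (i+1)) (p 1) := tr_cyc _ _ _
        rw [tr_cyc] at this ⊢
        linarith
    have e1 : σ * tr (p 1) (p i') (p i) < 0 := by
      linarith
    nlinarith [mul_pos hb (neg_pos.2 e1), mul_nonneg hc.le (neg_nonneg.2 n2)]
  rw [Finset.sum_eq_single j]
  · rw [if_pos hTj]
  · intro i hi hij
    rw [Finset.mem_Icc] at hi
    rw [if_neg]
    intro hT
    rcases lt_or_gt_of_ne hij with h' | h'
    · exact less i j hi.1 (by omega) hj1 hj2 hT hTj h'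
    · exact less j i hj1 hj2 hi.1 (by omega) hTj hT h'
  · intro hnot
    exact (hnot (Finset.mem_Icc.2 ⟨hj1, by omega⟩)).elim

end

section

/-- combinatorial data around a facet -/
structure LabD (v : Z3) (c : ℤ) (r : ℕ) (Pt u : ℕ → Z3) (e : ℕ → ℤ) : Prop where
  three : 3 ≤ r
  prim : IsPrimitive v
  per : ∀ i, Pt (i + r) = Pt i
  plane : ∀ i, dt v (Pt i) = c
  on1 : ∀ i, dt (u (i + 1)) (Pt i) = e (i + 1)
  on2 : ∀ i, dt (u (i + 1)) (Pt (i + 1)) = e (i + 1)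
  pos : ∀ i m, 2 ≤ m → m + 1 ≤ r → e (i + 1) < dt (u (i + 1)) (Pt (i + m))

variable {v : Z3} {c : ℤ} {r : ℕ} {Pt u : ℕ → Z3} {e : ℕ → ℤ}

def pO (O : Z3) (Pt : ℕ → Z3) (i : ℕ) : V3 := toR (Pt i) - toR O

theorem tr_pO (O : Z3) (Pt : ℕ → Z3) (i j k : ℕ) : tr (pO O Pt i) (pO O Pt j) (pO O Pt k)
    = ((dt (cr (Pt i - O) (Pt j - O)) (Pt k - O) : ℤ) : ℝ) := by
  unfold tr pO
  rw [← toR_sub, ← toR_sub, ← toR_sub, ← toR_cr, dt_toR]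

def edD (v : Z3) (Pt u : ℕ → Z3) (i : ℕ) : ℤ := dt (cr v (u (i + 1))) (Pt (i + 1) - Pt i)

theorem LabD.det (L : LabD v c r Pt u e) (O : Z3) (i m : ℕ) :
    dt (cr (Pt i - O) (Pt (i + 1) - O)) (Pt (i + m) - O) * edD v Pt u i =
      dt (Pt (i + 1) - Pt i) (Pt (i + 1) - Pt i) *
        ((dt v O - c) * (dt (u (i + 1)) (Pt (i + m)) - e (i + 1))) := by
  have h1 : dt v (Pt (i + 1) - Pt i) = 0 := by rw [dt_sub, L.plane, L.plane, sub_self]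
  have h2 : dt (u (i + 1)) (Pt (i + 1) - Pt i) = 0 := by rw [dt_sub, L.on1, L.on2, sub_self]
  have := edge_det (O - Pt i) (Pt (i + m) - Pt i) (Pt (i + 1) - Pt i) v (u (i + 1)) h1 h2
  unfold edD
  have e1 : dt (cr (O - Pt i) (Pt (i + m) - Pt i)) (Pt (i + 1) - Pt i)
    = dt (cr (Pt i - O) (Pt (i + 1) - O)) (Pt (i + m) - O) := by
    simp [dt]; ring
  rw [e1] at this
  rw [this, dt_sub v, dt_sub v, dt_sub (u _), dt_sub (u _), L.plane, L.plane, L.on1]; ring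

theorem LabD.edge_ne (L : LabD v c r Pt u e) (i : ℕ) : Pt (i + 1) - Pt i ≠ 0 := by
  intro h0
  have h1 := L.pos (i + 1) (r - 1) (by have := L.three; omega) (by have := L.three; omega)
  rw [show i + 1 + (r - 1) = i + r by have := L.three; omega, L.per] at h1
  have h2 := L.on1 (i + 1)
  rw [sub_eq_zero.1 h0] at h2
  omega

theorem LabD.edD_sign (L : LabD v c r Pt u e) {O : Z3} {i m : ℕ} (h2 : 2 ≤ m)
    (h3 : m + 1 ≤ r) : Int.sign (dt (cr (Pt i - O) (Pt (i + 1) - O)) (Pt (i + m) - O)) * Int.sign (edD v Pt u i)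
      = Int.sign (dt v O - c) := by
  have h := L.det O i m
  have h1 := congrArg Int.sign h
  rw [Int.sign_mul, Int.sign_mul, Int.sign_mul, Int.sign_eq_one_of_pos (dt_self_pos_int (L.edge_ne i)),
    Int.sign_eq_one_of_pos (sub_pos.2 (L.pos i m h2 h3))] at h1
  simpa using h1

theorem int_sign_cases {x : ℤ} (h : x ≠ 0) : Int.sign x = 1 ∨ Int.sign x = -1 := by
  rcases lt_or_gt_of_ne h with h | h
  · right; exact Int.sign_eq_neg_one_of_neg h
  · left; exact Int.sign_eq_one_of_pos h

theorem exists_off (L : LabD v c r Pt u e) : ∃ O : Z3, dt v O ≠ c := by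
  refine ⟨Pt 0 + v, ?_⟩
  rw [dt_add, L.plane]
  have := dt_self_pos_int (prim_ne_zero L.prim)
  omega

theorem LabD.edD_succ (L : LabD v c r Pt u e) (i : ℕ) :
    Int.sign (edD v Pt u (i + 1)) = Int.sign (edD v Pt u i) ∧ edD v Pt u i ≠ 0 := by
  have h3 := L.three
  obtain ⟨O, hO⟩ := exists_off L
  have a1 := L.edD_sign (O := O) (i := i) (m := 2) le_rfl h3
  have a2 := L.edD_sign (O := O) (i := i + 1) (m := r - 1) (by omega) (by omega)
  rw [show i + 1 + (r - 1) = i + r by omega, L.per, dt_cr_cycle, dt_cr_cycle] at a2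
  have hs := int_sign_cases (sub_ne_zero.2 hO)
  rw [show i + 1 + 1 = i + 2 by omega] at a2
  set x := Int.sign (dt (cr (Pt i - O) (Pt (i + 1) - O)) (Pt (i + 2) - O))
  have hx : x ≠ 0 := by
    intro h0; rw [h0, zero_mul] at a1; rw [← a1] at hs; omega
  refine ⟨mul_left_cancel₀ hx (a2.trans a1.symm), ?_⟩
  intro h0
  rw [h0] at a1; simp at a1; rw [← a1] at hs; omega

def dlt (v : Z3) (Pt u : ℕ → Z3) : ℤ := Int.sign (edD v Pt u 0)

theorem LabD.edD_const (L : LabD v c r Pt u e) (i : ℕ) : Int.sign (edD v Pt u i) = dlt v Pt u := by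
  induction i with
  | zero => rfl
  | succ i ih => rw [(L.edD_succ i).1, ih]

theorem LabD.dlt_cases (L : LabD v c r Pt u e) : dlt v Pt u = 1 ∨ dlt v Pt u = -1 :=
  int_sign_cases (L.edD_succ 0).2

def sg (v : Z3) (c : ℤ) (O : Z3) (Pt u : ℕ → Z3) : ℤ := Int.sign (dt v O - c) * dlt v Pt u

theorem LabD.sg_eq (L : LabD v c r Pt u e) {O : Z3} {i m : ℕ} (h2 : 2 ≤ m)
    (h3 : m + 1 ≤ r) : Int.sign (dt (cr (Pt i - O) (Pt (i + 1) - O)) (Pt (i + m) - O)) = sg v c O Pt u := by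
  have := L.edD_sign (O := O) (i := i) h2 h3
  rw [L.edD_const] at this
  unfold sg
  rw [← this, mul_assoc]
  rcases L.dlt_cases with h | h <;> rw [h] <;> simp

theorem LabD.sg_cases (L : LabD v c r Pt u e) {O : Z3} (hO : dt v O ≠ c) :
    sg v c O Pt u = 1 ∨ sg v c O Pt u = -1 := by
  unfold sg
  rcases L.dlt_cases with h | h <;> rcases int_sign_cases (sub_ne_zero.2 hO) with h' | h' <;> rw [h, h'] <;> simp

theorem LabD.fan (L : LabD v c r Pt u e) {O : Z3} (hO : dt v O ≠ c) :
    Fan r (pO O Pt) (toR v) ((c - dt v O : ℤ) : ℝ) (sg v c O Pt u : ℝ) where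
  three := L.three
  h0 := by
    rw [Int.cast_ne_zero]; exact sub_ne_zero.2 (Ne.symm hO)
  per := fun i => by unfold pO; rw [L.per]
  hv := fun i => by
    unfold pO; rw [← toR_sub, dt_toR, dt_sub, L.plane]
  pos := by
    intro i m h2 h3
    rw [tr_pO, ← L.sg_eq (O := O) (i := i) h2 h3, ← Int.cast_mul]
    have : dt (cr (Pt i - O) (Pt (i + 1) - O)) (Pt (i + m) - O) ≠ 0 := by
      intro h0
      have h1 := L.sg_eq (O := O) (i := i) h2 h3
      rw [h0] at h1
      have := L.sg_cases hO
      simp at h1; omega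
    rw [Int.sign_mul_self_eq_abs]
    exact_mod_cast abs_pos.2 this

def Nn (O Y Z : Z3) : Z3 := prm (cr (Y - O) (Z - O))

def tV (O : Z3) (Pt : ℕ → Z3) (j : ℕ) : Fin 4 → Z3 := ![O, Pt 1, Pt j, Pt (j + 1)]
def tn (v O : Z3) (Pt : ℕ → Z3) (j : ℕ) : Fin 4 → Z3 :=
  ![v, Nn O (Pt j) (Pt (j + 1)), Nn O (Pt (j + 1)) (Pt 1), Nn O (Pt 1) (Pt j)]

theorem prm_perp {Y Z O : Z3} : dt (Nn O Y Z) Y = dt (Nn O Y Z) O ∧ dt (Nn O Y Z) Z = dt (Nn O Y Z) O := by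
  unfold Nn
  by_cases h : cr (Y - O) (Z - O) = 0
  · have z : prm (0 : Z3) = 0 := by funext i; simp [prm]
    rw [h, z]; simp [dt]
  · have := dt_prm_cr_l _ _ h
    rw [dt_sub, dt_sub, sub_eq_zero, sub_eq_zero] at this
    exact this

def TetOK (R : V3) (v : Z3) (c : ℤ) (O : Z3) (Pt u : ℕ → Z3) (j : ℕ) (v' : Fin 4 → Z3) (c' : Fin 4 → ℤ) : Prop :=
  (∀ y : V3, (∀ i, (c' i : ℝ) < dt (toR (v' i)) y) ↔
      Tj (pO O Pt) (toR v) ((c - dt v O : ℤ) : ℝ) (sg v c O Pt u : ℝ) (y - toR O) j) ∧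
  (∀ l, {x | tcond R v' c' l x}.Finite) ∧
  (∀ i, v' i ≠ 0) ∧
  ∃ c3 c2 : ℚ, ∀ l : ℕ, 1 ≤ l → (NT R v' c' l : ℝ) = c3 * (l : ℝ) ^ 3 + c2 * (l : ℝ) ^ 2
      + (sg v c O Pt u * thS R (tV O Pt j) (tn v O Pt j)) * l
      + (open Classical in if Tj (pO O Pt) (toR v) ((c - dt v O : ℤ) : ℝ) (sg v c O Pt u : ℝ) (R - toR O) j then 1 else 0)

theorem cr_ne_of_dt {a b c : Z3} (h : dt (cr a b) c ≠ 0) : cr a b ≠ 0 ∧ cr b c ≠ 0 ∧ cr c a ≠ 0 := by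
  refine ⟨?_, ?_, ?_⟩ <;> intro h0 <;> apply h
  · rw [h0]; simp [dt]
  · rw [dt_cr_cycle, h0]; simp [dt]
  · rw [dt_cr_cycle, dt_cr_cycle, h0]; simp [dt]

theorem LabD.tet (L : LabD v c r Pt u e) {O : Z3} (hO : dt v O ≠ c) {R : V3} (hR : Gen R)
    {j : ℕ} (hj : 2 ≤ j) (hj' : j + 1 ≤ r) : ∃ v' c', TetOK R v c O Pt u j v' c' := by
  have F := L.fan hO
  have hpos := F.pos1s hj hj'
  rw [tr_pO] at hpos
  have hD : tD (tV O Pt j) ≠ 0 := by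
    intro h0
    have : tD (tV O Pt j) = dt (cr (Pt 1 - O) (Pt j - O)) (Pt (j + 1) - O) := rfl
    rw [← this, h0] at hpos
    simp at hpos
  have hsgn : Int.sign (tD (tV O Pt j)) = sg v c O Pt u := by
    have e1 := L.sg_eq (O := O) (i := j) (m := 1 + r - j) (by omega) (by omega)
    rw [show j + (1 + r - j) = 1 + r by omega, L.per, ← dt_cr_cycle] at e1
    exact e1
  obtain ⟨n1, n2, n3⟩ := cr_ne_of_dt (show dt (cr (Pt 1 - O) (Pt j - O)) (Pt (j + 1) - O) ≠ 0 from hD)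
  have hn : ∀ i, IsPrimitive (tn v O Pt j i) := by
    intro i
    fin_cases i
    · exact L.prim
    · exact prm_prim n2
    · exact prm_prim n3
    · exact prm_prim n1
  have q1 := prm_perp (Y := Pt j) (Z := Pt (j + 1)) (O := O)
  have q2 := prm_perp (Y := Pt (j + 1)) (Z := Pt 1) (O := O)
  have q3 := prm_perp (Y := Pt 1) (Z := Pt j) (O := O)
  have hc : ∀ i a b, i ≠ a → i ≠ b → dt (tn v O Pt j i) (tV O Pt j a) = dt (tn v O Pt j i) (tV O Pt j b) := by
    have : ∀ i, ∃ t, ∀ a, i ≠ a → dt (tn v O Pt j i) (tV O Pt j a) = t := by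
      intro i
      fin_cases i
      · refine ⟨c, fun a ha => ?_⟩
        fin_cases a
        · exact (ha rfl).elim
        · exact L.plane _
        · exact L.plane _
        · exact L.plane _
      · refine ⟨dt (Nn O (Pt j) (Pt (j + 1))) O, fun a ha => ?_⟩
        fin_cases a
        · rfl
        · exact (ha rfl).elim
        · exact q1.1
        · exact q1.2
      · refine ⟨dt (Nn O (Pt (j + 1)) (Pt 1)) O, fun a ha => ?_⟩
        fin_cases a
        · rfl
        · exact q2.2
        · exact (ha rfl).elim
        · exact q2.1
      · refine ⟨dt (Nn O (Pt 1) (Pt j)) O, fun a ha => ?_⟩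
        fin_cases a
        · rfl
        · exact q3.1
        · exact q3.2
        · exact (ha rfl).elim
    intro i a b ha hb
    obtain ⟨t, ht⟩ := this i
    rw [ht a ha, ht b hb]
  obtain ⟨v', h', c', T, hv'⟩ := tet_exists hD hn hc
  have hint : ∀ y : V3, (∀ i, (c' i : ℝ) < dt (toR (v' i)) y) ↔
      Tj (pO O Pt) (toR v) ((c - dt v O : ℤ) : ℝ) (sg v c O Pt u : ℝ) (y - toR O) j := by
    intro y
    set s : ℝ := (sg v c O Pt u : ℝ) with hs
    set w := y - toR O with hw
    rw [← tr_pO] at hpos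
    have hcr := tr_cramer (pO O Pt 1) (pO O Pt j) (pO O Pt (j + 1)) w
    set t := tr (pO O Pt 1) (pO O Pt j) (pO O Pt (j + 1)) with ht
    set t1 := tr (pO O Pt j) (pO O Pt (j + 1)) w with ht1
    set t2 := tr (pO O Pt (j + 1)) (pO O Pt 1) w with ht2
    set t3 := tr (pO O Pt 1) (pO O Pt j) w with ht3
    have hs0 : s ≠ 0 := by rintro h0; rw [h0] at hpos; simp at hpos
    have ht0 : t ≠ 0 := by rintro h0; rw [h0] at hpos; simp at hpos
    have ev : ∀ i, t * (dt (toR (v' i)) y - dt (v' i) O) =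
        t1 * ((dt (v' i) (Pt 1) : ℤ) - (dt (v' i) O : ℤ)) + t2 * ((dt (v' i) (Pt j) : ℤ) - (dt (v' i) O : ℤ))
        + t3 * ((dt (v' i) (Pt (j + 1)) : ℤ) - (dt (v' i) O : ℤ)) := by
      intro i
      have := congrArg (dt (toR (v' i))) hcr
      rw [dt_smul, dt_add, dt_add, dt_smul, dt_smul, dt_smul] at this
      unfold pO at this
      rw [hw, dt_sub, dt_sub, dt_sub, dt_sub, dt_toR, dt_toR, dt_toR, dt_toR] at this
      exact this
    have E0 : ∀ i, dt (v' i) O = c' i + if i = 0 then (h' i : ℤ) else 0 := fun i => T.eval i 0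
    have E1 : ∀ i, dt (v' i) (Pt 1) = c' i + if i = 1 then (h' i : ℤ) else 0 := fun i => T.eval i 1
    have E2 : ∀ i, dt (v' i) (Pt j) = c' i + if i = 2 then (h' i : ℤ) else 0 := fun i => T.eval i 2
    have E3 : ∀ i, dt (v' i) (Pt (j + 1)) = c' i + if i = 3 then (h' i : ℤ) else 0 := fun i => T.eval i 3
    have hp : ∀ i, (0:ℝ) < (h' i : ℝ) := fun i => by have := T.pos i; positivity
    have a0 := ev 0; have a1 := ev 1; have a2 := ev 2; have a3 := ev 3
    rw [E0, E1, E2, E3] at a0 a1 a2 a3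
    simp at a0 a1 a2 a3
    have hvw : dt (toR v) w / ((c - dt v O : ℤ) : ℝ) = (t1 + t2 + t3) / t := by
      have := congrArg (dt (toR v)) hcr
      rw [dt_smul, dt_add, dt_add, dt_smul, dt_smul, dt_smul, F.hv, F.hv, F.hv] at this
      have h0 := F.h0
      rw [div_eq_div_iff h0 ht0]
      linarith
    have hst : 0 < s * t := hpos
    have b1 : (s * t) * (dt (toR (v' 1)) y - c' 1) = (s * t1) * h' 1 := by linear_combination s * a1
    have b2 : (s * t) * (dt (toR (v' 2)) y - c' 2) = (s * t2) * h' 2 := by linear_combination s * a2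
    have b3 : (s * t) * (dt (toR (v' 3)) y - c' 3) = (s * t3) * h' 3 := by linear_combination s * a3
    have b0 : (dt (toR (v' 0)) y - c' 0) = (1 - (t1 + t2 + t3) / t) * h' 0 := by
      field_simp
      linear_combination a0
    have key : ∀ (x a b h z : ℝ), 0 < a → 0 < h → a * (x - b) = z * h → (b < x ↔ 0 < z) := by
      intro x a b h z ha hh he
      constructor
      · intro hb
        have : 0 < z * h := by rw [← he]; exact mul_pos ha (by linarith)
        exact (pos_iff_pos_of_mul_pos this).2 hh
      · intro hz
        have : 0 < a * (x - b) := by rw [he]; exact mul_pos hz hh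
        have := (pos_iff_pos_of_mul_pos this).1 ha
        linarith
    have k1 := key _ _ _ _ _ hst (hp 1) b1
    have k2 := key _ _ _ _ _ hst (hp 2) b2
    have k3 := key _ _ _ _ _ hst (hp 3) b3
    have k0 := key _ 1 _ _ _ one_pos (hp 0) ((one_mul _).trans b0)
    unfold Tj
    rw [← ht1, ← ht2, ← ht3, hvw, ← k1, ← k2, ← k3]
    constructor
    · intro h
      exact ⟨h 1, h 3, h 2, by have := k0.1 (h 0); linarith⟩
    · rintro ⟨x1, x3, x2, x0⟩ i
      fin_cases i
      · exact k0.2 (by linarith)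
      · exact x1
      · exact x2
      · exact x3
  refine ⟨v', c', hint, T.finite R, fun i => prim_ne_zero (T.prim i), ?_⟩
  obtain ⟨c3, c2, hm⟩ := T.main R
  refine ⟨c3, c2, fun l hl => ?_⟩
  rw [hm l hl]
  have hth := T.theta R
  rw [hsgn, thS_congr hR hn hv'] at hth
  have hM : tM R (tV O Pt j) v' = sg v c O Pt u * thS R (tV O Pt j) (tn v O Pt j) := by
    rw [← hth, ← mul_assoc]
    rcases L.sg_cases hO with h | h <;> rw [h] <;> simp
  rw [hM]
  congr 1
  have hiff : (∀ i, 0 < dt (toR (v' i)) R - c' i) ↔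
      Tj (pO O Pt) (toR v) ((c - dt v O : ℤ) : ℝ) (sg v c O Pt u : ℝ) (R - toR O) j := by
    rw [← hint R]
    exact forall_congr' fun i => sub_pos
  by_cases hT : Tj (pO O Pt) (toR v) ((c - dt v O : ℤ) : ℝ) (sg v c O Pt u : ℝ) (R - toR O) j
  · rw [if_pos hT, if_pos (hiff.2 hT)]
  · rw [if_neg hT, if_neg (fun h => hT (hiff.1 h))]

end

section

def yN (R : V3) (l : ℕ) (x : Z3) (N : ℕ) : V3 :=
  (1 - 1 / (N : ℝ)) • ((1 / (l : ℝ)) • toR x) + (1 / (N : ℝ)) • R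

theorem dt_yN (R : V3) {l : ℕ} (hl : 1 ≤ l) (x m : Z3) (c : ℤ) {N : ℕ} (hN : 1 ≤ N) :
    ((N : ℝ) * l) * (dt (toR m) (yN R l x N) - c) =
      ((N : ℝ) - 1) * ((dt m x - c * l : ℤ) : ℝ) + l * (dt (toR m) R - c) := by
  have h1 : (l : ℝ) ≠ 0 := by positivity
  have h2 : (N : ℝ) ≠ 0 := by positivity
  unfold yN
  rw [dt_add, dt_smul, dt_smul, dt_smul, dt_toR]
  push_cast
  field_simp
  ring

theorem gen_yN {R : V3} (hR : Gen R) {l : ℕ} (hl : 1 ≤ l) (x : Z3) {N : ℕ} (hN : 1 ≤ N) : Gen (yN R l x N) := by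
  intro m hm c h
  have h1 := dt_yN R hl x m c hN
  rw [h, sub_self, mul_zero] at h1
  have hlm : (l : ℤ) • m ≠ 0 := by
    intro h0; rw [smul_eq_zero] at h0
    rcases h0 with h0 | h0
    · omega
    · exact hm h0
  apply hR ((l : ℤ) • m) hlm (c * l - (N - 1) * (dt m x - c * l))
  rw [toR_smul, smul_dt]
  push_cast at *
  linarith

theorem hcond_ev {R : V3} {l : ℕ} (hl : 1 ≤ l) (x m : Z3) (c : ℤ) :
    ∀ᶠ N : ℕ in Filter.atTop, (hcond R l x m c ↔ (c : ℝ) < dt (toR m) (yN R l x N)) := by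
  set b := dt (toR m) R - c with hb
  have hl' : (0:ℝ) < l := by positivity
  obtain ⟨M, hM⟩ := exists_nat_gt (l * |b| + 1)
  filter_upwards [Filter.eventually_ge_atTop (max M 1)] with N hN
  have hN1 : 1 ≤ N := le_trans (le_max_right _ _) hN
  have hN2 : (M : ℝ) ≤ N := by exact_mod_cast le_trans (le_max_left _ _) hN
  have hN' : (0:ℝ) < N := by positivity
  have h1 := dt_yN R hl x m c hN1
  have h2 : (c : ℝ) < dt (toR m) (yN R l x N) ↔
      0 < ((N : ℝ) - 1) * ((dt m x - c * l : ℤ) : ℝ) + l * (dt (toR m) R - c) := by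
    rw [← h1, mul_pos_iff_of_pos_left (by positivity), sub_pos]
  rw [h2, ← hb]
  unfold hcond
  rw [← hb]
  set a := dt m x - c * l
  have hbb : |(l:ℝ) * b| < N - 1 := by rw [abs_mul, abs_of_pos hl']; linarith
  rw [abs_lt] at hbb
  rcases lt_trichotomy a 0 with h | h | h
  · have ha : (a : ℝ) ≤ -1 := by exact_mod_cast (by omega : a ≤ -1)
    constructor
    · rintro (h' | h')
      · omega
      · omega
    · intro h'
      exfalso
      nlinarith
  · rw [h]
    simp only [lt_irrefl, false_or, true_and, Int.cast_zero, mul_zero, zero_add]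
    rw [mul_pos_iff_of_pos_left hl']
  · have ha : (1 : ℝ) ≤ a := by exact_mod_cast (by omega : 1 ≤ a)
    constructor
    · intro _; nlinarith
    · intro _; left; exact h

theorem tendsto_yN (R : V3) (l : ℕ) (x : Z3) :
    Filter.Tendsto (yN R l x) Filter.atTop (nhds ((1 / (l : ℝ)) • toR x)) := by
  have h := tendsto_one_div_atTop_nhds_zero_nat (𝕜 := ℝ)
  have h1 : Filter.Tendsto (fun N : ℕ => (1 - 1 / (N : ℝ)) • ((1 / (l : ℝ)) • toR x) + (1 / (N : ℝ)) • R)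
    Filter.atTop (nhds ((1 - (0:ℝ)) • ((1 / (l : ℝ)) • toR x) + (0:ℝ) • R)) :=
    ((tendsto_const_nhds.sub h).smul tendsto_const_nhds).add (h.smul tendsto_const_nhds)
  rw [sub_zero, one_smul, zero_smul, add_zero] at h1
  exact h1

theorem mem_ev {P : Set V3} (hc : Convex ℝ P) (hcl : IsClosed P) {R : V3} (hR : R ∈ P) {l : ℕ} (hl : 1 ≤ l)
    (x : Z3) : ∀ᶠ N : ℕ in Filter.atTop, (toR x ∈ (l : ℝ) • P ↔ yN R l x N ∈ P) := by
  have hl' : (l : ℝ) ≠ 0 := by positivity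
  have e : toR x ∈ (l : ℝ) • P ↔ (1 / (l : ℝ)) • toR x ∈ P := by
    rw [Set.mem_smul_set_iff_inv_smul_mem₀ hl', one_div]
  by_cases h : (1 / (l : ℝ)) • toR x ∈ P
  · filter_upwards [Filter.eventually_ge_atTop 1] with N hN
    rw [e]
    have hN' : (1:ℝ) ≤ N := by exact_mod_cast hN
    refine ⟨fun _ => ?_, fun _ => h⟩
    exact hc h hR (by rw [sub_nonneg, div_le_one (by linarith)]; exact hN') (by positivity) (by ring)
  · have := (tendsto_yN R l x).eventually (hcl.isOpen_compl.mem_nhds h)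
    filter_upwards [this] with N hN
    rw [e]
    exact ⟨fun h' => (h h').elim, fun h' => (hN h').elim⟩

variable {P : Set V3} {n : ℕ} {Fc : Fin n → Set V3} {vn : Fin n → Z3} {c : Fin n → ℤ}
  {rk : Fin n → ℕ} {Pt u : Fin n → ℕ → Z3} {e : Fin n → ℕ → ℤ}

/-- Labelled polytope data. -/
structure LD (P : Set V3) (n : ℕ) (Fc : Fin n → Set V3) (vn : Fin n → Z3) (c : Fin n → ℤ)
  (rk : Fin n → ℕ) (Pt u : Fin n → ℕ → Z3) (e : Fin n → ℕ → ℤ) : Prop where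
  G : PD P n Fc vn c
  L : ∀ k, LabD (vn k) (c k) (rk k) (Pt k) (u k) (e k)
  hull : ∀ k, Fc k = convexHull ℝ ((fun i => toR (Pt k i)) '' Set.Icc 1 (rk k))

def TjK (vn : Fin n → Z3) (c : Fin n → ℤ) (Pt u : Fin n → ℕ → Z3) (O : Z3) (y : V3) (k : Fin n) (j : ℕ) : Prop :=
  Tj (pO O (Pt k)) (toR (vn k)) ((c k - dt (vn k) O : ℤ) : ℝ) (sg (vn k) (c k) O (Pt k) (u k) : ℝ) (y - toR O) j

theorem LD.hit_iff (D : LD P n Fc vn c rk Pt u e) (O : Z3) (y : V3) (k : Fin n) :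
    hit Fc (toR O) y k ↔ ∃ t : ℝ, 1 < t ∧ t • (y - toR O) ∈ convexHull ℝ (pO O (Pt k) '' Set.Icc 1 (rk k)) := by
  have h : Fc k = toR O +ᵥ convexHull ℝ (pO O (Pt k) '' Set.Icc 1 (rk k)) := by
    rw [← convexHull_vadd, D.hull]
    congr 1
    ext z
    simp only [Set.mem_image, Set.mem_vadd_set]
    constructor
    · rintro ⟨i, hi, rfl⟩
      exact ⟨_, ⟨i, hi, rfl⟩, by simp [pO]⟩
    · rintro ⟨_, ⟨i, hi, rfl⟩, rfl⟩
      exact ⟨i, hi, by simp [pO]⟩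
  unfold hit
  rw [h]
  have : ∀ t : ℝ, toR O + t • (y - toR O) ∈ toR O +ᵥ convexHull ℝ (pO O (Pt k) '' Set.Icc 1 (rk k)) ↔
      t • (y - toR O) ∈ convexHull ℝ (pO O (Pt k) '' Set.Icc 1 (rk k)) := by
    intro t
    rw [← vadd_eq_add, Set.vadd_mem_vadd_set_iff]
  simp only [this]

theorem gen_tr {O : Z3} {y : V3} (hy : Gen y) {Pt : ℕ → Z3} {a b : ℕ} (h : cr (Pt a - O) (Pt b - O) ≠ 0) :
    tr (pO O Pt a) (pO O Pt b) (y - toR O) ≠ 0 := by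
  unfold tr pO
  rw [← toR_sub, ← toR_sub, ← toR_cr]
  exact hy.ne h O

theorem tr_pO_ne {O : Z3} {Pt : ℕ → Z3} {a b d : ℕ} {s : ℝ} (h : 0 < s * tr (pO O Pt a) (pO O Pt b) (pO O Pt d)) :
    dt (cr (Pt a - O) (Pt b - O)) (Pt d - O) ≠ 0 := by
  intro h0
  rw [tr_pO, h0] at h; simp at h

open Classical in
theorem LD.ident (D : LD P n Fc vn c rk Pt u e) {O : Z3} (hOP : toR O ∉ P) (hO : ∀ k, dt (vn k) O ≠ c k)
    {y : V3} (hy : Gen y) :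
    ∑ k, Int.sign (dt (vn k) O - c k) * ∑ j ∈ Finset.Icc 2 (rk k - 1), (if TjK vn c Pt u O y k j then (1:ℤ) else 0)
      = if y ∈ P then 1 else 0 := by
  rw [← D.G.core hy hOP hO]
  refine Finset.sum_congr rfl fun k _ => ?_
  rw [← Int.sign_eq_sign]
  congr 1
  have F := (D.L k).fan (hO k)
  have hr := F.three
  have := F.count (w := y - toR O) (by
    intro j h1 h2
    apply gen_tr hy
    rcases Nat.eq_or_lt_of_le h2 with h | h
    · have h3 := (cr_ne_of_dt (tr_pO_ne (F.pos1s (j := j - 1) (by omega) (by omega)))).2.2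
      rw [show j - 1 + 1 = j by omega, cr_anti] at h3
      intro h0; exact h3 (by rw [h0]; simp)
    · exact (cr_ne_of_dt (tr_pO_ne (F.pos1s (j := j) h1 (by omega)))).1) (by
    intro j h1 h2
    apply gen_tr hy
    exact (cr_ne_of_dt (tr_pO_ne (F.pos j 2 le_rfl (by omega)))).1)
  unfold TjK
  rw [this]
  simp only [D.hit_iff]

theorem ncard_sum {S : Finset Z3} {p : Z3 → Prop} [DecidablePred p] (h : ∀ x, p x → x ∈ S) :
    (Set.ncard {x | p x} : ℤ) = ∑ x ∈ S, if p x then (1:ℤ) else 0 := by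
  have : {x | p x} = ((S.filter p : Finset Z3) : Set Z3) := by
    ext x; simp; exact fun hx => h x hx
  rw [this, Set.ncard_coe_finset, Finset.card_filter]
  push_cast; rfl

theorem lattice_finite {P : Set V3} (hP : IsCompact P) (l : ℕ) : {x : Z3 | toR x ∈ (l : ℝ) • P}.Finite := by
  obtain ⟨M, hM⟩ := (hP.smul (l : ℝ)).isBounded.exists_norm_le
  apply (Set.finite_Icc (fun _ => -⌈M⌉ : Z3) (fun _ => ⌈M⌉)).subset
  intro x hx
  have h1 := hM _ hx
  have h2 : ∀ i, |(x i : ℝ)| ≤ ⌈M⌉ := fun i => by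
    have := norm_le_pi_norm (toR x) i
    rw [Real.norm_eq_abs] at this
    exact (this.trans h1).trans (Int.le_ceil M)
  constructor
  · intro i; have := (abs_le.1 (h2 i)).1; exact_mod_cast this
  · intro i; have := (abs_le.1 (h2 i)).2; exact_mod_cast this

open Classical in
theorem LD.count (D : LD P n Fc vn c rk Pt u e) {O : Z3} (hOP : toR O ∉ P) (hO : ∀ k, dt (vn k) O ≠ c k)
    {R : V3} (hR : Gen R) (hRP : R ∈ P) :
    ∃ c3 c2 : ℚ, ∀ l : ℕ, 1 ≤ l → (latticeCount P l : ℝ) = c3 * (l : ℝ) ^ 3 + c2 * (l : ℝ) ^ 2 +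
      (∑ k, (dlt (vn k) (Pt k) (u k) : ℝ) * ∑ j ∈ Finset.Icc 2 (rk k - 1),
        thS R (tV O (Pt k) j) (tn (vn k) O (Pt k) j)) * l + 1 := by
  have hex : ∀ k j, ∃ v' c', 2 ≤ j → j + 1 ≤ rk k → TetOK R (vn k) (c k) O (Pt k) (u k) j v' c' := by
    intro k j
    by_cases h : 2 ≤ j ∧ j + 1 ≤ rk k
    · obtain ⟨v', c', h'⟩ := (D.L k).tet (hO k) hR h.1 h.2
      exact ⟨v', c', fun _ _ => h'⟩
    · exact ⟨0, 0, fun h1 h2 => (h ⟨h1, h2⟩).elim⟩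
  choose v' c' hT using hex
  have hT : ∀ k, ∀ j ∈ Finset.Icc 2 (rk k - 1), TetOK R (vn k) (c k) O (Pt k) (u k) j (v' k j) (c' k j) := by
    intro k j hj
    rw [Finset.mem_Icc] at hj
    exact hT k j hj.1 (by omega)
  have hc32 : ∀ k j, ∃ q : ℚ × ℚ, j ∈ Finset.Icc 2 (rk k - 1) → ∀ l : ℕ, 1 ≤ l →
      (NT R (v' k j) (c' k j) l : ℝ) = q.1 * (l : ℝ) ^ 3 + q.2 * (l : ℝ) ^ 2
      + (sg (vn k) (c k) O (Pt k) (u k) * thS R (tV O (Pt k) j) (tn (vn k) O (Pt k) j)) * l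
      + (if TjK vn c Pt u O R k j then 1 else 0) := by
    intro k j
    by_cases h : j ∈ Finset.Icc 2 (rk k - 1)
    · obtain ⟨-, -, -, c3, c2, h'⟩ := hT k j h
      refine ⟨(c3, c2), fun _ l hl => ?_⟩
      rw [h' l hl]; rfl
    · exact ⟨0, fun h' => (h h').elim⟩
  choose q hq using hc32
  -- pointwise identity
  have hpt : ∀ l : ℕ, 1 ≤ l → ∀ x : Z3, (if toR x ∈ (l : ℝ) • P then (1:ℤ) else 0) =
      ∑ k, Int.sign (dt (vn k) O - c k) * ∑ j ∈ Finset.Icc 2 (rk k - 1),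
        (if tcond R (v' k j) (c' k j) l x then (1:ℤ) else 0) := by
    intro l hl x
    have h1 := mem_ev D.G.conv D.G.compact.isClosed hRP hl x
    have h2 : ∀ᶠ N : ℕ in Filter.atTop, ∀ k, ∀ j ∈ Finset.Icc 2 (rk k - 1),
        (tcond R (v' k j) (c' k j) l x ↔ TjK vn c Pt u O (yN R l x N) k j) := by
      rw [Filter.eventually_all]
      intro k
      rw [Filter.eventually_all_finset]
      intro j hj
      have h3 : ∀ᶠ N : ℕ in Filter.atTop, ∀ i, (hcond R l x (v' k j i) (c' k j i) ↔
          (c' k j i : ℝ) < dt (toR (v' k j i)) (yN R l x N)) := by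
        rw [Filter.eventually_all]
        exact fun i => hcond_ev hl x _ _
      filter_upwards [h3] with N hN
      have := (hT k j hj).1 (yN R l x N)
      unfold TjK
      rw [← this]
      exact forall_congr' hN
    obtain ⟨N, hN, hN1, hN2⟩ := (h1.and (h2.and (Filter.eventually_ge_atTop 1))).exists
    have hid := D.ident hOP hO (gen_yN hR hl x hN2)
    simp only [hN]
    rw [← hid]
    refine Finset.sum_congr rfl fun k _ => ?_
    congr 1
    refine Finset.sum_congr rfl fun j hj => ?_
    simp only [hN1 k j hj]
  -- total
  have htot : ∀ l : ℕ, 1 ≤ l → (latticeCount P l : ℤ) =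
      ∑ k, Int.sign (dt (vn k) O - c k) * ∑ j ∈ Finset.Icc 2 (rk k - 1), (NT R (v' k j) (c' k j) l : ℤ) := by
    intro l hl
    set S : Finset Z3 := (lattice_finite D.G.compact l).toFinset ∪
      Finset.univ.biUnion fun k => (Finset.Icc 2 (rk k - 1)).attach.biUnion fun j =>
        ((hT k j.1 j.2).2.1 l).toFinset with hS
    have e1 : (latticeCount P l : ℤ) = ∑ x ∈ S, if toR x ∈ (l : ℝ) • P then (1:ℤ) else 0 := by
      apply ncard_sum
      intro x hx
      rw [hS, Finset.mem_union]; left; simpa using hx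
    have e2 : ∀ k, ∀ j ∈ Finset.Icc 2 (rk k - 1), (NT R (v' k j) (c' k j) l : ℤ) =
        ∑ x ∈ S, if tcond R (v' k j) (c' k j) l x then (1:ℤ) else 0 := by
      intro k j hj
      apply ncard_sum
      intro x hx
      rw [hS, Finset.mem_union]; right
      rw [Finset.mem_biUnion]
      refine ⟨k, Finset.mem_univ _, ?_⟩
      rw [Finset.mem_biUnion]
      exact ⟨⟨j, hj⟩, Finset.mem_attach _ _, by simpa using hx⟩
    rw [e1, Finset.sum_congr rfl fun x _ => hpt l hl x, Finset.sum_comm]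
    refine Finset.sum_congr rfl fun k _ => ?_
    rw [← Finset.mul_sum, Finset.sum_comm]
    congr 1
    exact Finset.sum_congr rfl fun j hj => (e2 k j hj).symm
  refine ⟨∑ k, (Int.sign (dt (vn k) O - c k) : ℚ) * ∑ j ∈ Finset.Icc 2 (rk k - 1), (q k j).1,
    ∑ k, (Int.sign (dt (vn k) O - c k) : ℚ) * ∑ j ∈ Finset.Icc 2 (rk k - 1), (q k j).2, ?_⟩
  intro l hl
  have h1 := htot l hl
  have h2 : (latticeCount P l : ℝ) = ∑ k, (Int.sign (dt (vn k) O - c k) : ℝ) *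
      ∑ j ∈ Finset.Icc 2 (rk k - 1), (NT R (v' k j) (c' k j) l : ℝ) := by exact_mod_cast h1
  have h3 := D.ident hOP hO hR
  rw [if_pos hRP] at h3
  have h4 : (1 : ℝ) = ∑ k, (Int.sign (dt (vn k) O - c k) : ℝ) *
      ∑ j ∈ Finset.Icc 2 (rk k - 1), (if TjK vn c Pt u O R k j then (1:ℝ) else 0) := by
    have := congrArg (fun z : ℤ => (z : ℝ)) h3.symm
    push_cast at this
    exact this
  rw [h2]
  conv_rhs => rw [h4]
  push_cast
  simp only [Finset.sum_mul, ← Finset.sum_add_distrib]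
  refine Finset.sum_congr rfl fun k _ => ?_
  have hd : (dlt (vn k) (Pt k) (u k) : ℝ) = (Int.sign (dt (vn k) O - c k) : ℝ) * sg (vn k) (c k) O (Pt k) (u k) := by
    unfold sg
    rcases int_sign_cases (sub_ne_zero.2 (hO k)) with h | h <;> rw [h] <;> simp
  rw [hd, Finset.sum_congr rfl fun j hj => hq k j hj l hl]
  simp only [Finset.sum_add_distrib, ← Finset.sum_mul, ← Finset.mul_sum]
  ring

end

section

theorem per_ind {Q : ℕ → Prop} {r : ℕ} (hr : 1 ≤ r) (hp : ∀ i, Q (i + r) ↔ Q i)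
    (h : ∀ i ∈ Finset.Icc 1 r, Q i) : ∀ i, Q i := by
  intro i
  induction i using Nat.strong_induction_on with
  | _ i ih =>
    rcases Nat.eq_zero_or_pos i with h0 | h0
    · subst h0
      have := h r (Finset.mem_Icc.2 ⟨hr, le_refl _⟩)
      rw [← hp 0]; simpa using this
    · rcases Nat.lt_or_ge r i with h1 | h1
      · have := ih (i - r) (by omega)
        rw [← hp, Nat.sub_add_cancel h1.le] at this
        exact this
      · exact h i (Finset.mem_Icc.2 ⟨h0, h1⟩)

theorem per_mod {α : Type*} {f : ℕ → α} {r : ℕ} (hp : ∀ i, f (i + r) = f i) {a b : ℕ} (h : a ≡ b [MOD r]) :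
    f a = f b := by
  have h1 : ∀ t i, f (i + t * r) = f i := by
    intro t
    induction t with
    | zero => intro i; simp
    | succ t ih => intro i; rw [Nat.succ_mul, ← add_assoc, hp, ih]
  have h2 : ∀ a, f a = f (a % r) := by
    intro a
    conv_lhs => rw [← Nat.mod_add_div a r, mul_comm]
    rw [h1]
  rw [h2 a, h2 b, h]

theorem per_rep {r : ℕ} (hr : 1 ≤ r) (a : ℕ) : ∃ b ∈ Finset.Icc 1 r, a ≡ b [MOD r] := by
  rcases Nat.eq_zero_or_pos (a % r) with h | h
  · refine ⟨r, Finset.mem_Icc.2 ⟨hr, le_refl _⟩, ?_⟩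
    unfold Nat.ModEq; rw [h, Nat.mod_self]
  · refine ⟨a % r, Finset.mem_Icc.2 ⟨h, (Nat.mod_lt _ hr).le⟩, ?_⟩
    exact (Nat.mod_modEq _ _).symm

theorem inward_unique {P F : Set V3} (hfull : affineSpan ℝ P = ⊤) (hF : IsFacetOf P F) {v v' : Z3}
    (hv : IsInwardNormal P F v) (hv' : IsInwardNormal P F v') : v = v' := by
  obtain ⟨hf, hdim⟩ := hF
  obtain ⟨hne, w, rfl⟩ := isFaceOf_iff.1 hf
  obtain ⟨t, ht, hw⟩ := normal_of_face hfull hne hdim hv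
  obtain ⟨s, hs, hw'⟩ := normal_of_face hfull hne hdim hv'
  have e : t • toR v = s • toR v' := by rw [← hw, ← hw']
  have e2 : toR v' = (t / s) • toR v := by
    rw [div_eq_inv_mul, mul_smul, e, smul_smul, inv_mul_cancel₀ hs.ne, one_smul]
  have hpos : 0 < t / s := div_pos_of_neg_of_neg ht hs
  have hc : cr v v' = 0 := by
    apply toR_inj
    rw [toR_cr, e2, cr_smul_right]
    funext i
    fin_cases i <;> simp [cr, toR] <;> ring_nf <;> simp
  rcases prim_eq_or_neg hv.1 hv'.1 hc with h | h
  · exact h.symm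
  · exfalso
    rw [h, toR_neg] at e2
    have h3 := congrArg (fun z => dt (toR v) z) e2
    beta_reduce at h3
    rw [dt_neg, dt_smul] at h3
    have := dt_self_pos (toR_ne (prim_ne_zero hv.1))
    nlinarith [mul_pos hpos this]

theorem vertex_extreme {P : Set V3} {x : V3} (h : IsVertexOf P x) : x ∈ P.extremePoints ℝ := by
  obtain ⟨_, w, hw⟩ := isFaceOf_iff.1 h
  have hx : x ∈ mface P w := by rw [← hw]; rfl
  rw [mem_extremePoints]
  refine ⟨hx.1, ?_⟩
  rintro y hy z hz ⟨a, b, ha, hb, hab, rfl⟩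
  have h1 := hx.2 y hy
  have h2 := hx.2 z hz
  have e : dt w (a • y + b • z) = a * dt w y + b * dt w z := by rw [dt_add, dt_smul, dt_smul]
  have h3 : dt w y = dt w (a • y + b • z) := by
    apply le_antisymm h1
    apply le_of_mul_le_mul_left _ ha
    have := mul_le_mul_of_nonneg_left h2 hb.le
    have e2 : a * dt w (a • y + b • z) + b * dt w (a • y + b • z) = dt w (a • y + b • z) := by
      rw [← add_mul, hab, one_mul]
    linarith
  have h4 : dt w z = dt w (a • y + b • z) := by
    apply le_antisymm h2
    apply le_of_mul_le_mul_left _ hb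
    have := mul_le_mul_of_nonneg_left h1 ha.le
    have e2 : a * dt w (a • y + b • z) + b * dt w (a • y + b • z) = dt w (a • y + b • z) := by
      rw [← add_mul, hab, one_mul]
    linarith
  constructor
  · have : y ∈ mface P w := ⟨hy, fun q hq => by rw [h3]; exact hx.2 q hq⟩
    rw [← hw] at this; exact this
  · have : z ∈ mface P w := ⟨hz, fun q hq => by rw [h4]; exact hx.2 q hq⟩
    rw [← hw] at this; exact this

theorem vertex_seg {P : Set V3} {x y z : V3} (h : IsVertexOf P x) (hy : y ∈ P) (hz : z ∈ P)
    (hs : x ∈ segment ℝ y z) : x = y ∨ x = z := by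
  have := (mem_extremePoints_iff_forall_segment.1 (vertex_extreme h)).2 y hy z hz hs
  tauto

theorem vertex_hull {P S : Set V3} {x : V3} (h : IsVertexOf P x) (hS : convexHull ℝ S ⊆ P)
    (hx : x ∈ convexHull ℝ S) : x ∈ S := by
  have := inter_extremePoints_subset_extremePoints_of_subset (𝕜 := ℝ) hS ⟨hx, vertex_extreme h⟩
  exact extremePoints_convexHull_subset this

/-- full combinatorial data -/
structure FD (P : Set V3) (n : ℕ) (Fc : Fin n → Set V3) (vn : Fin n → Z3) (c : Fin n → ℤ)
    (rk : Fin n → ℕ) (Pt : Fin n → ℕ → Z3) (idx : Fin n → ℕ → Fin n) (Q : Fin n → ℕ → V3) : Prop where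
  G : PD P n Fc vn c
  facet : ∀ k, IsFacetOf P (Fc k)
  allF : ∀ S, IsFacetOf P S → ∃ k, S = Fc k
  simple : IsSimple P
  three : ∀ k, 3 ≤ rk k
  per : ∀ k i, Pt k (i + rk k) = Pt k i
  idxper : ∀ k i, idx k (i + rk k) = idx k i
  inj : ∀ k a b, Pt k a = Pt k b → a ≡ b [MOD rk k]
  vert : ∀ k i, IsVertexOf P (toR (Pt k i))
  hull : ∀ k, Fc k = convexHull ℝ ((fun i => toR (Pt k i)) '' Set.Icc 1 (rk k))
  meet : ∀ k i, Fc k ∩ Fc (idx k (i + 1)) = segment ℝ (toR (Pt k i)) (toR (Pt k (i + 1)))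
  Qe : ∀ k i, IsEdgeOf P (segment ℝ (toR (Pt k i)) (Q k i)) ∧ Q k i ∉ Fc k ∧ Q k i ≠ toR (Pt k i)

theorem build_FD
    (Vs : Finset (Fin 3 → ℤ)) 
    (P : Set (Fin 3 → ℝ)) (hP : P = convexHull ℝ (toR '' (Vs : Set (Fin 3 → ℤ))))
    (hfull : affineSpan ℝ P = ⊤) (hsimple : IsSimple P)
    (n : ℕ) (Fc : Fin n → Set (Fin 3 → ℝ))
    (hFc_inj : Function.Injective Fc)
    (hFc : ∀ k, IsFacetOf P (Fc k)) (hFc_all : ∀ S, IsFacetOf P S → ∃ k, S = Fc k)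
    (vn : Fin n → Fin 3 → ℤ) (hvn : ∀ k, IsInwardNormal P (Fc k) (vn k))
    (rk : Fin n → ℕ) (Pt : (k : Fin n) → ℕ → Fin 3 → ℤ)
    (Fk : (k : Fin n) → ℕ → Set (Fin 3 → ℝ)) (vk : (k : Fin n) → ℕ → Fin 3 → ℤ)
    (Q : (k : Fin n) → ℕ → Fin 3 → ℝ)
    (hlab : ∀ k, FacetLabeling P (Fc k) (vn k) (rk k) (Pt k) (Fk k) (vk k) (Q k)) :
    ∃ (c : Fin n → ℤ) (idx : Fin n → ℕ → Fin n), FD P n Fc vn c rk Pt idx Q ∧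
      ∀ k i, vk k i = vn (idx k i) := by
  have h1r : ∀ k, 1 ≤ rk k := fun k => by have := (hlab k).three_le; omega
  have hPt1 : ∀ k, toR (Pt k 1) ∈ Fc k := by
    intro k
    rw [(hlab k).F_eq_hull]
    exact subset_convexHull ℝ _ ⟨1, ⟨le_refl _, h1r k⟩, rfl⟩
  have hfk : ∀ k i, IsFacetOf P (Fk k i) := fun k =>
    per_ind (h1r k) (fun i => by rw [(hlab k).Fk_periodic]) (hlab k).Fk_facet
  choose idx hidx using fun k i => hFc_all _ (hfk k i)
  have hvk : ∀ k i, IsInwardNormal P (Fk k i) (vk k i) := fun k =>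
    per_ind (h1r k) (fun i => by rw [(hlab k).Fk_periodic, (hlab k).vk_periodic]) (hlab k).vk_normal
  refine ⟨fun k => dt (vn k) (Pt k 1), idx, ?_, ?_⟩
  swap
  · intro k i
    have h := hvk k i
    rw [hidx] at h
    exact inward_unique hfull (hFc _) h (hvn _)
  refine ⟨⟨⟨Vs, hP⟩, hfull, fun k => (hvn k).1, fun k => (facet_desc hfull (hFc k) (hvn k) (hPt1 k)).1,
    fun k => (facet_desc hfull (hFc k) (hvn k) (hPt1 k)).2, ?_, hFc_inj, fun k => ⟨_, hPt1 k⟩⟩, hFc, hFc_all, hsimple,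
    fun k => (hlab k).three_le, fun k => (hlab k).Pt_periodic, ?_, ?_, ?_, fun k => (hlab k).F_eq_hull, ?_, ?_⟩
  · intro w hw
    obtain ⟨k, hk⟩ := hFc_all _ hw
    have h2 := hvn k
    rw [← hk] at h2
    exact ⟨k, hk, normal_of_face hfull hw.1.1 hw.2 h2⟩
  · intro k i
    apply hFc_inj
    rw [← hidx, ← hidx, (hlab k).Fk_periodic]
  · intro k a b hab
    obtain ⟨a', ha', ea⟩ := per_rep (h1r k) a
    obtain ⟨b', hb', eb⟩ := per_rep (h1r k) b
    rw [per_mod (hlab k).Pt_periodic ea, per_mod (hlab k).Pt_periodic eb] at hab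
    have := (hlab k).Pt_injOn a' ha' b' hb' hab
    subst this
    exact ea.trans eb.symm
  · intro k
    exact per_ind (h1r k) (fun i => by rw [(hlab k).Pt_periodic]) (hlab k).Pt_vertex
  · intro k i
    have h3 := (hlab k).three_le
    have key : ∀ i, Fc k ∩ Fk k i = segment ℝ (toR (Pt k (i + rk k - 1))) (toR (Pt k i)) := by
      refine per_ind (h1r k) (fun i => ?_) ?_
      · rw [(hlab k).Fk_periodic, (hlab k).Pt_periodic, show i + rk k + rk k - 1 = (i + rk k - 1) + rk k by omega,
          (hlab k).Pt_periodic]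
      · intro i hi
        have h1 := (Finset.mem_Icc.1 hi).1
        rw [(hlab k).Fk_meets_F i hi, show i + rk k - 1 = (i - 1) + rk k by omega, (hlab k).Pt_periodic]
    rw [← hidx, key, show i + 1 + rk k - 1 = i + rk k by omega, (hlab k).Pt_periodic]
  · intro k
    exact per_ind (h1r k) (fun i => by rw [(hlab k).Pt_periodic, (hlab k).Q_periodic]) (hlab k).Q_edge

variable {P : Set V3} {n : ℕ} {Fc : Fin n → Set V3} {vn : Fin n → Z3} {c : Fin n → ℤ}
   {rk : Fin n → ℕ} {Pt : Fin n → ℕ → Z3} {idx : Fin n → ℕ → Fin n} {Q : Fin n → ℕ → V3}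

theorem FD.memF (D : FD P n Fc vn c rk Pt idx Q) (k i) : toR (Pt k i) ∈ Fc k := by
  have h1 : 1 ≤ rk k := by have := D.three k; omega
  revert i
  refine per_ind h1 (fun i => by rw [D.per]) ?_
  intro i hi
  rw [D.hull]
  exact subset_convexHull ℝ _ ⟨i, by simpa using hi, rfl⟩

theorem FD.memP (D : FD P n Fc vn c rk Pt idx Q) (k i) : toR (Pt k i) ∈ P := by
  have := D.memF k i
  rw [D.G.desc] at this; exact this.1

theorem FD.val (D : FD P n Fc vn c rk Pt idx Q) {k} {X : Z3} (h : toR X ∈ Fc k) : dt (vn k) X = c k := by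
  rw [D.G.desc] at h
  have := h.2
  rw [dt_toR] at this
  exact_mod_cast this

theorem FD.mem1 (D : FD P n Fc vn c rk Pt idx Q) (k i) : toR (Pt k i) ∈ Fc (idx k (i + 1)) := by
  have : toR (Pt k i) ∈ Fc k ∩ Fc (idx k (i + 1)) := by rw [D.meet]; exact left_mem_segment _ _ _
  exact this.2

theorem FD.mem2 (D : FD P n Fc vn c rk Pt idx Q) (k i) : toR (Pt k (i + 1)) ∈ Fc (idx k (i + 1)) := by
  have : toR (Pt k (i + 1)) ∈ Fc k ∩ Fc (idx k (i + 1)) := by rw [D.meet]; exact right_mem_segment _ _ _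
  exact this.2

theorem FD.toLD (D : FD P n Fc vn c rk Pt idx Q) :
    LD P n Fc vn c rk Pt (fun k i => vn (idx k i)) (fun k i => c (idx k i)) := by
  refine ⟨D.G, fun k => ⟨D.three k, D.G.prim k, D.per k, fun i => D.val (D.memF k i), fun i => D.val (D.mem1 k i),
    fun i => D.val (D.mem2 k i), ?_⟩, D.hull⟩
  intro i m hm hmr
  have hP := D.memP k (i + m)
  have h1 := D.G.ge (idx k (i + 1)) _ hP
  rw [dt_toR] at h1
  refine lt_of_le_of_ne (by exact_mod_cast h1) ?_
  intro he
  have h2 : toR (Pt k (i + m)) ∈ Fc k ∩ Fc (idx k (i + 1)) := by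
    refine ⟨D.memF k _, ?_⟩
    rw [D.G.desc]
    exact ⟨hP, by rw [dt_toR, he]⟩
  rw [D.meet] at h2
  rcases vertex_seg (D.vert k _) (D.memP k _) (D.memP k _) h2 with h | h
  · have := D.inj k _ _ (toR_inj h)
    have h3 : m ≡ 0 [MOD rk k] := Nat.ModEq.add_left_cancel' i (by simpa using this)
    have := (Nat.modEq_zero_iff_dvd.1 h3)
    have := Nat.le_of_dvd (by omega) this
    omega
  · have := D.inj k _ _ (toR_inj h)
    have h3 : m ≡ 1 [MOD rk k] := Nat.ModEq.add_left_cancel' i this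
    unfold Nat.ModEq at h3
    rw [Nat.mod_eq_of_lt (by omega), Nat.mod_eq_of_lt (by omega)] at h3
    omega

end

section

theorem exists_ref (O X : Z3) : ∃ n : Z3, IsPrimitive n ∧ dt n O = dt n X := by
  obtain ⟨n, hn, h1, _⟩ := exists_perp (X - O) (X - O)
  refine ⟨prm n, prm_prim hn, ?_⟩
  have h2 := prm_spec n
  have h3 := dt_prm n (X - O)
  rw [h1, dt_sub] at h3
  have hg : (gcd3 n : ℤ) ≠ 0 := by
    intro h0; rw [h0, zero_smul] at h2; exact hn h2
  rcases mul_eq_zero.1 h3.symm with h | h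
  · exact absurd h hg
  · linarith

def refv (O X : Z3) : Z3 := Classical.choose (exists_ref O X)
theorem refv_prim (O X : Z3) : IsPrimitive (refv O X) := (Classical.choose_spec (exists_ref O X)).1
theorem refv_perp (O X : Z3) : dt (refv O X) O = dt (refv O X) X := (Classical.choose_spec (exists_ref O X)).2

def gX (R : V3) (O X a : Z3) : ℝ := Th R O X (refv O X) a

theorem gX_diff {R : V3} (hR : Gen R) {O X a b : Z3} (hX : O ≠ X) (pa : IsPrimitive a) (pb : IsPrimitive b)
    (ha : dt a O = dt a X) (hb : dt b O = dt b X) : Th R O X a b = gX R O X b - gX R O X a := by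
  have h := cocycle hR hX (refv_prim O X) pa pb (refv_perp O X) ha hb
  rw [Th_anti (refv_prim O X) pb] at h
  unfold gX; linarith

theorem gX_neg {R : V3} (hR : Gen R) {O X a : Z3} (pa : IsPrimitive a) : gX R O X (-a) = gX R O X a :=
  Th_neg_right hR (refv_prim O X) pa

def Wk (R : V3) (O v Y Z : Z3) : ℝ := Th R Y Z v (Nn O Y Z) + gX R O Y (Nn O Y Z) - gX R O Z (Nn O Y Z)

theorem Nn_ne {O v Y Z : Z3} (h : dt v Y = dt v Z) (hO : dt v Y ≠ dt v O) (hYZ : Y ≠ Z) :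
    cr (Y - O) (Z - O) ≠ 0 := by
  intro h0
  have h1 := cr_cr v (Y - O) (Z - O)
  rw [h0] at h1
  rw [dt_sub, dt_sub, ← h, ← smul_sub] at h1
  have h2 : cr v 0 = 0 := by apply vec_ext <;> simp
  rw [h2] at h1
  rcases smul_eq_zero.1 h1.symm with h3 | h3
  · exact hO (by linarith)
  · apply hYZ
    have : Y - Z = 0 := by rw [← h3]; abel
    exact sub_eq_zero.1 this

theorem Nn_prim {O v Y Z : Z3} (h : dt v Y = dt v Z) (hO : dt v Y ≠ dt v O) (hYZ : Y ≠ Z) : IsPrimitive (Nn O Y Z) :=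
  prm_prim (Nn_ne h hO hYZ)

theorem Nn_anti (O Y Z : Z3) : Nn O Z Y = - Nn O Y Z := by
  unfold Nn; rw [cr_anti, prm_neg]

theorem Wk_anti {R : V3} (hR : Gen R) {O v Y Z : Z3} (pv : IsPrimitive v) (h : dt v Y = dt v Z)
    (hO : dt v Y ≠ dt v O) (hYZ : Y ≠ Z) : Wk R O v Z Y = - Wk R O v Y Z := by
  have pN := Nn_prim h hO hYZ
  have hp := prm_perp (O := O) (Y := Y) (Z := Z)
  unfold Wk
  rw [Nn_anti O Y Z, gX_neg hR pN, gX_neg hR pN, Th_neg_right hR pv pN, Th_swap h (hp.1.trans hp.2.symm)]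
  ring

theorem off_ne {O v Y : Z3} (hO : dt v Y ≠ dt v O) : O ≠ Y := by rintro rfl; exact hO rfl

theorem thS_W {R : V3} (hR : Gen R) {O v X Y Z : Z3} (h1 : dt v X = dt v Y)
    (h2 : dt v Y = dt v Z) (hO : dt v X ≠ dt v O) (hXY : X ≠ Y) (hYZ : Y ≠ Z) (hZX : Z ≠ X) :
    thS R ![O, X, Y, Z] ![v, Nn O Y Z, Nn O Z X, Nn O X Y] = Wk R O v X Y + Wk R O v Y Z + Wk R O v Z X := by
  have hOY : dt v Y ≠ dt v O := by rw [← h1]; exact hO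
  have hOZ : dt v Z ≠ dt v O := by rw [← h2]; exact hOY
  have p1 := Nn_prim h1 hO hXY
  have p2 := Nn_prim h2 hOY hYZ
  have p3 := Nn_prim (h2.symm.trans h1.symm) hOZ hZX
  have q1 := prm_perp (O := O) (Y := X) (Z := Y)
  have q2 := prm_perp (O := O) (Y := Y) (Z := Z)
  have q3 := prm_perp (O := O) (Y := Z) (Z := X)
  unfold thS Wk
  simp only [Matrix.cons_val]
  rw [gX_diff hR (off_ne hO) p3 p1 q3.2.symm q1.1.symm, gX_diff hR (off_ne hOY) p1 p2 q1.2.symm q2.1.symm,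
    gX_diff hR (off_ne hOZ) p2 p3 q2.2.symm q3.1.symm]
  ring

theorem fan_tele (W : ℕ → ℕ → ℝ) (r : ℕ) (hr : 3 ≤ r)
    (ha : ∀ i, 2 ≤ i → i ≤ r → W i 1 = - W 1 i) (h0 : W 0 1 = W r 1) :
    ∑ j ∈ Finset.Icc 2 (r - 1), (W 1 j + W j (j + 1) + W (j + 1) 1) = ∑ i ∈ Finset.range r, W i (i + 1) := by
  have key : ∀ s, 2 ≤ s → s ≤ r - 1 → ∑ j ∈ Finset.Icc 2 s, (W 1 j + W j (j + 1) + W (j + 1) 1)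
      = (∑ i ∈ Finset.range s, W (i + 1) (i + 2)) + W (s + 1) 1 := by
    intro s hs
    induction s, hs using Nat.le_induction with
    | base => intro _; simp [Finset.sum_range_succ]
    | succ s hs ih =>
      intro h
      rw [Finset.sum_Icc_succ_top (by omega), ih (by omega), Finset.sum_range_succ, ha (s + 1) (by omega) (by omega)]
      ring
  rw [key (r - 1) (by omega) le_rfl]
  obtain ⟨t, rfl⟩ : ∃ t, r = t + 1 := ⟨r - 1, by omega⟩
  rw [Finset.sum_range_succ' _ t, zero_add, h0]
  rfl

variable {P : Set V3} {n : ℕ} {Fc : Fin n → Set V3} {vn : Fin n → Z3} {c : Fin n → ℤ}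
   {rk : Fin n → ℕ} {Pt : Fin n → ℕ → Z3} {idx : Fin n → ℕ → Fin n} {Q : Fin n → ℕ → V3}

theorem FD.pt_ne (D : FD P n Fc vn c rk Pt idx Q) (k : Fin n) {a b : ℕ} (h : ¬ a ≡ b [MOD rk k]) : Pt k a ≠ Pt k b :=
  fun h' => h (D.inj k a b h')

theorem FD.pt_ne_lt (D : FD P n Fc vn c rk Pt idx Q) (k : Fin n) {a b : ℕ} (h : a < b) (h' : b < a + rk k) :
    Pt k a ≠ Pt k b := by
  apply D.pt_ne
  intro h1
  have := (Nat.modEq_iff_dvd' h.le).1 h1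
  have := Nat.le_of_dvd (by omega) this
  omega

theorem FD.fan_sum (D : FD P n Fc vn c rk Pt idx Q) {R : V3} (hR : Gen R) {O : Z3} (hO : ∀ k, dt (vn k) O ≠ c k)
    (k : Fin n) :
    ∑ j ∈ Finset.Icc 2 (rk k - 1), thS R (tV O (Pt k) j) (tn (vn k) O (Pt k) j) =
      ∑ i ∈ Finset.range (rk k), Wk R O (vn k) (Pt k i) (Pt k (i + 1)) := by
  have h3 := D.three k
  have hv : ∀ i, dt (vn k) (Pt k i) = c k := fun i => D.val (D.memF k i)
  have hOi : ∀ i, dt (vn k) (Pt k i) ≠ dt (vn k) O := fun i => by rw [hv]; exact (hO k).symm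
  rw [← fan_tele (fun a b => Wk R O (vn k) (Pt k a) (Pt k b)) (rk k) h3]
  · refine Finset.sum_congr rfl fun j hj => ?_
    rw [Finset.mem_Icc] at hj
    exact thS_W hR (by rw [hv, hv]) (by rw [hv, hv]) (hOi _) (D.pt_ne_lt k (by omega) (by omega))
      (D.pt_ne_lt k (by omega) (by omega)) (D.pt_ne_lt k (by omega) (by omega)).symm
  · intro i h1 h2
    exact Wk_anti hR (D.G.prim k) (by rw [hv, hv]) (hOi _) (D.pt_ne_lt k (by omega) (by omega))
  · have := D.per k 0
    rw [zero_add] at this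
    beta_reduce
    rw [this]

def Phi (R : V3) (O : Z3) (vn : Fin n → Z3) (a b : Fin n) (Y Z : Z3) : ℝ :=
  ((Int.sign (dt (cr (vn a) (vn b)) (Z - Y)) : ℤ) : ℝ) * Wk R O (vn a) Y Z

theorem Phi_symm {R : V3} (hR : Gen R) {O : Z3} {a b : Fin n} {Y Z : Z3} (pv : IsPrimitive (vn a))
    (h : dt (vn a) Y = dt (vn a) Z)
    (hO : dt (vn a) Y ≠ dt (vn a) O) (hYZ : Y ≠ Z) : Phi R O vn a b Z Y = Phi R O vn a b Y Z := by
  unfold Phi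
  rw [Wk_anti hR pv h hO hYZ, show Y - Z = -(Z - Y) by abel, dt_neg, Int.sign_neg]; push_cast; ring

theorem Phi_pair {R : V3} (hR : Gen R) {O : Z3} {a b : Fin n} {Y Z : Z3} (pa : IsPrimitive (vn a))
    (pb : IsPrimitive (vn b)) (h : dt (vn a) Y = dt (vn a) Z) (h' : dt (vn b) Y = dt (vn b) Z)
    (hO : dt (vn a) Y ≠ dt (vn a) O) (hYZ : Y ≠ Z)
    (hc : cr (vn a) (vn b) ≠ 0) :
    Phi R O vn a b Y Z + Phi R O vn b a Y Z = Mv R Y Z (vn a) (vn b) := by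
  have pN := Nn_prim h hO hYZ
  have hp := prm_perp (O := O) (Y := Y) (Z := Z)
  have hcc := cocycle hR hYZ pa pb pN h h' (hp.1.trans hp.2.symm)
  rw [Th_anti pa pN] at hcc
  have hs : dt (cr (vn a) (vn b)) (Z - Y) ≠ 0 := by
    refine cr_ne_dt (sub_ne_zero.2 hYZ.symm) ?_ ?_ hc
    · rw [dt_sub]; linarith
    · rw [dt_sub]; linarith
  unfold Phi Wk
  have e1 : dt (cr (vn b) (vn a)) (Z - Y) = - dt (cr (vn a) (vn b)) (Z - Y) := by rw [cr_anti, neg_dt]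
  rw [e1, Int.sign_neg]
  have e2 : Th R Y Z (vn a) (vn b) = ((Int.sign (dt (cr (vn a) (vn b)) (Z - Y)) : ℤ) : ℝ) * Mv R Y Z (vn a) (vn b) := rfl
  rcases int_sign_cases hs with h | h <;> rw [h] at e2 ⊢ <;> push_cast at e2 ⊢ <;> linarith

theorem FD.dlt_sum (D : FD P n Fc vn c rk Pt idx Q) {R : V3} (hR : Gen R) {O : Z3} (hO : ∀ k, dt (vn k) O ≠ c k)
    (k : Fin n) :
    (dlt (vn k) (Pt k) (fun i => vn (idx k i)) : ℝ) *
      ∑ j ∈ Finset.Icc 2 (rk k - 1), thS R (tV O (Pt k) j) (tn (vn k) O (Pt k) j) =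
      ∑ i ∈ Finset.range (rk k), Phi R O vn k (idx k (i + 1)) (Pt k i) (Pt k (i + 1)) := by
  rw [D.fan_sum hR hO, Finset.mul_sum]
  refine Finset.sum_congr rfl fun i _ => ?_
  rw [← (D.toLD.L k).edD_const i]
  rfl

end

section

variable {P : Set V3} {n : ℕ} {Fc : Fin n → Set V3} {vn : Fin n → Z3} {c : Fin n → ℤ}
   {rk : Fin n → ℕ} {Pt : Fin n → ℕ → Z3} {idx : Fin n → ℕ → Fin n} {Q : Fin n → ℕ → V3}

theorem FD.notmem (D : FD P n Fc vn c rk Pt idx Q) (k i) {m : ℕ} (h1 : 2 ≤ m) (h2 : m + 1 ≤ rk k) :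
    toR (Pt k (i + m)) ∉ Fc (idx k (i + 1)) := by
  intro h
  have h3 := (D.toLD.L k).pos i m h1 h2
  have h4 := D.val h
  beta_reduce at h3
  omega

theorem FD.idx_ne (D : FD P n Fc vn c rk Pt idx Q) (k i) : idx k (i + 1) ≠ k := by
  intro h
  have := D.notmem k i (m := 2) le_rfl (D.three k)
  rw [h] at this
  exact this (D.memF k _)

theorem FD.idx_succ_ne (D : FD P n Fc vn c rk Pt idx Q) (k i) : idx k (i + 1) ≠ idx k (i + 2) := by
  intro h
  have := D.notmem k i (m := 2) le_rfl (D.three k)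
  rw [h] at this
  exact this (D.mem2 k (i + 1))

theorem FD.three_facets (D : FD P n Fc vn c rk Pt idx Q) (k i) {k' : Fin n} (h : toR (Pt k (i + 1)) ∈ Fc k') :
    k' = k ∨ k' = idx k (i + 1) ∨ k' = idx k (i + 2) := by
  have hs := D.simple _ (D.vert k (i + 1))
  set S : Set (Set V3) := {F : Set V3 | IsFacetOf P F ∧ toR (Pt k (i + 1)) ∈ F} with hS
  have hfin : S.Finite := Set.finite_of_ncard_ne_zero (by rw [hs]; norm_num)
  have hsub : ({Fc k, Fc (idx k (i + 1)), Fc (idx k (i + 2))} : Set (Set V3)) ⊆ S := by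
    rintro F (rfl | rfl | rfl)
    · exact ⟨D.facet _, D.memF k _⟩
    · exact ⟨D.facet _, D.mem2 k _⟩
    · exact ⟨D.facet _, D.mem1 k (i + 1)⟩
  have hc : ({Fc k, Fc (idx k (i + 1)), Fc (idx k (i + 2))} : Set (Set V3)).ncard = 3 := by
    rw [Set.ncard_eq_three]
    exact ⟨_, _, _, fun h => D.idx_ne k i (D.G.inj h).symm, fun h => D.idx_ne k (i + 1) (D.G.inj h).symm,
      fun h => D.idx_succ_ne k i (D.G.inj h), rfl⟩
  have he := Set.eq_of_subset_of_ncard_le hsub (by rw [hs, hc]) hfin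
  have hm : Fc k' ∈ S := ⟨D.facet _, h⟩
  rw [← he] at hm
  rcases hm with h | h | h
  · exact Or.inl (D.G.inj h)
  · exact Or.inr (Or.inl (D.G.inj h))
  · exact Or.inr (Or.inr (D.G.inj h))

theorem FD.two_facets (D : FD P n Fc vn c rk Pt idx Q) (k i) {k' : Fin n} (h : toR (Pt k i) ∈ Fc k')
    (h' : toR (Pt k (i + 1)) ∈ Fc k') : k' = k ∨ k' = idx k (i + 1) := by
  have h3 := D.three k
  rcases D.three_facets k i h' with h1 | h1 | h1
  · exact Or.inl h1
  · exact Or.inr h1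
  · exfalso
    have := D.notmem k (i + 1) (m := rk k - 1) (by omega) (by omega)
    rw [show i + 1 + (rk k - 1) = i + rk k by omega, D.per, ← h1] at this
    exact this h

theorem seg_dim {x y : V3} (h : x ≠ y) : faceDim (segment ℝ x y) = 1 := by
  unfold faceDim
  rw [vectorSpan_segment]
  apply finrank_span_singleton
  rw [vsub_eq_sub]
  exact sub_ne_zero.2 h.symm

theorem FD.inter_edge (D : FD P n Fc vn c rk Pt idx Q) {k k' : Fin n} {x y : V3} (hxy : x ≠ y)
    (h : Fc k ∩ Fc k' = segment ℝ x y) : IsEdgeOf P (Fc k ∩ Fc k') := by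
  refine ⟨?_, by rw [h]; exact seg_dim hxy⟩
  rw [isFaceOf_iff]
  have hx : x ∈ Fc k ∩ Fc k' := by rw [h]; exact left_mem_segment _ _ _
  refine ⟨⟨x, hx⟩, -(toR (vn k) + toR (vn k')), ?_⟩
  have e : ∀ z, dt (-(toR (vn k) + toR (vn k'))) z = - (dt (toR (vn k)) z + dt (toR (vn k')) z) := by
    intro z; rw [neg_dt, add_dt]
  have hx' := hx
  rw [D.G.desc k, D.G.desc k'] at hx'
  ext z
  unfold mface
  rw [D.G.desc k, D.G.desc k']
  constructor
  · rintro ⟨⟨hz, h1⟩, ⟨_, h2⟩⟩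
    refine ⟨hz, fun y hy => ?_⟩
    rw [e, e, h1, h2]
    have := D.G.ge k y hy
    have := D.G.ge k' y hy
    linarith
  · rintro ⟨hz, hm⟩
    have h1 := hm x hx'.1.1
    rw [e, e, hx'.1.2, hx'.2.2] at h1
    have h2 := D.G.ge k z hz
    have h3 := D.G.ge k' z hz
    exact ⟨⟨hz, by linarith⟩, ⟨hz, by linarith⟩⟩

theorem FD.exists_idx (D : FD P n Fc vn c rk Pt idx Q) {k k' : Fin n} (hk : k ≠ k') {x : V3}
    (hx : x ∈ Fc k) (hx' : x ∈ Fc k') : ∃ i < rk k, idx k (i + 1) = k' := by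
  have h3 := D.three k
  have h1 : ∃ i, toR (Pt k (i + 1)) ∈ Fc k' := by
    by_contra hcon
    push Not at hcon
    have hsub : Fc k ⊆ {y : V3 | (c k' : ℝ) < dt (toR (vn k')) y} := by
      rw [D.hull k]
      apply convexHull_min
      · rintro _ ⟨i, hi, rfl⟩
        have hi1 := hi.1
        have := hcon (i - 1)
        rw [show i - 1 + 1 = i by omega, D.G.desc] at this
        have hg := D.G.ge k' _ (D.memP k i)
        refine lt_of_le_of_ne hg fun he => this ⟨D.memP k i, he.symm⟩
      · intro y hy z hz a b ha hb hab
        rw [Set.mem_ofPred_eq] at *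
        rw [dt_add, dt_smul, dt_smul]
        rcases eq_or_lt_of_le ha with h | h
        · subst h; rw [zero_add] at hab; subst hab; simpa using hz
        · have : (c k' : ℝ) = a * c k' + b * c k' := by rw [← add_mul, hab, one_mul]
          rw [this]
          have := mul_lt_mul_of_pos_left hy h
          have := mul_le_mul_of_nonneg_left hz.le hb
          linarith
    have := hsub hx
    rw [D.G.desc] at hx'
    rw [Set.mem_ofPred_eq, hx'.2] at this
    exact lt_irrefl _ this
  obtain ⟨i, hi⟩ := h1
  have h2 : ∃ i, idx k (i + 1) = k' := by
    rcases D.three_facets k i hi with h | h | h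
    · exact absurd h.symm hk
    · exact ⟨i, h.symm⟩
    · exact ⟨i + 1, h.symm⟩
  obtain ⟨i, hi⟩ := h2
  refine ⟨i % rk k, Nat.mod_lt _ (by omega), ?_⟩
  rw [← hi]
  apply per_mod (D.idxper k)
  exact (Nat.mod_modEq i _).add_right 1

theorem FD.ends (D : FD P n Fc vn c rk Pt idx Q) {k : Fin n} {i : ℕ} {X Y : Z3}
    (h : Fc k ∩ Fc (idx k (i + 1)) = segment ℝ (toR X) (toR Y)) :
    (Pt k i = X ∧ Pt k (i + 1) = Y) ∨ (Pt k i = Y ∧ Pt k (i + 1) = X) := by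
  have h3 := D.three k
  have hX : toR X ∈ P := by
    have : toR X ∈ Fc k ∩ Fc (idx k (i + 1)) := by rw [h]; exact left_mem_segment _ _ _
    have := this.1
    rw [D.G.desc] at this; exact this.1
  have hY : toR Y ∈ P := by
    have : toR Y ∈ Fc k ∩ Fc (idx k (i + 1)) := by rw [h]; exact right_mem_segment _ _ _
    have := this.1
    rw [D.G.desc] at this; exact this.1
  have h1 : toR (Pt k i) ∈ segment ℝ (toR X) (toR Y) := by rw [← h]; exact ⟨D.memF _ _, D.mem1 _ _⟩
  have h2 : toR (Pt k (i + 1)) ∈ segment ℝ (toR X) (toR Y) := by rw [← h]; exact ⟨D.memF _ _, D.mem2 _ _⟩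
  have hne := D.pt_ne_lt k (a := i) (b := i + 1) (by omega) (by omega)
  rcases vertex_seg (D.vert _ _) hX hY h1 with e1 | e1 <;> rcases vertex_seg (D.vert _ _) hX hY h2 with e2 | e2
  · exact absurd (toR_inj (e1.trans e2.symm)) hne
  · exact Or.inl ⟨toR_inj e1, toR_inj e2⟩
  · exact Or.inr ⟨toR_inj e1, toR_inj e2⟩
  · exact absurd (toR_inj (e1.trans e2.symm)) hne

theorem FD.idx_uniq (D : FD P n Fc vn c rk Pt idx Q) {k : Fin n} {i j : ℕ} (hi : i < rk k) (hj : j < rk k)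
    (h : idx k (i + 1) = idx k (j + 1)) : i = j := by
  have h3 := D.three k
  have e := D.meet k j
  rw [← h] at e
  have lt_of : ∀ a b, a < rk k → b < rk k → a ≡ b [MOD rk k] → a = b := fun a b ha hb hab => by
    unfold Nat.ModEq at hab
    rwa [Nat.mod_eq_of_lt ha, Nat.mod_eq_of_lt hb] at hab
  rcases D.ends e with ⟨h1, -⟩ | ⟨h1, h2⟩
  · exact lt_of _ _ hi hj (D.inj _ _ _ h1)
  · exfalso
    have a1 := D.inj _ _ _ h1
    have a2 := D.inj _ _ _ h2
    have a3 : j + 2 ≡ j [MOD rk k] := ((a1.add_right 1).symm.trans a2)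
    have a4 : 2 ≡ 0 [MOD rk k] := Nat.ModEq.add_left_cancel' j (by simpa using a3)
    have := Nat.le_of_dvd (by norm_num) (Nat.modEq_zero_iff_dvd.1 a4)
    omega

/-- edge data -/
structure EDt (P : Set V3) (n : ℕ) (Fc : Fin n → Set V3) (m : ℕ) (E : Fin m → Set V3) (A B : Fin m → Z3)
    (fa fb : Fin m → Fin n) : Prop where
  inj : Function.Injective E
  all : ∀ S, IsEdgeOf P S → ∃ j, S = E j
  seg : ∀ j, A j ≠ B j ∧ E j = segment ℝ (toR (A j)) (toR (B j))
  fac : ∀ j, fa j ≠ fb j ∧ E j = Fc (fa j) ∩ Fc (fb j)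

variable {m : ℕ} {E : Fin m → Set V3} {A B : Fin m → Z3} {fa fb : Fin m → Fin n}

theorem EDt.memA (H : EDt P n Fc m E A B fa fb) (j) : toR (A j) ∈ Fc (fa j) ∩ Fc (fb j) := by
  rw [← (H.fac j).2, (H.seg j).2]; exact left_mem_segment _ _ _

theorem EDt.memB (H : EDt P n Fc m E A B fa fb) (j) : toR (B j) ∈ Fc (fa j) ∩ Fc (fb j) := by
  rw [← (H.fac j).2, (H.seg j).2]; exact right_mem_segment _ _ _

theorem FD.bij (D : FD P n Fc vn c rk Pt idx Q) (H : EDt P n Fc m E A B fa fb)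
    (Ψ : Fin n → Fin n → Z3 → Z3 → ℝ)
    (hΨ : ∀ j, Ψ (fa j) (fb j) (B j) (A j) = Ψ (fa j) (fb j) (A j) (B j))
    (hΨ' : ∀ j, Ψ (fb j) (fa j) (B j) (A j) = Ψ (fb j) (fa j) (A j) (B j)) :
    ∑ k, ∑ i ∈ Finset.range (rk k), Ψ k (idx k (i + 1)) (Pt k i) (Pt k (i + 1)) =
      ∑ j, (Ψ (fa j) (fb j) (A j) (B j) + Ψ (fb j) (fa j) (A j) (B j)) := by
  have ex1 : ∀ j, ∃ i < rk (fa j), idx (fa j) (i + 1) = fb j := fun j =>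
    D.exists_idx (H.fac j).1 (H.memA j).1 (H.memA j).2
  have ex2 : ∀ j, ∃ i < rk (fb j), idx (fb j) (i + 1) = fa j := fun j =>
    D.exists_idx (H.fac j).1.symm (H.memA j).2 (H.memA j).1
  choose i1 hi1 hf1 using ex1
  choose i2 hi2 hf2 using ex2
  have hE1 : ∀ j, Fc (fa j) ∩ Fc (idx (fa j) (i1 j + 1)) = segment ℝ (toR (A j)) (toR (B j)) := fun j => by
    rw [hf1, ← (H.fac j).2, (H.seg j).2]
  have hE2 : ∀ j, Fc (fb j) ∩ Fc (idx (fb j) (i2 j + 1)) = segment ℝ (toR (A j)) (toR (B j)) := fun j => by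
    rw [hf2, Set.inter_comm, ← (H.fac j).2, (H.seg j).2]
  have hR : ∑ j, (Ψ (fa j) (fb j) (A j) (B j) + Ψ (fb j) (fa j) (A j) (B j)) =
      ∑ x : Fin m × Bool, (if x.2 then Ψ (fa x.1) (fb x.1) (A x.1) (B x.1) else
        Ψ (fb x.1) (fa x.1) (A x.1) (B x.1)) := by
    rw [Fintype.sum_prod_type]
    refine Finset.sum_congr rfl fun j _ => ?_
    simp
  rw [hR, Finset.sum_sigma']
  symm
  refine Finset.sum_bij (fun x _ => if x.2 then ⟨fa x.1, i1 x.1⟩ else ⟨fb x.1, i2 x.1⟩) ?_ ?_ ?_ ?_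
  · rintro ⟨j, b⟩ _
    cases b
    · simpa using hi2 j
    · simpa using hi1 j
  · have key : ∀ (j : Fin m) (b : Bool), E j = Fc ((if b then ⟨fa j, i1 j⟩ else ⟨fb j, i2 j⟩ : (_ : Fin n) × ℕ).1) ∩
        Fc (idx (if b then ⟨fa j, i1 j⟩ else ⟨fb j, i2 j⟩ : (_ : Fin n) × ℕ).1
          ((if b then ⟨fa j, i1 j⟩ else ⟨fb j, i2 j⟩ : (_ : Fin n) × ℕ).2 + 1)) := by
      intro j b
      cases b
      · simp only [Bool.false_eq_true, if_false]; rw [hE2, (H.seg j).2]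
      · simp only [if_true]; rw [hE1, (H.seg j).2]
    rintro ⟨j, b⟩ _ ⟨j', b'⟩ _ h
    beta_reduce at h
    have e1 := key j b
    have e2 := key j' b'
    rw [h, ← e2] at e1
    have hj := H.inj e1
    subst hj
    have hne := (H.fac j).1
    cases b <;> cases b' <;> simp at h ⊢
    · exact hne h.1.symm
    · exact hne h.1
  · rintro ⟨k, i⟩ hki
    have hi : i < rk k := by simpa using hki
    have hne := D.pt_ne_lt k (a := i) (b := i + 1) (by omega) (by have := D.three k; omega)
    have hedge := D.inter_edge (fun h => hne (toR_inj h)) (D.meet k i)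
    obtain ⟨j, hj⟩ := H.all _ hedge
    have hA : toR (Pt k i) ∈ E j := by rw [← hj]; exact ⟨D.memF _ _, D.mem1 _ _⟩
    have hB : toR (Pt k (i + 1)) ∈ E j := by rw [← hj]; exact ⟨D.memF _ _, D.mem2 _ _⟩
    rw [(H.fac j).2] at hA hB
    have h1 := D.two_facets k i hA.1 hB.1
    have h2 := D.two_facets k i hA.2 hB.2
    have hne' := (H.fac j).1
    rcases h1 with h1 | h1
    · have h4 : fb j = idx k (i + 1) := by
        rcases h2 with h2 | h2
        · exact absurd (h1.trans h2.symm) hne'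
        · exact h2
      refine ⟨(j, true), Finset.mem_univ _, ?_⟩
      simp only [if_true]
      subst h1
      have := D.idx_uniq (hi1 j) hi ((hf1 j).trans h4)
      rw [this]
    · have h4 : fb j = k := by
        rcases h2 with h2 | h2
        · exact h2
        · exact absurd (h1.trans h2.symm) hne'
      refine ⟨(j, false), Finset.mem_univ _, ?_⟩
      simp only [Bool.false_eq_true, if_false]
      subst h4
      have := D.idx_uniq (hi2 j) hi ((hf2 j).trans h1)
      rw [this]
  · rintro ⟨j, b⟩ _
    cases b
    · simp only [Bool.false_eq_true, if_false]
      rcases D.ends (hE2 j) with ⟨a1, a2⟩ | ⟨a1, a2⟩ <;> rw [a1, a2, hf2]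
      exact (hΨ' j).symm
    · simp only [if_true]
      rcases D.ends (hE1 j) with ⟨a1, a2⟩ | ⟨a1, a2⟩ <;> rw [a1, a2, hf1]
      exact (hΨ j).symm

theorem FD.Q_mem (D : FD P n Fc vn c rk Pt idx Q) (H : EDt P n Fc m E A B fa fb) (k i) :
    Q k (i + 1) ∈ Fc (idx k (i + 1)) ∧ Q k (i + 1) ∈ Fc (idx k (i + 2)) := by
  obtain ⟨he, hQ, hne⟩ := D.Qe k (i + 1)
  obtain ⟨j, hj⟩ := H.all _ he
  have h1 : toR (Pt k (i + 1)) ∈ Fc (fa j) ∩ Fc (fb j) := by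
    rw [← (H.fac j).2, ← hj]; exact left_mem_segment _ _ _
  have h2 : Q k (i + 1) ∈ Fc (fa j) ∩ Fc (fb j) := by
    rw [← (H.fac j).2, ← hj]; exact right_mem_segment _ _ _
  have hne' := (H.fac j).1
  have a1 : fa j ≠ k := by intro h; rw [h] at h2; exact hQ h2.1
  have a2 : fb j ≠ k := by intro h; rw [h] at h2; exact hQ h2.2
  have b1 := (D.three_facets k i h1.1).resolve_left a1
  have b2 := (D.three_facets k i h1.2).resolve_left a2
  rcases b1 with b1 | b1 <;> rcases b2 with b2 | b2
  · exact absurd (b1.trans b2.symm) hne'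
  · rw [← b1, ← b2]; exact h2
  · rw [← b1, ← b2]; exact h2.symm
  · exact absurd (b1.trans b2.symm) hne'

end

section

def triMat (b ε : ℕ → ℝ) (s N : ℕ) : Matrix (Fin N) (Fin N) ℝ :=
  Matrix.of fun k l : Fin N =>
    if (k : ℕ) = (l : ℕ) then b (s + (k : ℕ))
    else if (k : ℕ) + 1 = (l : ℕ) ∨ (l : ℕ) + 1 = (k : ℕ) then
      (ε (s + min (k : ℕ) (l : ℕ)))⁻¹
    else 0

theorem triDet_eq (b ε : ℕ → ℝ) (s t : ℕ) : triDet b ε s t = (triMat b ε s (t + 1 - s)).det := by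
  unfold triDet
  split_ifs with h
  · have : t + 1 - s = 0 := by omega
    rw [this]; simp
  · rfl

theorem tri_first (b ε : ℕ → ℝ) (s N : ℕ) :
    (triMat b ε s (N + 2)).det = b s * (triMat b ε (s + 1) (N + 1)).det
      - (ε s)⁻¹ * (ε s)⁻¹ * (triMat b ε (s + 2) N).det := by
  rw [Matrix.det_succ_row_zero, Fin.sum_univ_succ, Fin.sum_univ_succ]
  have hz : ∑ i : Fin N, (-1 : ℝ) ^ ((i.succ.succ : Fin (N + 2)) : ℕ) * triMat b ε s (N + 2) 0 i.succ.succ *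
      ((triMat b ε s (N + 2)).submatrix Fin.succ (i.succ.succ).succAbove).det = 0 := by
    apply Finset.sum_eq_zero
    intro i _
    have : triMat b ε s (N + 2) 0 i.succ.succ = 0 := by
      simp [triMat]
    rw [this]; simp
  rw [hz]
  have m0 : (triMat b ε s (N + 2)).submatrix Fin.succ (Fin.succAbove 0) = triMat b ε (s + 1) (N + 1) := by
    ext i j
    simp only [triMat, Matrix.submatrix_apply, Matrix.of_apply, Fin.succAbove_zero, Fin.val_succ, add_left_inj]
    rw [show s + (↑i + 1) = s + 1 + ↑i by omega, show min ((i : ℕ) + 1) ((j : ℕ) + 1) = min (i : ℕ) (j : ℕ) + 1 by omega,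
      show s + (min (i : ℕ) (j : ℕ) + 1) = s + 1 + min (i : ℕ) (j : ℕ) by omega]
  have m1 : ((triMat b ε s (N + 2)).submatrix Fin.succ (Fin.succAbove (Fin.succ 0))).det =
      (ε s)⁻¹ * (triMat b ε (s + 2) N).det := by
    rw [Matrix.det_succ_column_zero, Fin.sum_univ_succ]
    have hz2 : ∑ i : Fin N, (-1 : ℝ) ^ ((i.succ : Fin (N + 1)) : ℕ) *
        ((triMat b ε s (N + 2)).submatrix Fin.succ (Fin.succAbove (Fin.succ 0))) i.succ 0 *
        ((((triMat b ε s (N + 2)).submatrix Fin.succ (Fin.succAbove (Fin.succ 0)))).submatrix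
          (i.succ).succAbove Fin.succ).det = 0 := by
      apply Finset.sum_eq_zero
      intro i _
      have : ((triMat b ε s (N + 2)).submatrix Fin.succ (Fin.succAbove (Fin.succ 0))) i.succ 0 = 0 := by
        simp [triMat]
      rw [this]; simp
    rw [hz2]
    have e0 : ((triMat b ε s (N + 2)).submatrix Fin.succ (Fin.succAbove (Fin.succ 0))) 0 0 = (ε s)⁻¹ := by
      simp [triMat]
    have e1 : (((triMat b ε s (N + 2)).submatrix Fin.succ (Fin.succAbove (Fin.succ 0)))).submatrix
          (Fin.succAbove 0) Fin.succ = triMat b ε (s + 2) N := by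
      ext i j
      simp only [triMat, Matrix.submatrix_apply, Matrix.of_apply, Fin.succAbove_zero, Fin.val_succ, Fin.succ_succAbove_succ,
        add_left_inj]
      rw [show s + (↑i + 1 + 1) = s + 2 + ↑i by omega,
        show min ((i : ℕ) + 1 + 1) ((j : ℕ) + 1 + 1) = min (i : ℕ) (j : ℕ) + 2 by omega,
        show s + (min (i : ℕ) (j : ℕ) + 2) = s + 2 + min (i : ℕ) (j : ℕ) by omega]
    rw [e0, e1]
    simp
  rw [m0, m1]
  have f0 : triMat b ε s (N + 2) 0 0 = b s := by simp [triMat]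
  have f1 : triMat b ε s (N + 2) 0 (Fin.succ 0) = (ε s)⁻¹ := by simp [triMat]
  rw [f0, f1]
  simp
  ring

theorem tri_zero (b ε : ℕ → ℝ) (s : ℕ) : (triMat b ε s 0).det = 1 := by simp
theorem tri_one (b ε : ℕ → ℝ) (s : ℕ) : (triMat b ε s 1).det = b s := by simp [triMat]

theorem tri_last (b ε : ℕ → ℝ) (N s : ℕ) :
    (triMat b ε s (N + 2)).det = b (s + N + 1) * (triMat b ε s (N + 1)).det
      - (ε (s + N))⁻¹ * (ε (s + N))⁻¹ * (triMat b ε s N).det := by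
  induction N using Nat.strong_induction_on generalizing s with
  | _ N ih =>
    match N, ih with
    | 0, _ => rw [tri_first, tri_zero, tri_one, tri_one, tri_zero]; simp; ring
    | 1, ih =>
      have h0 := ih 0 (by omega) (s + 1)
      rw [tri_first b ε s 1, h0, tri_first b ε s 0]
      simp only [tri_zero, tri_one, add_zero]
      ring_nf
    | N + 2, ih =>
      have h0 := ih N (by omega) (s + 2)
      have h1 := ih (N + 1) (by omega) (s + 1)
      rw [tri_first b ε s (N + 2), h1, h0, tri_first b ε s (N + 1), tri_first b ε s N]
      rw [show s + 1 + (N + 1) + 1 = s + (N + 2) + 1 by omega, show s + 1 + (N + 1) = s + (N + 2) by omega,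
        show s + 2 + N + 1 = s + (N + 2) + 1 by omega, show s + 2 + N = s + (N + 2) by omega]
      ring

def Ssol (a b ε : ℕ → ℝ) (j : ℕ) : ℝ :=
  ∑ i ∈ Finset.Icc 2 (j - 1), a i * triDet b ε (i + 1) (j - 1) * ∏ k ∈ Finset.Icc i (j - 1), ε k

theorem Ssol_rec (a b ε : ℕ → ℝ) (j : ℕ) (hj : 2 ≤ j) (h0 : ε j ≠ 0) (h1 : ε (j - 1) ≠ 0) :
    Ssol a b ε (j + 1) = ε j * (a j + b j * Ssol a b ε j - (ε (j - 1))⁻¹ * Ssol a b ε (j - 1)) := by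
  obtain ⟨t, rfl⟩ : ∃ t, j = t + 2 := ⟨j - 2, by omega⟩
  unfold Ssol
  simp only [Nat.add_sub_cancel, show t + 2 - 1 = t + 1 by omega, show t + 1 - 1 = t by omega] at *
  rw [Finset.sum_Icc_succ_top (by omega)]
  simp only [triDet_eq] at *
  rw [show t + 1 + 1 + 1 - (t + 1 + 1 + 1) = 0 by omega, tri_zero, Finset.Icc_self, Finset.prod_singleton]
  rw [mul_sub, mul_add, Finset.mul_sum, Finset.mul_sum, Finset.mul_sum, Finset.mul_sum]
  rcases Nat.eq_zero_or_pos t with ht | ht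
  · subst ht; simp; ring
  · rw [Finset.sum_Icc_succ_top (a := 2) (b := t) (by omega), Finset.sum_Icc_succ_top (a := 2) (b := t) (by omega)]
    have key : ∀ i ∈ Finset.Icc 2 t, a i * (triMat b ε (i + 1) (t + 1 + 1 + 1 - (i + 1))).det *
        ∏ k ∈ Finset.Icc i (t + 1 + 1), ε k =
        ε (t + 1 + 1) * (b (t + 1 + 1) * (a i * (triMat b ε (i + 1) (t + 1 + 1 - (i + 1))).det *
          ∏ k ∈ Finset.Icc i (t + 1), ε k)) -
        ε (t + 1 + 1) * ((ε (t + 1))⁻¹ * (a i * (triMat b ε (i + 1) (t + 1 - (i + 1))).det *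
          ∏ k ∈ Finset.Icc i t, ε k)) := by
      intro i hi
      rw [Finset.mem_Icc] at hi
      obtain ⟨N, rfl⟩ : ∃ N, t = i + N := ⟨t - i, by omega⟩
      rw [show i + N + 1 + 1 + 1 - (i + 1) = N + 2 by omega, show i + N + 1 + 1 - (i + 1) = N + 1 by omega,
        show i + N + 1 - (i + 1) = N by omega, tri_last, Finset.prod_Icc_succ_top (by omega),
        Finset.prod_Icc_succ_top (by omega), show i + 1 + N + 1 = i + N + 1 + 1 by omega,
        show i + 1 + N = i + N + 1 by omega]
      have : ε (i + N + 1) ≠ 0 := h1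
      field_simp
    rw [Finset.sum_congr rfl key, Finset.sum_sub_distrib]
    rw [show t + 1 + 1 + 1 - (t + 1 + 1) = 1 by omega, show t + 1 + 1 - (t + 1 + 1) = 0 by omega, tri_one, tri_zero,
      Finset.Icc_self, Finset.prod_singleton, Finset.prod_Icc_succ_top (by omega), Finset.Icc_self, Finset.prod_singleton]
    simp only [show t + 1 + 1 = t + 2 by omega]
    ring

theorem Ssol_unique (a b ε x : ℕ → ℝ) (hx1 : x 1 = 0) (hx2 : x 2 = 0) (hε : ∀ j, 1 ≤ j → ε j ≠ 0)
    (hrec : ∀ j, 2 ≤ j → x (j + 1) / ε j + x (j - 1) / ε (j - 1) = b j * x j + a j) :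
    ∀ j, 1 ≤ j → x j = Ssol a b ε j := by
  have key : ∀ j, 1 ≤ j → x j = Ssol a b ε j ∧ x (j + 1) = Ssol a b ε (j + 1) := by
    intro j hj
    induction j, hj using Nat.le_induction with
    | base => rw [hx1, hx2]; simp [Ssol]
    | succ j hj ih =>
      refine ⟨ih.2, ?_⟩
      rw [Ssol_rec a b ε (j + 1) (by omega) (hε _ (by omega)) (hε _ (by omega)), Nat.add_sub_cancel, ← ih.1, ← ih.2]
      have h := hrec (j + 1) (by omega)
      rw [Nat.add_sub_cancel] at h
      have h1 := hε (j + 1) (by omega)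
      have h2 := hε j hj
      have h3 : x (j + 1 + 1) / ε (j + 1) = b (j + 1) * x (j + 1) + a (j + 1) - x j / ε j := by linarith
      rw [div_eq_iff h1] at h3
      rw [h3]; ring
  exact fun j hj => (key j hj).1

theorem sum_swap (T : ℕ → ℕ → ℝ) (V : ℕ → ℝ) (r : ℕ) :
    ∑ i ∈ Finset.Icc 2 r, ∑ j ∈ Finset.Icc (i + 1) r, T i j * V j =
      ∑ j ∈ Finset.Icc 1 r, (∑ i ∈ Finset.Icc 2 (j - 1), T i j) * V j := by
  simp only [Finset.sum_mul]
  apply Finset.sum_comm'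
  intro i j
  simp only [Finset.mem_Icc]
  omega

theorem CFacet_eq (vF : Z3) (Pt vk : ℕ → Z3) (Q : ℕ → V3) (r : ℕ) :
    CFacet vF Pt vk Q r = - ∑ j ∈ Finset.Icc 1 r, Ssol (aF vF vk Pt Q) (bF vF vk Pt) (epsF vF vk) j *
      ((gcd3 (Pt j - Pt (j - 1)) : ℝ) / (mIndex vF (vk j) : ℝ)) := by
  unfold CFacet Ssol
  rw [← sum_swap]

end

section

def crZ (v Y : Z3) : Z3 →+ ℤ where
  toFun x := dt (cr v x) Y
  map_zero' := by simp [dt]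
  map_add' x y := by simp only [dt, cr_0, cr_1, cr_2, Pi.add_apply]; ring

theorem gcd3_ne {x : Z3} (h : x ≠ 0) : (gcd3 x : ℤ) ≠ 0 := by
  intro h0
  have := prm_spec x
  rw [h0, zero_smul] at this
  exact h this

theorem plane_cr {v w x : Z3} (hx : x ∈ planeLattice v w) : cr (cr v w) (cr v x) = 0 := by
  have hx' : toR x ∈ Submodule.span ℝ {toR v, toR w} := hx
  rw [Submodule.mem_span_pair] at hx'
  obtain ⟨a, b, h⟩ := hx'
  apply toR_inj
  rw [toR_cr, toR_cr, toR_cr, ← h]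
  apply vec_ext <;> simp [toR] <;> ring

theorem mIndex_eq {v w : Z3} (hv : IsPrimitive v) (hc : cr v w ≠ 0) : mIndex v w = gcd3 (cr v w) := by
  have hg : (gcd3 (cr v w) : ℤ) ≠ 0 := gcd3_ne hc
  have hN := prm_prim hc
  have hspec := prm_spec (cr v w)
  obtain ⟨Y, hY⟩ := prim_bezout hN
  set g := gcd3 (cr v w) with hgd
  set N := prm (cr v w) with hNd
  obtain ⟨p, hp⟩ := exists_residue w hv
  choose y hy using hp
  -- cr v x = t x • N on the plane
  have ht : ∀ x ∈ planeLattice v w, cr v x = crZ v Y x • N := by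
    intro x hx
    have h1 := plane_cr hx
    rw [hspec, cr_smul_left] at h1
    have h2 : cr N (cr v x) = 0 := by
      rcases smul_eq_zero.1 h1 with h | h
      · exact absurd h hg
      · exact h
    obtain ⟨t, ht⟩ := prim_parallel hN h2
    have : crZ v Y x = t := by
      show dt (cr v x) Y = t
      rw [ht, smul_dt, hY, mul_one]
    rw [this, ht]
  have hvL : v ∈ planeLattice v w := by
    show toR v ∈ Submodule.span ℝ {toR v, toR w}
    exact Submodule.subset_span (by simp)
  have hwL : w ∈ planeLattice v w := by
    show toR w ∈ Submodule.span ℝ {toR v, toR w}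
    exact Submodule.subset_span (by simp)
  have hyw : w - p • v = (g : ℤ) • y := by
    funext i; simp only [Pi.sub_apply, Pi.smul_apply, smul_eq_mul]; exact hy i
  have hyL : y ∈ planeLattice v w := by
    show toR y ∈ Submodule.span ℝ {toR v, toR w}
    have hgr : (g : ℝ) ≠ 0 := by exact_mod_cast hg
    have e : toR y = (1 / (g : ℝ)) • (toR w - (p : ℝ) • toR v) := by
      have := congrArg toR hyw
      rw [toR_sub, toR_smul, toR_smul] at this
      rw [this, smul_smul]
      push_cast
      rw [one_div, inv_mul_cancel₀ hgr, one_smul]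
    rw [e]
    refine Submodule.smul_mem _ _ (Submodule.sub_mem _ (Submodule.subset_span (by simp)) ?_)
    exact Submodule.smul_mem _ _ (Submodule.subset_span (by simp))
  have htw : crZ v Y w = g := by
    show dt (cr v w) Y = g
    rw [hspec, smul_dt, hY, mul_one]
  have hty : crZ v Y y = 1 := by
    have h1 := congrArg (crZ v Y) hyw
    have h2 : crZ v Y v = 0 := by
      show dt (cr v v) Y = 0
      simp only [dt, cr_0, cr_1, cr_2]; ring
    rw [map_sub, map_zsmul, map_zsmul, htw, h2, smul_zero, sub_zero, smul_eq_mul] at h1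
    have : (g : ℤ) * (crZ v Y y - 1) = 0 := by linarith
    rcases mul_eq_zero.1 this with h | h
    · exact absurd h hg
    · linarith
  set φ : planeLattice v w →+ ℤ := (crZ v Y).comp (planeLattice v w).subtype with hφ
  have hsurj : Function.Surjective φ := by
    intro z
    refine ⟨z • ⟨y, hyL⟩, ?_⟩
    rw [map_zsmul]
    show z • crZ v Y y = z
    rw [hty]; simp
  have hcomap : (AddSubgroup.closure ({v, w} : Set Z3)).addSubgroupOf (planeLattice v w) =
      (AddSubgroup.zmultiples (g : ℤ)).comap φ := by
    ext ⟨x, hx⟩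
    rw [AddSubgroup.mem_addSubgroupOf, AddSubgroup.mem_comap, AddSubgroup.mem_closure_pair, AddSubgroup.mem_zmultiples_iff]
    show (∃ m n : ℤ, m • v + n • w = x) ↔ ∃ k : ℤ, k • (g : ℤ) = crZ v Y x
    constructor
    · rintro ⟨a, b, rfl⟩
      refine ⟨b, ?_⟩
      have h2 : crZ v Y v = 0 := by
        show dt (cr v v) Y = 0
        simp only [dt, cr_0, cr_1, cr_2]; ring
      rw [map_add, map_zsmul, map_zsmul, htw, h2]; simp
    · rintro ⟨b, hb⟩
      have h1 : crZ v Y (x - b • w) = 0 := by rw [map_sub, map_zsmul, htw, hb]; simp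
      have h2 := ht _ ((planeLattice v w).sub_mem hx ((planeLattice v w).zsmul_mem hwL b))
      rw [h1, zero_smul] at h2
      obtain ⟨a, ha⟩ := prim_parallel hv h2
      exact ⟨a, b, by rw [← ha]; abel⟩
  unfold mIndex
  rw [hcomap, AddSubgroup.index_comap_of_surjective _ hsurj, Int.index_zmultiples]
  simp

theorem edge_vec {v w d : Z3} (hc : cr v w ≠ 0) (hd : d ≠ 0) (h1 : dt v d = 0) (h2 : dt w d = 0) :
    (gcd3 (cr v w) : ℤ) • d = (Int.sign (dt (cr v w) d) * gcd3 d) • cr v w := by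
  have hg : (gcd3 (cr v w) : ℤ) ≠ 0 := gcd3_ne hc
  have hgd : (gcd3 d : ℤ) ≠ 0 := gcd3_ne hd
  have s1 := prm_spec (cr v w)
  have s2 := prm_spec d
  have hz : cr (cr v w) d = 0 := by
    rw [cr_anti, cr_cr, dt_comm d w, dt_comm d v, h1, h2]; simp
  have hz2 : cr (prm (cr v w)) (prm d) = 0 := by
    rw [s1, s2, cr_smul_left, cr_smul_right] at hz
    rcases smul_eq_zero.1 hz with h | h
    · exact absurd h hg
    · rcases smul_eq_zero.1 h with h | h
      · exact absurd h hgd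
      · exact h
  have hpos := dt_self_pos_int (prim_ne_zero (prm_prim hc))
  have g1 : (0 : ℤ) < gcd3 (cr v w) := by positivity
  have g2 : (0 : ℤ) < gcd3 d := by positivity
  have hdt : dt (cr v w) d = (gcd3 (cr v w) : ℤ) * (gcd3 d * dt (prm (cr v w)) (prm d)) := by
    conv_lhs => rw [s1, s2, smul_dt, dt_smul]
  rcases prim_eq_or_neg (prm_prim hc) (prm_prim hd) hz2 with h | h
  · have : Int.sign (dt (cr v w) d) = 1 := by
      rw [hdt, h]; exact Int.sign_eq_one_of_pos (by positivity)
    rw [this, one_mul]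
    conv_lhs => rw [s2, h]
    conv_rhs => rw [s1]
    rw [smul_comm]
  · have : Int.sign (dt (cr v w) d) = -1 := by
      rw [hdt, h, dt_neg]
      apply Int.sign_eq_neg_one_of_neg
      have : 0 < (gcd3 (cr v w) : ℤ) * (gcd3 d * dt (prm (cr v w)) (prm (cr v w))) := by positivity
      linarith
    rw [this]
    conv_lhs => rw [s2, h]
    conv_rhs => rw [s1]
    rw [smul_comm, smul_neg, smul_neg, neg_one_mul, neg_smul]

theorem edge_kap {v w e₁ e₂ : Z3} {p q : ℤ} (hv : IsPrimitive v) (hw : IsPrimitive w)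
    (hb : IsZBasisOf (planeLattice v w) e₁ e₂) (h1 : v = e₁) (h2 : w = p • e₁ + q • e₂) (hp : 0 ≤ p) (hpq : p < q)
    {r s : ℝ} (hr : 0 < r) (hs : 0 < s) : kapV v w r s = (dedekindSum p q : ℝ) + 1 / 4 := by
  subst h1
  obtain ⟨_, he2, hlin, hspan⟩ := hb
  have hli : ∀ a b : ℤ, a • v + b • e₂ = 0 → a = 0 ∧ b = 0 := LinearIndependent.pair_iff.1 hlin
  have hc2 : cr v e₂ ≠ 0 := by
    intro h
    obtain ⟨t, ht⟩ := prim_parallel hv h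
    have := (hli t (-1) (by rw [ht]; simp)).2
    omega
  have hg0 := gcd3_ne hc2
  -- gcd3 (cr v e₂) = 1
  have hg1 : gcd3 (cr v e₂) = 1 := by
    obtain ⟨p', hp'⟩ := exists_residue e₂ hv
    choose y hy using hp'
    set g := gcd3 (cr v e₂) with hg
    have hyw : e₂ - p' • v = (g : ℤ) • y := by
      funext i; simp only [Pi.sub_apply, Pi.smul_apply, smul_eq_mul]; exact hy i
    have hyL : y ∈ planeLattice v w := by
      show toR y ∈ Submodule.span ℝ {toR v, toR w}
      have hgr : (g : ℝ) ≠ 0 := by exact_mod_cast hg0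
      have e : toR y = (1 / (g : ℝ)) • (toR e₂ - (p' : ℝ) • toR v) := by
        have := congrArg toR hyw
        rw [toR_sub, toR_smul, toR_smul] at this
        rw [this, smul_smul]
        push_cast
        rw [one_div, inv_mul_cancel₀ hgr, one_smul]
      rw [e]
      refine Submodule.smul_mem _ _ (Submodule.sub_mem _ he2 ?_)
      exact Submodule.smul_mem _ _ (Submodule.subset_span (by simp))
    obtain ⟨a, b, hab⟩ := hspan y hyL
    have h3 : (p' + g * a) • v + (g * b - 1) • e₂ = 0 := by
      rw [hab] at hyw
      have : e₂ = p' • v + (g : ℤ) • (a • v + b • e₂) := by rw [← hyw]; abel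
      rw [add_smul, sub_smul, mul_smul, mul_smul, one_smul]
      rw [smul_add] at this
      have h5 := sub_eq_zero.2 this.symm
      rw [← h5]; abel
    have h4 := (hli _ _ h3).2
    have h5 : (g : ℤ) * b = 1 := by linarith
    have := Int.eq_one_of_mul_eq_one_right (by positivity) h5
    exact_mod_cast this
  have hcr : cr v w = q • cr v e₂ := by
    rw [h2]; apply vec_ext <;> simp <;> ring
  have hq : 0 < q := by omega
  have hgq : gcd3 (cr v w) = q.toNat := by
    have h6 := gcd3_smul q (cr v e₂)
    rw [← hcr, hg1, abs_of_pos hq] at h6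
    push_cast at h6
    omega
  have hcop : IsCoprime p q := by
    obtain ⟨y, hy⟩ := prim_bezout hw
    rw [h2, add_dt, smul_dt, smul_dt] at hy
    exact ⟨dt v y, dt e₂ y, by linarith⟩
  rw [kapV_eq hv (p := p), hgq, kap_dedekind hq hcop hr hs]
  intro i
  rw [hgq, Int.toNat_of_nonneg hq.le, h2]
  exact ⟨e₂ i, by simp⟩

theorem rel {V w0 w1 w2 d U : V3} {e1 e2 : ℝ} (he1 : e1 = dt (cr V w1) w0) (he2 : e2 = dt (cr V w2) w1)
    (z1 : e1 ≠ 0) (z2 : e2 ≠ 0) (d1 : dt d V = 0) (d2 : dt d w2 = 0) (d3 : dt d w1 ≠ 0)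
    (u1 : dt U w0 = 0) (u2 : dt U w1 = 0) (u3 : dt U V ≠ 0) :
    (1 / e2) • w2 + (1 / e1) • w0 = (dt d w0 / (e1 * dt d w1)) • w1 + (dt U w2 / (e2 * dt U V)) • V := by
  have hc := cramer V w1 w0 w2
  have e3 : dt (cr V w1) w2 = - e2 := by
    rw [he2]; simp only [dt, cr_0, cr_1, cr_2]; ring
  rw [← he1, e3] at hc
  set α := dt (cr w1 w0) w2
  set β := dt (cr w0 V) w2
  have hd := congrArg (fun z => dt d z) hc
  have hu := congrArg (fun z => dt U z) hc
  simp only [dt_add, dt_smul, d1, d2, u1, u2] at hd hu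
  have hβ : β = e2 * dt d w0 / dt d w1 := by rw [eq_div_iff d3]; linarith
  have hα : α = e1 * dt U w2 / dt U V := by rw [eq_div_iff u3]; linarith
  have hw : w2 = (1 / e1) • (α • V + β • w1 + (-e2) • w0) := by
    rw [← hc, smul_smul, one_div, inv_mul_cancel₀ z1, one_smul]
  conv_lhs => rw [hw]
  rw [hα, hβ]
  apply vec_ext <;> simp only [Pi.add_apply, Pi.smul_apply, smul_eq_mul] <;> field_simp <;> ring

def crL (u : V3) : V3 →ₗ[ℝ] V3 where
  toFun x := cr u x
  map_add' x y := by apply vec_ext <;> simp <;> ring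
  map_smul' t x := by apply vec_ext <;> simp <;> ring

theorem sum_Icc_range (f : ℕ → ℝ) (r : ℕ) : ∑ j ∈ Finset.Icc 1 r, f j = ∑ i ∈ Finset.range r, f (i + 1) := by
  induction r with
  | zero => simp
  | succ r ih => rw [Finset.sum_Icc_succ_top (by omega), Finset.sum_range_succ, ih]

end

section

variable {P : Set V3} {n : ℕ} {Fc : Fin n → Set V3} {vn : Fin n → Z3} {c : Fin n → ℤ}
  {rk : Fin n → ℕ} {Pt : Fin n → ℕ → Z3} {idx : Fin n → ℕ → Fin n} {Q : Fin n → ℕ → V3}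
variable {m : ℕ} {E : Fin m → Set V3} {A B : Fin m → Z3} {fa fb : Fin m → Fin n}

theorem FD.cr_ne (D : FD P n Fc vn c rk Pt idx Q) (k i) : cr (vn k) (vn (idx k (i + 1))) ≠ 0 := by
  intro h
  have := ((D.toLD.L k).edD_succ i).2
  apply this
  unfold edD
  rw [h]
  simp [dt]

theorem FD.d_ne (D : FD P n Fc vn c rk Pt idx Q) (k i) : Pt k (i + 1) - Pt k i ≠ 0 := by
  intro h
  have := ((D.toLD.L k).edD_succ i).2
  apply this
  unfold edD
  rw [h]
  simp [dt]

theorem FD.edge (D : FD P n Fc vn c rk Pt idx Q) (k i) :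
    (gcd3 (cr (vn k) (vn (idx k (i + 1)))) : ℤ) • (Pt k (i + 1) - Pt k i) =
      (dlt (vn k) (Pt k) (fun i => vn (idx k i)) * gcd3 (Pt k (i + 1) - Pt k i)) • cr (vn k) (vn (idx k (i + 1))) := by
  have L := D.toLD.L k
  rw [← L.edD_const i]
  refine edge_vec (D.cr_ne k i) (D.d_ne k i) ?_ ?_
  · rw [dt_sub, L.plane, L.plane, sub_self]
  · have a := L.on1 i
    have b := L.on2 i
    beta_reduce at a b
    rw [dt_sub, a, b, sub_self]

theorem FD.wd_pos (D : FD P n Fc vn c rk Pt idx Q) (k i) :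
    0 < dt (vn (idx k (i + 1))) (Pt k (i + 2) - Pt k (i + 1)) := by
  have L := D.toLD.L k
  have a := L.pos i 2 le_rfl (D.three k)
  have b := L.on2 i
  beta_reduce at a b
  rw [dt_sub, b]; linarith

theorem FD.eps_ne (D : FD P n Fc vn c rk Pt idx Q) (k i) :
    epsF (vn k) (fun i => vn (idx k i)) (i + 1) ≠ 0 := by
  unfold epsF
  rw [det3_eq, ← toR_cr, dt_toR]
  have h := D.edge k (i + 1)
  have h2 := congrArg (fun z => dt (vn (idx k (i + 1))) z) h
  beta_reduce at h2
  rw [dt_smul, dt_smul] at h2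
  have h3 := D.wd_pos k i
  have h4 := gcd3_ne (D.cr_ne k (i + 1))
  intro h0
  have h5 : dt (cr (vn k) (vn (idx k (i + 1 + 1)))) (vn (idx k (i + 1))) = 0 := by exact_mod_cast h0
  rw [dt_comm, ] at h5
  rw [h5, mul_zero] at h2
  rcases mul_eq_zero.1 h2 with h | h
  · exact h4 h
  · exact h3.ne' h

theorem FD.CF (D : FD P n Fc vn c rk Pt idx Q) (H : EDt P n Fc m E A B fa fb) (k) :
    CFacet (vn k) (Pt k) (fun i => vn (idx k i)) (Q k) (rk k) =
      - ∑ i ∈ Finset.range (rk k), ((gcd3 (Pt k (i + 1) - Pt k i) : ℝ) / (gcd3 (cr (vn k) (vn (idx k (i + 1)))) : ℝ)) *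
        (((dt (vn k) (vn (idx k (i + 1))) : ℤ) : ℝ) / ((dt (vn k) (vn k) : ℤ) : ℝ)) := by
  have L := D.toLD.L k
  set V : V3 := toR (vn k) with hV
  set w : ℕ → V3 := fun i => toR (vn (idx k i)) with hw
  set U : ℕ → V3 := fun i => Q k (i + 1) - toR (Pt k (i + 1)) with hU
  have hface : ∀ {k' : Fin n} {y z : V3}, y ∈ Fc k' → z ∈ Fc k' → dt (y - z) (toR (vn k')) = 0 := by
    intro k' y z hy hz
    rw [D.G.desc] at hy hz
    rw [dt_comm, dt_sub, hy.2, hz.2, sub_self]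
  have u1 : ∀ i, dt (U i) (w (i + 1)) = 0 := fun i => hface (D.Q_mem H k i).1 (D.mem2 k i)
  have u2 : ∀ i, dt (U i) (w (i + 2)) = 0 := fun i => hface (D.Q_mem H k i).2 (D.mem1 k (i + 1))
  have u3 : ∀ i, dt (U i) V ≠ 0 := by
    intro i h
    have h1 := D.memF k (i + 1)
    have h2 := (D.Q_mem H k i).1
    apply (D.Qe k (i + 1)).2.1
    rw [D.G.desc] at h1 h2 ⊢
    refine ⟨h2.1, ?_⟩
    rw [dt_comm, dt_sub] at h
    linarith [h1.2]
  set ε := epsF (vn k) (fun i => vn (idx k i)) with hε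
  have εe : ∀ i, ε i = dt (cr V (w (i + 1))) (w i) := fun i => by rw [hε]; unfold epsF; rw [det3_eq]
  have ε0 : ∀ i, ε (i + 1) ≠ 0 := fun i => D.eps_ne k i
  set x : ℕ → ℝ := fun j => dt (U 0) (w j) / dt (U 0) V with hx
  have hS := Ssol_unique (aF (vn k) (fun i => vn (idx k i)) (Pt k) (Q k))
    (bF (vn k) (fun i => vn (idx k i)) (Pt k)) ε x (by simp only [hx]; rw [u1 0, zero_div])
    (by simp only [hx]; rw [u2 0, zero_div])
    (by intro j hj; obtain ⟨t, rfl⟩ := Nat.exists_eq_add_of_le' hj; exact ε0 t)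
    (by
      intro j hj
      obtain ⟨t, rfl⟩ := Nat.exists_eq_add_of_le' hj
      have hr := rel (V := V) (w0 := w (t + 1)) (w1 := w (t + 2)) (w2 := w (t + 3))
        (d := toR (Pt k (t + 3)) - toR (Pt k (t + 2))) (U := U t) (εe (t + 1)) (εe (t + 2)) (ε0 t) (ε0 (t + 1))
        (hface (D.memF k _) (D.memF k _)) (hface (D.mem2 k (t + 2)) (D.mem1 k (t + 2)))
        (by
          have := D.wd_pos k (t + 1)
          rw [← toR_sub, dt_comm, dt_toR]
          exact_mod_cast this.ne') (u1 t) (u2 t) (u3 t)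
      have h2 := congrArg (fun z => dt (U 0) z) hr
      simp only [dt_add, dt_smul] at h2
      have e1 : aF (vn k) (fun i => vn (idx k i)) (Pt k) (Q k) (t + 2) = dt (U t) (w (t + 3)) / (ε (t + 2) * dt (U t) V) := by
        unfold aF; rw [inner3_eq, inner3_eq]; rfl
      have e2 : bF (vn k) (fun i => vn (idx k i)) (Pt k) (t + 2) =
          dt (toR (Pt k (t + 3)) - toR (Pt k (t + 2))) (w (t + 1)) / (ε (t + 1) * dt (toR (Pt k (t + 3)) - toR (Pt k (t + 2))) (w (t + 2))) := by
        unfold bF; rw [inner3_eq, inner3_eq]; rfl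
      rw [e1, e2]
      generalize dt (U t) (w (t + 3)) / (ε (t + 2) * dt (U t) V) = a at *
      generalize dt (toR (Pt k (t + 3)) - toR (Pt k (t + 2))) (w (t + 1)) / (ε (t + 1) * dt (toR (Pt k (t + 3)) - toR (Pt k (t + 2))) (w (t + 2))) = b at *
      have h3 := u3 0
      show dt (U 0) (w (t + 3)) / dt (U 0) V / ε (t + 2) + dt (U 0) (w (t + 1)) / dt (U 0) V / ε (t + 1) =
        b * (dt (U 0) (w (t + 2)) / dt (U 0) V) + a
      have h4 : a = a * dt (U 0) V / dt (U 0) V := by field_simp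
      have h5 : a * dt (U 0) V = 1 / ε (t + 2) * dt (U 0) (w (t + 3)) + 1 / ε (t + 1) * dt (U 0) (w (t + 1)) - b * dt (U 0) (w (t + 2)) := by
        linarith
      rw [h5] at h4
      rw [h4]; ring)
  rw [CFacet_eq, sum_Icc_range]
  congr 1
  set vm : ℕ → ℝ := fun i => (gcd3 (Pt k (i + 1) - Pt k i) : ℝ) / (gcd3 (cr (vn k) (vn (idx k (i + 1)))) : ℝ) with hvm
  set Z : V3 := ∑ i ∈ Finset.range (rk k), vm i • w (i + 1) with hZ
  have hdZ : ∀ u : V3, dt u Z = ∑ i ∈ Finset.range (rk k), vm i * dt u (w (i + 1)) := by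
    intro u
    rw [hZ]
    induction Finset.range (rk k) using Finset.induction_on with
    | empty => simp [dt]
    | insert a s ha ih => rw [Finset.sum_insert ha, Finset.sum_insert ha, dt_add, dt_smul, ih]
  have hcZ : cr V Z = 0 := by
    have e : crL V Z = ∑ i ∈ Finset.range (rk k), vm i • cr V (w (i + 1)) := by
      rw [hZ, map_sum]
      refine Finset.sum_congr rfl fun i _ => ?_
      rw [map_smul]; rfl
    have e2 : (dlt (vn k) (Pt k) (fun i => vn (idx k i)) : ℝ) • crL V Z =
        ∑ i ∈ Finset.range (rk k), (toR (Pt k (i + 1)) - toR (Pt k i)) := by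
      rw [e, Finset.smul_sum]
      refine Finset.sum_congr rfl fun i _ => ?_
      have h := congrArg toR (D.edge k i)
      rw [toR_smul, toR_smul, toR_sub, toR_cr] at h
      have hg : ((gcd3 (cr (vn k) (vn (idx k (i + 1)))) : ℤ) : ℝ) ≠ 0 := by
        exact_mod_cast gcd3_ne (D.cr_ne k i)
      have h2 := congrArg (fun z => (((gcd3 (cr (vn k) (vn (idx k (i + 1)))) : ℤ) : ℝ))⁻¹ • z) h
      beta_reduce at h2
      rw [smul_smul, inv_mul_cancel₀ hg, one_smul] at h2
      rw [h2, smul_smul, smul_smul]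
      congr 1
      simp only [hvm]
      push_cast
      ring
    rw [Finset.sum_range_sub (fun i => toR (Pt k i)), ] at e2
    have hp := D.per k 0
    rw [zero_add] at hp
    rw [hp, sub_self] at e2
    rcases smul_eq_zero.1 e2 with h | h
    · rcases L.dlt_cases with h' | h' <;> rw [h'] at h <;> norm_num at h
    · exact h
  have hVV : dt V V ≠ 0 := (dt_self_pos (D.G.vne k)).ne'
  have hZV : Z = (dt V Z / dt V V) • V := by
    have h := cr_cr V V Z
    rw [hcZ] at h
    have h0 : cr V (0 : V3) = 0 := by apply vec_ext <;> simp
    rw [h0] at h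
    have h2 : dt V V • Z = dt V Z • V := (sub_eq_zero.1 h.symm).symm
    rw [div_eq_inv_mul, mul_smul, ← h2, smul_smul, inv_mul_cancel₀ hVV, one_smul]
  have hfin : dt (U 0) Z / dt (U 0) V = dt V Z / dt V V := by
    have h := congrArg (fun z => dt (U 0) z) hZV
    beta_reduce at h
    rw [dt_smul] at h
    rw [h, mul_div_assoc, div_self (u3 0), mul_one]
  rw [hdZ, hdZ, Finset.sum_div, Finset.sum_div] at hfin
  refine Eq.trans ?_ (hfin.trans ?_)
  · refine Finset.sum_congr rfl fun i _ => ?_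
    rw [← hS (i + 1) (by omega), mIndex_eq (D.G.prim k) (D.cr_ne k i)]
    simp only [hx, hvm, Nat.add_sub_cancel]
    ring
  · refine Finset.sum_congr rfl fun i _ => ?_
    simp only [hV, hw]
    rw [dt_toR, dt_toR, mul_div_assoc]

theorem FD.cr_fab (D : FD P n Fc vn c rk Pt idx Q) (H : EDt P n Fc m E A B fa fb) (j) :
    cr (vn (fa j)) (vn (fb j)) ≠ 0 := by
  intro h
  rcases prim_eq_or_neg (D.G.prim _) (D.G.prim _) h with h | h
  · exact (H.fac j).1 (D.G.vinj h).symm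
  · exact D.G.not_neg h (H.memA j).1 (H.memA j).2

theorem FD.sumCF (D : FD P n Fc vn c rk Pt idx Q) (H : EDt P n Fc m E A B fa fb) :
    ∑ k, CFacet (vn k) (Pt k) (fun i => vn (idx k i)) (Q k) (rk k) =
      - ∑ j, 12 * ((gcd3 (B j - A j) : ℝ) * nu (vn (fa j)) (vn (fb j))) := by
  rw [Finset.sum_congr rfl fun k _ => D.CF H k, Finset.sum_neg_distrib]
  congr 1
  have := D.bij H (fun a b Y Z => ((gcd3 (Z - Y) : ℝ) / (gcd3 (cr (vn a) (vn b)) : ℝ)) *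
        (((dt (vn a) (vn b) : ℤ) : ℝ) / ((dt (vn a) (vn a) : ℤ) : ℝ)))
    (fun j => by beta_reduce; rw [gcd3_sub_comm]) (fun j => by beta_reduce; rw [gcd3_sub_comm])
  rw [this]
  refine Finset.sum_congr rfl fun j _ => ?_
  unfold nu
  rw [gcd3_cr_comm (vn (fa j)) (vn (fb j)), dt_comm (vn (fb j)) (vn (fa j))]
  ring

theorem FD.sumTh (D : FD P n Fc vn c rk Pt idx Q) (H : EDt P n Fc m E A B fa fb) {R : V3} (hR : Gen R) {O : Z3}
    (hO : ∀ k, dt (vn k) O ≠ c k) :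
    ∑ k, (dlt (vn k) (Pt k) (fun i => vn (idx k i)) : ℝ) *
      ∑ j ∈ Finset.Icc 2 (rk k - 1), thS R (tV O (Pt k) j) (tn (vn k) O (Pt k) j) =
    ∑ j, Mv R (A j) (B j) (vn (fa j)) (vn (fb j)) := by
  rw [Finset.sum_congr rfl fun k _ => D.dlt_sum hR hO k]
  have a1 : ∀ j, dt (vn (fa j)) (A j) = c (fa j) := fun j => D.val (H.memA j).1
  have a2 : ∀ j, dt (vn (fb j)) (A j) = c (fb j) := fun j => D.val (H.memA j).2
  have b1 : ∀ j, dt (vn (fa j)) (B j) = c (fa j) := fun j => D.val (H.memB j).1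
  have b2 : ∀ j, dt (vn (fb j)) (B j) = c (fb j) := fun j => D.val (H.memB j).2
  rw [D.bij H (Phi R O vn)
    (fun j => Phi_symm hR (D.G.prim _) (by rw [a1, b1]) (by rw [a1]; exact (hO _).symm) (H.seg j).1)
    (fun j => Phi_symm hR (D.G.prim _) (by rw [a2, b2]) (by rw [a2]; exact (hO _).symm) (H.seg j).1)]
  refine Finset.sum_congr rfl fun j _ => ?_
  exact Phi_pair hR (D.G.prim _) (D.G.prim _) (by rw [a1, b1]) (by rw [a2, b2]) (by rw [a1]; exact (hO _).symm)
    (H.seg j).1 (D.cr_fab H j)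

theorem count_zero {P : Set V3} (hne : P.Nonempty) : latticeCount P 0 = 1 := by
  unfold latticeCount
  rw [Set.ncard_eq_one]
  refine ⟨0, ?_⟩
  ext p
  rw [Set.mem_ofPred_eq, Nat.cast_zero, Set.zero_smul_set hne, Set.mem_zero, Set.mem_singleton_iff]
  constructor
  · intro h
    funext i
    have := congrFun h i
    simpa [toR] using this
  · rintro rfl
    funext i; simp [toR]

end

/-- **Main theorem.** Let `P ⊂ ℝ³` be a 3-dimensional simple integral convex polytope with
edges `E_1, …, E_m` and facets `F_1, …, F_n`. Then there exist rationals `c₃, c₂` such that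
for every nonnegative integer `l`,
`|(lP) ∩ ℤ³| = c₃ l³ + c₂ l² + c₁ l + 1`, where
`c₁ = ∑_{j=1}^m (s(E_j) + 1/4) Vol(E_j) + (1/12) ∑_{k=1}^n C(F_k)`.
Here `Vol(E_j)` is the relative volume (lattice length) of the edge `E_j` with lattice
endpoints `A j`, `B j` (namely `gcd3 (B j - A j)`), `s(E_j)` is the Dedekind sum `s(p, q)`
attached to the edge `E_j = F_{fa j} ∩ F_{fb j}` via an adapted basis of
`(ℝ v_{fa j} + ℝ v_{fb j}) ∩ ℤ³`, and `C(F_k)` is computed from a labeling of the vertices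
and adjacent facets around `F_k`. -/
theorem ehrhart_linear_coefficient
    (Vs : Finset (Fin 3 → ℤ)) (hVs : Vs.Nonempty)
    (P : Set (Fin 3 → ℝ)) (hP : P = convexHull ℝ (toR '' (Vs : Set (Fin 3 → ℤ))))
    (hfull : affineSpan ℝ P = ⊤) (hsimple : IsSimple P)
    (m n : ℕ) (E : Fin m → Set (Fin 3 → ℝ)) (Fc : Fin n → Set (Fin 3 → ℝ))
    (hE_inj : Function.Injective E) (hFc_inj : Function.Injective Fc)
    (hE : ∀ j, IsEdgeOf P (E j)) (hE_all : ∀ S, IsEdgeOf P S → ∃ j, S = E j)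
    (hFc : ∀ k, IsFacetOf P (Fc k)) (hFc_all : ∀ S, IsFacetOf P S → ∃ k, S = Fc k)
    (vn : Fin n → Fin 3 → ℤ) (hvn : ∀ k, IsInwardNormal P (Fc k) (vn k))
    (A B : Fin m → Fin 3 → ℤ)
    (hAB : ∀ j, A j ≠ B j ∧ E j = segment ℝ (toR (A j)) (toR (B j)))
    (fa fb : Fin m → Fin n)
    (hfafb : ∀ j, fa j ≠ fb j ∧ E j = Fc (fa j) ∩ Fc (fb j))
    (sE : Fin m → ℚ)
    (hsE : ∀ j, ∃ (e₁ e₂ : Fin 3 → ℤ) (p q : ℤ),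
      IsZBasisOf (planeLattice (vn (fa j)) (vn (fb j))) e₁ e₂ ∧
      vn (fa j) = e₁ ∧ vn (fb j) = p • e₁ + q • e₂ ∧ 0 ≤ p ∧ p < q ∧
      sE j = dedekindSum p q)
    (rk : Fin n → ℕ) (Pt : (k : Fin n) → ℕ → Fin 3 → ℤ)
    (Fk : (k : Fin n) → ℕ → Set (Fin 3 → ℝ)) (vk : (k : Fin n) → ℕ → Fin 3 → ℤ)
    (Q : (k : Fin n) → ℕ → Fin 3 → ℝ)
    (hlab : ∀ k, FacetLabeling P (Fc k) (vn k) (rk k) (Pt k) (Fk k) (vk k) (Q k)) :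
    ∃ c₃ c₂ : ℚ, ∀ l : ℕ,
      (latticeCount P l : ℝ) =
        (c₃ : ℝ) * (l : ℝ) ^ 3 + (c₂ : ℝ) * (l : ℝ) ^ 2 +
          ((∑ j, ((sE j : ℝ) + 1 / 4) * (gcd3 (B j - A j) : ℝ)) +
            (1 / 12) * ∑ k, CFacet (vn k) (Pt k) (vk k) (Q k) (rk k)) * (l : ℝ) + 1 := by
  obtain ⟨c, idx, D, hvk⟩ := build_FD Vs P hP hfull hsimple n Fc hFc_inj hFc hFc_all vn hvn rk Pt Fk vk Q hlab
  have H : EDt P n Fc m E A B fa fb := ⟨hE_inj, hE_all, hAB, hfafb⟩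
  obtain ⟨O, hOP, hO⟩ := exists_O (c := c) D.G.compact.isBounded (fun k => prim_ne_zero (D.G.prim k))
  obtain ⟨R, hRi, hR⟩ := exists_gen isOpen_interior D.G.int_ne
  obtain ⟨c3, c2, hc⟩ := D.toLD.count hOP hO hR (interior_subset hRi)
  refine ⟨c3, c2, fun l => ?_⟩
  rcases Nat.eq_zero_or_pos l with rfl | hl
  · rw [count_zero (D.G.int_ne.mono interior_subset)]
    simp
  rw [hc l hl, D.sumTh H hR hO]
  have hCF : ∑ k, CFacet (vn k) (Pt k) (vk k) (Q k) (rk k) =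
      - ∑ j, 12 * ((gcd3 (B j - A j) : ℝ) * nu (vn (fa j)) (vn (fb j))) := by
    rw [← D.sumCF H]
    refine Finset.sum_congr rfl fun k _ => ?_
    rw [show vk k = fun i => vn (idx k i) from funext (hvk k)]
  rw [hCF]
  congr 3
  have e12 : ∀ x : ℝ, (1 / 12 : ℝ) * -(12 * x) = -x := fun x => by ring
  rw [← Finset.mul_sum, e12, ← Finset.sum_neg_distrib, ← Finset.sum_add_distrib]
  refine Finset.sum_congr rfl fun j _ => ?_
  obtain ⟨e₁, e₂, p, q, hb, h1, h2, hp, hpq, hs⟩ := hsE j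
  have hpos : ∀ k, dt (vn k) (A j) = c k → 0 < dt (toR (vn k)) (R - toR (A j)) := by
    intro k hk
    have h3 := D.G.int_pos hRi k
    rw [dt_sub, dt_toR, hk]
    linarith
  unfold Mv
  rw [edge_kap (D.G.prim _) (D.G.prim _) hb h1 h2 hp hpq (hpos _ (D.val (H.memA j).1))
    (hpos _ (D.val (H.memA j).2)), hs]
  ring

end
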